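/- Provided α > 0 is sufficiently small, the following holds: for any admissible curve X : [0,1) → B and Lebesgue-a.e. θ ∈ [0,1), χ₋(θ, X(θ)) := liminf_{n→∞} (1/n)·log|∂f_n(θ, X(θ))/∂x| > 0. -/

import Mathlib

open Set MeasureTheory Filter
open scoped ENNReal

noncomputable section

/-- The quadratic map `f(x) = a - x²`. -/
def qm (a : ℝ) : ℝ → ℝ := fun x => a - x ^ 2

/-- The critical point `0` of `qm a` is strictly pre-periodic: its forward orbit never
returns to `0` and is eventually periodic. -/
def StrictlyPreperiodic (a : ℝ) : Prop :=
  (∀ i : ℕ, 1 ≤ i → (qm a)^[i] 0 ≠ 0) ∧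
    ∃ m p : ℕ, 1 ≤ m ∧ 1 ≤ p ∧ (qm a)^[m + p] 0 = (qm a)^[m] 0

/-- A lift of the Viana skew product `F(θ, x) = (dθ, f(x) + αφ(θ))` to `ℝ × ℝ`;
for `φ` of period `1` this is a lift of the corresponding map of `(ℝ/ℤ) × ℝ`. -/
def Viana (a : ℝ) (d : ℕ) (φ : ℝ → ℝ) (α : ℝ) : ℝ × ℝ → ℝ × ℝ :=
  fun p => ((d : ℝ) * p.1, qm a p.2 + α * φ p.1)

/-- The fibre maps `f_n`, defined by `F^n(θ, x) = (d^n θ, f_n(θ, x))`. -/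
def fn (a : ℝ) (d : ℕ) (φ : ℝ → ℝ) (α : ℝ) (n : ℕ) (θ x : ℝ) : ℝ :=
  ((Viana a d φ α)^[n] (θ, x)).2

/-- A curve `X : [0,1) → B = [-β, β]` is admissible if it is the image of a horizontal curve
under `F^n` for some `n ≥ n₀ + 1`: there are `ω = [j/dⁿ, (j+1)/dⁿ) ∈ 𝒫_n` and `x₀ ∈ B` with
`X(dⁿθ mod 1) = f_n(θ, x₀)` for all `θ ∈ ω`; equivalently `X(t) = f_n((t+j)/dⁿ, x₀)` on `[0,1)`. -/
def Admissible (a : ℝ) (d : ℕ) (φ : ℝ → ℝ) (α β : ℝ) (n₀ : ℕ) (X : ℝ → ℝ) : Prop :=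
  ∃ n : ℕ, n₀ + 1 ≤ n ∧ ∃ j : ℕ, j < d ^ n ∧ ∃ x₀ ∈ Set.Icc (-β) β,
    ∀ θ ∈ Set.Ico (0 : ℝ) 1, X θ = fn a d φ α n ((θ + j) / (d : ℝ) ^ n) x₀

/-- The product of the absolute derivatives of the quadratic map along a sequence of points. -/
def dprod (x : ℕ → ℝ) (k : ℕ) : ℝ := ∏ i ∈ Finset.range k, |2 * x i|

lemma dprod_zero (x : ℕ → ℝ) : dprod x 0 = 1 := by simp [dprod]

lemma dprod_succ (x : ℕ → ℝ) (k : ℕ) : dprod x (k + 1) = dprod x k * |2 * x k| := by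
  simp [dprod, Finset.prod_range_succ]

lemma dprod_nonneg (x : ℕ → ℝ) (k : ℕ) : 0 ≤ dprod x k :=
  Finset.prod_nonneg fun _ _ => abs_nonneg _

lemma dprod_add (x : ℕ → ℝ) (m n : ℕ) :
    dprod x (m + n) = dprod x m * dprod (fun i => x (m + i)) n := by
  simp [dprod, Finset.prod_range_add]

lemma dprod_pos {x : ℕ → ℝ} {k : ℕ} (h : ∀ i < k, x i ≠ 0) : 0 < dprod x k :=
  Finset.prod_pos fun i hi => abs_pos.2 (mul_ne_zero two_ne_zero (h i (Finset.mem_range.1 hi)))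

lemma ne_zero_of_dprod_ne_zero {x : ℕ → ℝ} {k : ℕ} (h : dprod x k ≠ 0) {i : ℕ} (hi : i < k) :
    x i ≠ 0 := by
  intro h0
  exact h (Finset.prod_eq_zero (Finset.mem_range.2 hi) (by simp [h0]))

lemma dprod_ge_pow {x : ℕ → ℝ} {k : ℕ} {c : ℝ} (hc : 0 ≤ c) (h : ∀ i < k, c ≤ |2 * x i|) :
    c ^ k ≤ dprod x k := by
  induction k with
  | zero => simp [dprod_zero]
  | succ k ih =>
    rw [dprod_succ, pow_succ]
    exact mul_le_mul (ih fun i hi => h i (by omega)) (h k (by omega)) hc (dprod_nonneg _ _)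

lemma dprod_le_pow {x : ℕ → ℝ} {k : ℕ} {c : ℝ} (h : ∀ i < k, |2 * x i| ≤ c) :
    dprod x k ≤ c ^ k := by
  induction k with
  | zero => simp [dprod_zero]
  | succ k ih =>
    rw [dprod_succ, pow_succ]
    exact mul_le_mul (ih fun i hi => h i (by omega)) (h k (by omega)) (abs_nonneg _)
      (pow_nonneg ((abs_nonneg _).trans (h k (by omega))) _)

lemma continuous_qm (a : ℝ) : Continuous (qm a) := by unfold qm; fun_prop

lemma qm_sub (a x y : ℝ) : qm a x - qm a y = -(x + y) * (x - y) := by unfold qm; ring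

/-- The infinitesimal Hilbert length at `x` of the interval with endpoints `l`, `r`. -/
def hlen (l x r : ℝ) : ℝ := |r - l| / ((x - l) * (r - x))

lemma hlen_eq {l x r : ℝ} (h : 0 < (x - l) * (r - x)) : hlen l x r = 1 / |x - l| + 1 / |r - x| := by
  have h1 : x - l ≠ 0 := fun h0 => by simp [h0] at h
  have h2 : r - x ≠ 0 := fun h0 => by simp [h0] at h
  have h3 : |r - l| = |x - l| + |r - x| := by
    rw [show r - l = (x - l) + (r - x) by ring]
    exact abs_add_eq_add_abs_iff _ _ |>.2 (by
      rcases pos_and_pos_or_neg_and_neg_of_mul_pos h with h | h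
      · exact Or.inl ⟨h.1.le, h.2.le⟩
      · exact Or.inr ⟨h.1.le, h.2.le⟩)
  have h4 : (x - l) * (r - x) = |x - l| * |r - x| := by rw [← abs_mul, abs_of_pos h]
  unfold hlen
  rw [h3, h4]
  have := abs_pos.2 h1
  have := abs_pos.2 h2
  field_simp
  ring

lemma hlen_pos {l x r : ℝ} (h : 0 < (x - l) * (r - x)) : 0 < hlen l x r := by
  have h1 : x - l ≠ 0 := fun h0 => by simp [h0] at h
  have h2 : r - x ≠ 0 := fun h0 => by simp [h0] at h
  rw [hlen_eq h]
  have := abs_pos.2 h1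
  have := abs_pos.2 h2
  positivity

/-- One step of the Hilbert length comparison. -/
lemma hlen_step (a : ℝ) {l x r : ℝ} (h : 0 < (x - l) * (r - x)) (hl : 0 ≤ l * x) (hr : 0 ≤ r * x)
    (hx : x ≠ 0) (hl2 : |l| ≤ 2) (hx2 : |x| ≤ 2) (hr2 : |r| ≤ 2) :
    0 < (qm a x - qm a l) * (qm a r - qm a x) ∧
      hlen l x r * (1 + (x - l) * (r - x) / 16) ≤ hlen (qm a l) (qm a x) (qm a r) * |2 * x| := by
  have hxx : 0 < x ^ 2 := by positivity
  have hs : 0 < (x + l) * (x + r) := by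
    have e : (x + l) * (x + r) * x ^ 2 = (x ^ 2 + l * x) * (x ^ 2 + r * x) := by ring
    have : 0 < (x + l) * (x + r) * x ^ 2 := by rw [e]; positivity
    exact pos_of_mul_pos_left this hxx.le
  have hs16 : (x + l) * (x + r) ≤ 16 := by
    rw [abs_le] at *
    have h1 : |x + l| ≤ 4 := abs_le.2 ⟨by linarith, by linarith⟩
    have h2 : |x + r| ≤ 4 := abs_le.2 ⟨by linarith, by linarith⟩
    calc (x + l) * (x + r) ≤ |(x + l) * (x + r)| := le_abs_self _
      _ = |x + l| * |x + r| := abs_mul _ _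
      _ ≤ 4 * 4 := mul_le_mul h1 h2 (abs_nonneg _) (by norm_num)
      _ = 16 := by norm_num
  have e1 : (qm a x - qm a l) * (qm a r - qm a x) = ((x - l) * (r - x)) * ((x + l) * (x + r)) := by
    unfold qm; ring
  refine ⟨by rw [e1]; positivity, ?_⟩
  unfold hlen
  rw [e1]
  have e2 : |qm a r - qm a l| * |2 * x| = |r - l| * ((x + l) * (x + r) + (x - l) * (r - x)) := by
    rw [qm_sub, ← abs_mul, show -(r + l) * (r - l) * (2 * x) =
      -((r - l) * ((x + l) * (x + r) + (x - l) * (r - x))) by ring, abs_neg, abs_mul,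
      abs_of_pos (by positivity : 0 < (x + l) * (x + r) + (x - l) * (r - x))]
  set A := (x - l) * (r - x)
  set S := (x + l) * (x + r)
  rw [div_mul_eq_mul_div, div_mul_eq_mul_div, e2, div_le_div_iff₀ h (by positivity)]
  have : (1 + A / 16) * S ≤ S + A := by
    have := mul_le_mul_of_nonneg_left hs16 h.le
    nlinarith
  have h5 : 0 ≤ |r - l| * A := mul_nonneg (abs_nonneg _) h.le
  nlinarith [mul_le_mul_of_nonneg_left this h5]

/-- A continuous function without zeros in an open interval has one sign on the closed one. -/
lemma mul_nonneg_of_no_zero {g : ℝ → ℝ} (hg : Continuous g) {l r x t : ℝ}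
    (hx : x ∈ Ioo l r) (ht : t = l ∨ t = r) (h0 : ∀ y ∈ Ioo l r, g y ≠ 0) : 0 ≤ g t * g x := by
  by_contra hneg
  push Not at hneg
  have key : ∃ y ∈ Ioo l r, g y = 0 := by
    have h1 : (g t < 0 ∧ 0 < g x) ∨ (0 < g t ∧ g x < 0) := by
      rcases mul_neg_iff.1 hneg with h | h
      · exact Or.inr h
      · exact Or.inl h
    rcases ht with rfl | rfl
    · rcases h1 with h1 | h1
      · obtain ⟨y, hy, hy0⟩ := intermediate_value_Ioo hx.1.le hg.continuousOn (show (0:ℝ) ∈ Ioo (g t) (g x) from h1)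
        exact ⟨y, ⟨hy.1, hy.2.trans hx.2⟩, hy0⟩
      · obtain ⟨y, hy, hy0⟩ := intermediate_value_Ioo' hx.1.le hg.continuousOn (show (0:ℝ) ∈ Ioo (g x) (g t) from ⟨h1.2, h1.1⟩)
        exact ⟨y, ⟨hy.1, hy.2.trans hx.2⟩, hy0⟩
    · rcases h1 with h1 | h1
      · obtain ⟨y, hy, hy0⟩ := intermediate_value_Ioo' hx.2.le hg.continuousOn (show (0:ℝ) ∈ Ioo (g t) (g x) from h1)
        exact ⟨y, ⟨hx.1.trans hy.1, hy.2⟩, hy0⟩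
      · obtain ⟨y, hy, hy0⟩ := intermediate_value_Ioo hx.2.le hg.continuousOn (show (0:ℝ) ∈ Ioo (g x) (g t) from ⟨h1.2, h1.1⟩)
        exact ⟨y, ⟨hx.1.trans hy.1, hy.2⟩, hy0⟩
  obtain ⟨y, hy, hy0⟩ := key
  exact h0 y hy hy0

/-- The orbit of a point under the quadratic map. -/
def orb (a x : ℝ) (i : ℕ) : ℝ := (qm a)^[i] x

lemma orb_zero (a x : ℝ) : orb a x 0 = x := rfl

lemma orb_succ (a x : ℝ) (i : ℕ) : orb a x (i + 1) = qm a (orb a x i) :=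
  Function.iterate_succ_apply' _ _ _

lemma orb_add (a x : ℝ) (i j : ℕ) : orb a x (i + j) = orb a (orb a x i) j := by
  unfold orb; rw [add_comm, Function.iterate_add_apply]

lemma continuous_orb (a : ℝ) (i : ℕ) : Continuous (fun x => orb a x i) :=
  (continuous_qm a).iterate i

/-- The Hilbert length comparison along an interval on which `f^n` is monotone. -/
lemma hlen_chain {a l x r : ℝ} (n : ℕ) (hx : x ∈ Ioo l r)
    (hab : ∀ t ∈ Icc l r, ∀ i, |orb a t i| ≤ 2)
    (h0 : ∀ i < n, ∀ y ∈ Ioo l r, orb a y i ≠ 0) :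
    0 < (orb a x n - orb a l n) * (orb a r n - orb a x n) ∧
      (0 < (orb a r n - orb a x n) * ∏ i ∈ Finset.range n, (-(2 * orb a x i))) ∧
      hlen l x r ≤ hlen (orb a l n) (orb a x n) (orb a r n) * dprod (orb a x) n ∧
      (1 ≤ n → hlen l x r * (1 + (x - l) * (r - x) / 16) ≤
        hlen (orb a l n) (orb a x n) (orb a r n) * dprod (orb a x) n) := by
  have hl : l ∈ Icc l r := ⟨le_rfl, (hx.1.trans hx.2).le⟩
  have hr : r ∈ Icc l r := ⟨(hx.1.trans hx.2).le, le_rfl⟩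
  have hx' : x ∈ Icc l r := ⟨hx.1.le, hx.2.le⟩
  have hA : 0 < (x - l) * (r - x) := mul_pos (sub_pos.2 hx.1) (sub_pos.2 hx.2)
  induction n with
  | zero =>
    refine ⟨by simpa [orb_zero] using hA, ?_, by simp [orb_zero, dprod_zero], by simp⟩
    simpa [orb_zero] using hx.2
  | succ n ih =>
    obtain ⟨i1, i2, i3, i4⟩ := ih fun i hi => h0 i (by omega)
    have hxn := h0 n (by omega) x hx
    have sl := mul_nonneg_of_no_zero (continuous_orb a n) hx (Or.inl rfl) (h0 n (by omega))
    have sr := mul_nonneg_of_no_zero (continuous_orb a n) hx (Or.inr rfl) (h0 n (by omega))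
    obtain ⟨s1, s2⟩ := hlen_step a i1 sl sr hxn (hab l hl n) (hab x hx' n) (hab r hr n)
    simp only [orb_succ, dprod_succ]
    have hd := dprod_nonneg (orb a x) n
    have hp := hlen_pos i1
    have s3 : hlen (orb a l n) (orb a x n) (orb a r n) * dprod (orb a x) n ≤
        hlen (qm a (orb a l n)) (qm a (orb a x n)) (qm a (orb a r n)) *
          (dprod (orb a x) n * |2 * orb a x n|) := by
      have : hlen (orb a l n) (orb a x n) (orb a r n) ≤ 
        hlen (qm a (orb a l n)) (qm a (orb a x n)) (qm a (orb a r n)) * |2 * orb a x n| := by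
        refine le_trans ?_ s2
        nlinarith
      nlinarith
    refine ⟨s1, ?_, i3.trans s3, fun _ => ?_⟩
    · rw [Finset.prod_range_succ, qm_sub]
      set Q := ∏ i ∈ Finset.range n, (-(2 * orb a x i))
      have e : -(orb a r n + orb a x n) * (orb a r n - orb a x n) * (Q * -(2 * orb a x n)) =
        ((orb a r n - orb a x n) * Q) * (2 * (orb a r n * orb a x n + orb a x n ^ 2)) := by ring
      rw [e]
      have : 0 < orb a x n ^ 2 := by positivity
      positivity
    · rcases Nat.eq_zero_or_pos n with rfl | hn
      · simp only [orb_zero, dprod_zero, one_mul] at s2 ⊢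
        exact s2
      · exact (i4 hn).trans s3

/-- A point outside a closed set with points of the set on both sides lies in a gap. -/
lemma exists_gap {Z : Set ℝ} (hZ : IsClosed Z) {x u v : ℝ} (hu : u ∈ Z) (hv : v ∈ Z)
    (hux : u < x) (hxv : x < v) (hx : x ∉ Z) :
    ∃ l ∈ Z, ∃ r ∈ Z, u ≤ l ∧ r ≤ v ∧ x ∈ Ioo l r ∧ ∀ y ∈ Ioo l r, y ∉ Z := by
  have h1 : IsCompact (Z ∩ Icc u x) := isCompact_Icc.inter_left hZ
  have h2 : IsCompact (Z ∩ Icc x v) := isCompact_Icc.inter_left hZ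
  obtain ⟨l, hl, hl'⟩ := h1.exists_isGreatest ⟨u, hu, le_rfl, hux.le⟩
  obtain ⟨r, hr, hr'⟩ := h2.exists_isLeast ⟨v, hv, hxv.le, le_rfl⟩
  have hlx : l < x := lt_of_le_of_ne hl.2.2 fun h => hx (h ▸ hl.1)
  have hxr : x < r := lt_of_le_of_ne hr.2.1 fun h => hx (h ▸ hr.1)
  refine ⟨l, hl.1, r, hr.1, hl.2.1, hr.2.2, ⟨hlx, hxr⟩, fun y hy hyZ => ?_⟩
  rcases le_total y x with h | h
  · exact absurd (hl' ⟨hyZ, hl.2.1.trans hy.1.le, h⟩) (not_le.2 hy.1)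
  · exact absurd (hr' ⟨hyZ, h, hy.2.le.trans hr.2.2⟩) (not_le.2 hy.2)

lemma dprod_one (x : ℕ → ℝ) : dprod x 1 = |2 * x 0| := by simp [dprod]

/-- Standing facts on a strictly preperiodic quadratic map and its fixed point `-P`. -/
structure Misiurewicz (a P : ℝ) : Prop where
  one_lt : 1 < a
  lt_two : a < 2
  fixed : P ^ 2 = a + P
  one_lt_P : 1 < P
  pre : StrictlyPreperiodic a

namespace Misiurewicz

variable {a P : ℝ} (h : Misiurewicz a P)
include h

lemma P_lt_two : P < 2 := by nlinarith [h.fixed, h.lt_two, h.one_lt_P]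

lemma a_lt_P : a < P := by nlinarith [h.fixed, h.P_lt_two, h.one_lt_P]

lemma qm_mem {x : ℝ} (hx : x ∈ Icc (-P) P) : qm a x ∈ Icc (-P) P := by
  have := h.a_lt_P
  have := h.fixed
  unfold qm
  constructor
  · nlinarith [hx.1, hx.2]
  · nlinarith [sq_nonneg x]

lemma orb_mem {x : ℝ} (hx : x ∈ Icc (-P) P) (i : ℕ) : orb a x i ∈ Icc (-P) P := by
  induction i with
  | zero => exact hx
  | succ i ih => rw [orb_succ]; exact h.qm_mem ih

lemma qm_mem_Ioo {x : ℝ} (hx : x ∈ Ioo (-P) P) : qm a x ∈ Ioo (-P) P := by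
  have := h.a_lt_P
  have := h.fixed
  unfold qm
  constructor
  · nlinarith [hx.1, hx.2]
  · nlinarith [sq_nonneg x]

lemma orb_mem_Ioo {x : ℝ} (hx : x ∈ Ioo (-P) P) (i : ℕ) : orb a x i ∈ Ioo (-P) P := by
  induction i with
  | zero => exact hx
  | succ i ih => rw [orb_succ]; exact h.qm_mem_Ioo ih

lemma abs_orb_le {x : ℝ} (hx : x ∈ Icc (-P) P) (i : ℕ) : |orb a x i| ≤ 2 := by
  have := h.orb_mem hx i
  have := h.P_lt_two
  exact abs_le.2 ⟨by linarith [(h.orb_mem hx i).1], by linarith [(h.orb_mem hx i).2]⟩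

lemma zero_mem : (0 : ℝ) ∈ Ioo (-P) P := ⟨by linarith [h.one_lt_P], by linarith [h.one_lt_P]⟩

lemma qm_P : qm a P = -P := by unfold qm; linarith [h.fixed]

lemma qm_neg_P : qm a (-P) = -P := by unfold qm; linarith [h.fixed]

lemma orb_neg_P (n : ℕ) : orb a (-P) n = -P := by
  induction n with
  | zero => rfl
  | succ n ih => rw [orb_succ, ih, h.qm_neg_P]

lemma orb_P (n : ℕ) : orb a P n = P ∨ orb a P n = -P := by
  cases n with
  | zero => exact Or.inl rfl
  | succ n => right; rw [add_comm, orb_add, orb_succ, orb_zero, h.qm_P, h.orb_neg_P]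

omit h in
/-- The postcritical set together with the ends of the invariant interval. -/
def postcrit (a P : ℝ) : Set ℝ := range (orb a 0) ∪ {P, -P}

omit h in
lemma orb_zero_mem (k : ℕ) : orb a 0 k ∈ postcrit a P := Or.inl ⟨k, rfl⟩

omit h in
lemma P_mem : P ∈ postcrit a P := Or.inr (Or.inl rfl)

omit h in
lemma neg_P_mem : -P ∈ postcrit a P := Or.inr (Or.inr rfl)

lemma orb_postcrit {y : ℝ} (hy : y ∈ postcrit a P) (n : ℕ) : orb a y n ∈ postcrit a P := by
  rcases hy with ⟨k, rfl⟩ | rfl | rfl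
  · rw [← orb_add]; exact orb_zero_mem _
  · rcases h.orb_P n with h1 | h1 <;> rw [h1]
    exacts [P_mem, neg_P_mem]
  · rw [h.orb_neg_P]; exact neg_P_mem

lemma exists_period : ∃ m p : ℕ, 1 ≤ m ∧ 1 ≤ p ∧ ∀ k, m ≤ k → orb a 0 (k + p) = orb a 0 k := by
  obtain ⟨-, m, p, hm, hp, e⟩ := h.pre
  refine ⟨m, p, hm, hp, fun k hk => ?_⟩
  obtain ⟨j, rfl⟩ := Nat.exists_eq_add_of_le hk
  have e' : orb a 0 (m + p) = orb a 0 m := e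
  rw [show m + j + p = (m + p) + j by ring, orb_add a 0 (m + p), e', ← orb_add]

lemma finite_postcrit : (postcrit a P).Finite := by
  obtain ⟨m, p, hm, hp, e⟩ := h.exists_period
  refine Set.Finite.union ?_ (by simp)
  refine ((Finset.range (m + p)).finite_toSet.image (orb a 0)).subset ?_
  rintro _ ⟨k, rfl⟩
  induction k using Nat.strong_induction_on with
  | _ k ih =>
    by_cases hk : k < m + p
    · exact ⟨k, by simpa using hk, rfl⟩
    · have := e (k - p) (by omega)
      rw [show k - p + p = k by omega] at this
      rw [this]
      exact ih (k - p) (by omega)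

lemma orb_zero_ne {k : ℕ} (hk : 1 ≤ k) : orb a 0 k ≠ 0 := h.pre.1 k hk

omit h in
lemma orb_of_zero {y : ℝ} {i n : ℕ} (hi : i ≤ n) (hy : orb a y i = 0) :
    orb a y n = orb a 0 (n - i) := by
  obtain ⟨j, rfl⟩ := Nat.exists_eq_add_of_le hi
  rw [orb_add, hy]; simp

/-- The maximal interval inside `[u, v]` around `x` on which `f^n` is monotone. -/
lemma exists_monotone_interval {u v x : ℝ} (n : ℕ) (hu : -P ≤ u) (hv : v ≤ P) (hx : x ∈ Ioo u v)
    (h0 : ∀ i < n, orb a x i ≠ 0) :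
    ∃ l r, u ≤ l ∧ r ≤ v ∧ x ∈ Ioo l r ∧ (l = u ∨ ∃ i < n, orb a l i = 0) ∧
      (r = v ∨ ∃ i < n, orb a r i = 0) ∧ 
      0 < (orb a x n - orb a l n) * (orb a r n - orb a x n) ∧
      (0 < (orb a r n - orb a x n) * ∏ i ∈ Finset.range n, (-(2 * orb a x i))) ∧
      hlen l x r ≤ hlen (orb a l n) (orb a x n) (orb a r n) * dprod (orb a x) n ∧
      (1 ≤ n → hlen l x r * (1 + (x - l) * (r - x) / 16) ≤
        hlen (orb a l n) (orb a x n) (orb a r n) * dprod (orb a x) n) := by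
  set Z : Set ℝ := {u, v} ∪ ⋃ i ∈ Finset.range n, {y | orb a y i = 0}
  have hZ : IsClosed Z := by
    refine IsClosed.union (Set.Finite.isClosed (by simp)) ?_
    refine Set.Finite.isClosed_biUnion (Finset.finite_toSet _) fun i _ => ?_
    exact isClosed_singleton.preimage (continuous_orb a i)
  have hxZ : x ∉ Z := by
    rintro ((rfl | rfl) | hxz)
    · exact lt_irrefl _ hx.1
    · exact lt_irrefl _ hx.2
    · simp only [Finset.mem_range, mem_iUnion, mem_ofPred_eq] at hxz
      obtain ⟨i, hi, hi0⟩ := hxz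
      exact h0 i hi hi0
  obtain ⟨l, hl, r, hr, hul, hrv, hxlr, hgap⟩ := exists_gap hZ (Or.inl (Or.inl rfl)) (Or.inl (Or.inr rfl))
    hx.1 hx.2 hxZ
  have hsub : ∀ i < n, ∀ y ∈ Ioo l r, orb a y i ≠ 0 := by
    intro i hi y hy hy0
    exact hgap y hy (Or.inr (by simp only [Finset.mem_range, mem_iUnion, mem_ofPred_eq]; exact ⟨i, hi, hy0⟩))
  have hch := hlen_chain n hxlr (fun t ht i => h.abs_orb_le ⟨by linarith [ht.1], by linarith [ht.2]⟩ i) hsub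
  refine ⟨l, r, hul, hrv, hxlr, ?_, ?_, hch⟩
  · rcases hl with (rfl | rfl) | hl
    · exact Or.inl rfl
    · exact absurd hxlr.1 (not_lt.2 hx.2.le)
    · simp only [Finset.mem_range, mem_iUnion, mem_ofPred_eq] at hl
      obtain ⟨i, hi, hi0⟩ := hl
      exact Or.inr ⟨i, hi, hi0⟩
  · rcases hr with (rfl | rfl) | hr
    · exact absurd hxlr.2 (not_lt.2 hx.1.le)
    · exact Or.inl rfl
    · simp only [Finset.mem_range, mem_iUnion, mem_ofPred_eq] at hr
      obtain ⟨i, hi, hi0⟩ := hr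
      exact Or.inr ⟨i, hi, hi0⟩

omit h in
lemma hlen_mono {l x r l' r' : ℝ} (hl : l' ≤ l) (hr : r ≤ r') (hx : x ∈ Ioo l r) :
    hlen l' x r' ≤ hlen l x r := by
  have h1 := sub_pos.2 hx.1
  have h2 := sub_pos.2 hx.2
  have h1' : 0 < x - l' := by linarith
  have h2' : 0 < r' - x := by linarith
  rw [hlen_eq (mul_pos h1 h2), hlen_eq (mul_pos h1' h2'), abs_of_pos h1, abs_of_pos h2,
    abs_of_pos h1', abs_of_pos h2']
  gcongr

/-- The critical orbit ends in a repelling cycle. -/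
lemma repelling {m p : ℕ} (hm : 1 ≤ m) (hp : 1 ≤ p) (hper : ∀ k, m ≤ k → orb a 0 (k + p) = orb a 0 k) :
    1 < dprod (fun i => orb a 0 (m + i)) p := by
  set q := orb a 0 m with hq
  have horb : ∀ i, orb a q i = orb a 0 (m + i) := fun i => (orb_add a 0 m i).symm
  have hper' : ∀ i, orb a q (p + i) = orb a q i := fun i => by
    rw [horb, horb, ← hper (m + i) (by omega)]; congr 1; ring
  have hqP : q ∈ Ioo (-P) P := h.orb_mem_Ioo h.zero_mem m
  obtain ⟨l, hl, r, hr, hPl, hrP, hqlr, hgap⟩ := exists_gap (Z := postcrit a P \ {q}) (x := q)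
    (h.finite_postcrit.subset sdiff_subset).isClosed (u := -P) (v := P)
    ⟨neg_P_mem, hqP.1.ne⟩ ⟨P_mem, hqP.2.ne'⟩ hqP.1 hqP.2 (by simp)
  obtain ⟨s, t, hls, htr, hq', hs, ht, i1, i2, -, i4⟩ := h.exists_monotone_interval (p + p) hPl hrP hqlr
    (fun i _ => by rw [horb]; exact h.orb_zero_ne (by omega))
  have i4 := i4 (by omega)
  have hqq : orb a q (p + p) = q := by rw [hper', show p = p + 0 by rfl, hper']; rfl
  rw [hqq] at i1 i2 i4
  have hd : dprod (orb a q) (p + p) = dprod (fun i => orb a 0 (m + i)) p ^ 2 := by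
    rw [dprod_add, sq]
    congr 1
    · congr 1; ext i; exact horb i
    · congr 1; ext i; rw [hper', horb]
  have hpr : 0 ≤ ∏ i ∈ Finset.range (p + p), (-(2 * orb a q i)) := by
    rw [Finset.prod_range_add]
    have : ∏ i ∈ Finset.range p, (-(2 * orb a q (p + i))) = ∏ i ∈ Finset.range p, (-(2 * orb a q i)) :=
      Finset.prod_congr rfl fun i _ => by rw [hper']
    rw [this]; exact mul_self_nonneg _
  have ht1 : 0 < orb a t (p + p) - q := pos_of_mul_pos_left i2 hpr
  have hs1 : 0 < q - orb a s (p + p) := pos_of_mul_pos_left i1 ht1.le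
  have himg : ∀ y, (y ∈ postcrit a P ∨ ∃ i < p + p, orb a y i = 0) → orb a y (p + p) ∈ postcrit a P := by
    rintro y (hy | ⟨i, hi, hi0⟩)
    · exact h.orb_postcrit hy _
    · rw [orb_of_zero hi.le hi0]; exact orb_zero_mem _
  have htE := himg t (ht.imp (fun e => by rw [e]; exact hr.1) id)
  have hsE := himg s (hs.imp (fun e => by rw [e]; exact hl.1) id)
  have ht2 : t ≤ orb a t (p + p) := by
    by_contra hlt
    push Not at hlt
    exact hgap _ ⟨by linarith [hqlr.1], by linarith⟩ ⟨htE, by simp; intro e; linarith⟩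
  have hs2 : orb a s (p + p) ≤ s := by
    by_contra hlt
    push Not at hlt
    exact hgap _ ⟨by linarith, by linarith [hqlr.2]⟩ ⟨hsE, by simp; intro e; linarith⟩
  have hmono := hlen_mono hs2 ht2 hq'
  have hA : 0 < (q - s) * (t - q) := mul_pos (sub_pos.2 hq'.1) (sub_pos.2 hq'.2)
  have hpos := hlen_pos hA
  rw [hd] at i4
  have hd0 := dprod_nonneg (fun i => orb a 0 (m + i)) p
  by_contra hle
  push Not at hle
  have hle2 : dprod (fun i => orb a 0 (m + i)) p ^ 2 ≤ 1 := pow_le_one₀ hd0 hle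
  have hpos' : 0 < hlen (orb a s (p + p)) q (orb a t (p + p)) := hlen_pos (by positivity)
  nlinarith [mul_pos hpos hA]

/-- Exponential growth of the derivative along the critical orbit. -/
lemma growth : ∃ lam c C : ℝ, 1 < lam ∧ 0 < c ∧ 0 < C ∧
    ∀ k, c * lam ^ k ≤ dprod (fun i => orb a 0 (i + 1)) k ∧
      dprod (fun i => orb a 0 (i + 1)) k ≤ C * lam ^ k := by
  obtain ⟨m, p, hm, hp, hper⟩ := h.exists_period
  set π := dprod (fun i => orb a 0 (m + i)) p with hπ
  have hπ1 : 1 < π := h.repelling hm hp hper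
  set D := dprod (fun i => orb a 0 (i + 1)) with hD
  have hDpos : ∀ k, 0 < D k := fun k => dprod_pos fun i _ => h.orb_zero_ne (by omega)
  have hshift : ∀ k, m ≤ k → dprod (fun i => orb a 0 (k + i)) p = π := by
    intro k hk
    induction k, hk using Nat.le_induction with
    | base => rfl
    | succ k hk ih =>
      have e1 := dprod_succ (fun i => orb a 0 (k + i)) p
      have e2 : dprod (fun i => orb a 0 (k + i)) (1 + p) = _ := dprod_add (fun i => orb a 0 (k + i)) 1 p
      rw [add_comm 1 p, e1, hper k hk, ih, dprod_one, add_zero] at e2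
      have hne : |2 * orb a 0 k| ≠ 0 := abs_ne_zero.2 (mul_ne_zero two_ne_zero (h.orb_zero_ne (by omega)))
      have e3 : π = dprod (fun i => orb a 0 (k + (1 + i))) p := by
        have : |2 * orb a 0 k| * π = |2 * orb a 0 k| * dprod (fun i => orb a 0 (k + (1 + i))) p := by
          rw [← e2]; ring
        exact mul_left_cancel₀ hne this
      rw [e3]; congr 1; ext i; congr 1; ring
  have hDp : ∀ k, m ≤ k → D (k + p) = D k * π := by
    intro k hk
    rw [hD, dprod_add, ← hshift (k + 1) (by omega)]
    congr 2; ext i; congr 1; ring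
  set lam := π ^ (1 / (p : ℝ))
  have hlam : lam ^ p = π := by
    rw [← Real.rpow_natCast, ← Real.rpow_mul (by linarith)]
    field_simp; simp
  have hlam1 : 1 < lam := Real.one_lt_rpow hπ1 (by positivity)
  have hlam0 : 0 < lam := by linarith
  set u : ℕ → ℝ := fun k => D k / lam ^ k
  have hu : ∀ k, ∃ k' ∈ Finset.range (m + p), u k = u k' := by
    intro k
    induction k using Nat.strong_induction_on with
    | _ k ih =>
      by_cases hk : k < m + p
      · exact ⟨k, by simpa using hk, rfl⟩
      · obtain ⟨k', hk', e⟩ := ih (k - p) (by omega)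
        refine ⟨k', hk', ?_⟩
        rw [← e]
        have e2 := hDp (k - p) (by omega)
        have e3 : lam ^ k = lam ^ (k - p) * π := by rw [← hlam, ← pow_add]; congr 1; omega
        simp only [u]
        rw [show k - p + p = k by omega] at e2
        rw [e2, e3]
        field_simp
  have hupos : ∀ k, 0 < u k := fun k => div_pos (hDpos k) (pow_pos hlam0 k)
  have hne : (Finset.range (m + p)).Nonempty := ⟨0, by simp; omega⟩
  obtain ⟨k1, -, h1⟩ := Finset.exists_min_image (Finset.range (m + p)) u hne
  obtain ⟨k2, -, h2⟩ := Finset.exists_max_image (Finset.range (m + p)) u hne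
  refine ⟨lam, u k1, u k2, hlam1, hupos _, hupos _, fun k => ?_⟩
  obtain ⟨k', hk', e⟩ := hu k
  have e4 : D k = u k * lam ^ k := by simp only [u]; field_simp
  rw [e4, e]
  exact ⟨mul_le_mul_of_nonneg_right (h1 k' hk') (by positivity),
    mul_le_mul_of_nonneg_right (h2 k' hk') (by positivity)⟩

/-- Lower bound of the derivative at a return near the critical point. -/
lemma dprod_lower_of_return : ∃ δ > 0, ∀ x ∈ Ioo (-P) P, ∀ k, dprod (orb a x) k ≠ 0 →
    |orb a x k| ≤ δ → δ / 2 ≤ dprod (orb a x) k := by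
  have hfin : (postcrit a P \ {0}).Finite := h.finite_postcrit.subset sdiff_subset
  obtain ⟨ε, hε, hball⟩ := Metric.isOpen_iff.1 hfin.isClosed.isOpen_compl 0 (by simp)
  have hE : ∀ y ∈ postcrit a P, y ≠ 0 → ε ≤ |y| := by
    intro y hy hy0
    by_contra hlt
    push Not at hlt
    exact hball (by simpa using hlt) ⟨hy, hy0⟩
  refine ⟨ε / 2, by positivity, fun x hx k hk hxk => ?_⟩
  obtain ⟨l, r, hl, hr, hxlr, hl', hr', i1, -, i3, -⟩ := h.exists_monotone_interval k le_rfl le_rfl hx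
    fun i hi => ne_zero_of_dprod_ne_zero hk hi
  have hfar : ∀ t, (t = -P ∨ t = P ∨ ∃ i < k, orb a t i = 0) → ε ≤ |orb a t k| := by
    rintro t (rfl | rfl | ⟨i, hi, hi0⟩)
    · rw [h.orb_neg_P]; exact hE _ neg_P_mem (by linarith [h.one_lt_P])
    · rcases h.orb_P k with e | e <;> rw [e]
      · exact hE _ P_mem (by linarith [h.one_lt_P])
      · exact hE _ neg_P_mem (by linarith [h.one_lt_P])
    · rw [orb_of_zero hi.le hi0]; exact hE _ (orb_zero_mem _) (h.orb_zero_ne (by omega))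
  have f1 := hfar l (hl'.imp id Or.inr)
  have f2 := hfar r (Or.inr hr')
  have d1 : ε / 2 ≤ |orb a x k - orb a l k| := by
    have := abs_sub_abs_le_abs_sub (orb a l k) (orb a x k)
    rw [abs_sub_comm]; linarith
  have d2 : ε / 2 ≤ |orb a r k - orb a x k| := by
    have := abs_sub_abs_le_abs_sub (orb a r k) (orb a x k)
    linarith
  have u1 : hlen (orb a l k) (orb a x k) (orb a r k) ≤ 4 / ε := by
    rw [hlen_eq i1]
    have := one_div_le_one_div_of_le (by positivity) d1
    have := one_div_le_one_div_of_le (by positivity) d2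
    have e : 4 / ε = 1 / (ε / 2) + 1 / (ε / 2) := by field_simp; norm_num
    linarith
  have hA : 0 < (x - l) * (r - x) := mul_pos (sub_pos.2 hxlr.1) (sub_pos.2 hxlr.2)
  have u2 : 1 ≤ hlen l x r := by
    unfold hlen
    rw [le_div_iff₀ hA, one_mul, abs_of_pos (by linarith [hxlr.1, hxlr.2])]
    have := h.P_lt_two
    nlinarith [sq_nonneg ((x - l) - (r - x)), hxlr.1, hxlr.2]
  have u3 : 1 ≤ 4 / ε * dprod (orb a x) k :=
    (u2.trans i3).trans (mul_le_mul_of_nonneg_right u1 (dprod_nonneg _ _))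
  rw [div_mul_eq_mul_div, le_div_iff₀ hε] at u3
  linarith

lemma exists_expanding_time : ∃ k, ∀ e ∈ postcrit a P, e ≠ 0 → 4 ≤ dprod (orb a e) k := by
  obtain ⟨lam, c, C, hlam, hc, hC, hg⟩ := h.growth
  have hl0 : 0 < lam := by linarith
  obtain ⟨k, hk⟩ := pow_unbounded_of_one_lt (4 * C / c) hlam
  refine ⟨k + 2, ?_⟩
  rintro e (⟨j, rfl⟩ | he) he0
  · have hj : 1 ≤ j := by
      rcases Nat.eq_zero_or_pos j with rfl | hj
      · exact absurd (orb_zero a 0) he0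
      · exact hj
    obtain ⟨j, rfl⟩ : ∃ i, j = i + 1 := ⟨j - 1, by omega⟩
    have e1 := dprod_add (fun i => orb a 0 (i + 1)) j (k + 2)
    have e2 : dprod (orb a (orb a 0 (j + 1))) (k + 2) = dprod (fun i => orb a 0 (j + i + 1)) (k + 2) := by
      congr 1; ext i; rw [← orb_add]; congr 1; ring
    rw [e2]
    have e3 := (hg (j + (k + 2))).1
    rw [e1] at e3
    have e4 := (hg j).2
    set X := dprod (fun i => orb a 0 (j + i + 1)) (k + 2)
    have hX : 0 ≤ X := dprod_nonneg _ _
    have e5 : c * lam ^ (j + (k + 2)) ≤ C * lam ^ j * X := e3.trans (mul_le_mul_of_nonneg_right e4 hX)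
    rw [pow_add, show c * (lam ^ j * lam ^ (k + 2)) = lam ^ j * (c * lam ^ (k + 2)) by ring,
      show C * lam ^ j * X = lam ^ j * (C * X) by ring] at e5
    have e6 := le_of_mul_le_mul_left e5 (by positivity)
    have e7 : lam ^ k ≤ lam ^ (k + 2) := pow_le_pow_right₀ hlam.le (by omega)
    rw [div_lt_iff₀ hc] at hk
    have : C * 4 ≤ C * X := by nlinarith
    exact le_of_mul_le_mul_left this hC
  · have hab : ∀ i, (2 : ℝ) ≤ |2 * orb a e i| := by
      intro i
      have : orb a e i = P ∨ orb a e i = -P := by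
        rcases he with rfl | rfl
        · exact h.orb_P i
        · exact Or.inr (h.orb_neg_P i)
      have hP1 := h.one_lt_P
      rcases this with e | e <;> rw [e, abs_mul, abs_two] <;>
      · simp only [abs_neg, abs_of_pos (by linarith : 0 < P)]; linarith
    calc (4 : ℝ) ≤ 2 ^ (k + 2) := by rw [pow_add]; linarith [one_le_pow₀ (M₀ := ℝ) one_le_two (n := k)]
      _ ≤ _ := dprod_ge_pow (by norm_num) fun i _ => hab i

omit h in
lemma continuous_dprod_orb (k : ℕ) : Continuous fun x => dprod (orb a x) k := by
  unfold dprod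
  exact continuous_finsetProd _ fun i _ => (continuous_const.mul (continuous_orb a i)).abs

/-- Uniform expansion in a neighbourhood of the postcritical set without the critical point. -/
lemma exists_expanding_nhd : ∃ k, ∃ ε > 0, 1 ≤ k ∧ ∀ e ∈ postcrit a P, e ≠ 0 → ∀ y, |y - e| < ε →
    2 ≤ dprod (orb a y) k := by
  obtain ⟨k, hk⟩ := h.exists_expanding_time
  have hev : ∀ e ∈ postcrit a P, ∀ᶠ ε in nhdsWithin (0 : ℝ) (Ioi 0), e ≠ 0 → ∀ y, |y - e| < ε → 
      2 ≤ dprod (orb a y) k := by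
    intro e he
    by_cases he0 : e = 0
    · exact Eventually.of_forall fun _ h1 => absurd he0 h1
    · have : ∀ᶠ y in nhds e, 2 < dprod (orb a y) k :=
        (continuous_dprod_orb k).continuousAt.eventually (lt_mem_nhds (by linarith [hk e he he0]))
      obtain ⟨ε, hε, hb⟩ := Metric.eventually_nhds_iff.1 this
      filter_upwards [Ioo_mem_nhdsGT hε] with ε' hε' _ y hy
      exact (hb (by rw [Real.dist_eq]; linarith [hε'.2])).le
  have := (h.finite_postcrit.eventually_all (p := fun e ε => e ≠ 0 → ∀ y, |y - e| < ε → 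
      2 ≤ dprod (orb a y) k) (l := nhdsWithin (0 : ℝ) (Ioi 0))).2 hev
  obtain ⟨ε, h1, h2⟩ := (this.and self_mem_nhdsWithin).exists
  refine ⟨k, ε, h2, ?_, h1⟩
  rcases Nat.eq_zero_or_pos k with rfl | hk'
  · have := hk (-P) neg_P_mem (by linarith [h.one_lt_P])
    rw [dprod_zero] at this; linarith
  · exact hk'

/-- Orbits avoiding a neighbourhood of the critical point expand. -/
lemma dprod_unbounded {x δ : ℝ} (hδ : 0 < δ) (hx : x ∈ Ioo (-P) P) (hav : ∀ i, δ ≤ |orb a x i|) (M : ℝ) :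
    ∃ n, M ≤ dprod (orb a x) n := by
  obtain ⟨k, ε₀, hε₀, hk1, hexp⟩ := h.exists_expanding_nhd
  set ε := min ε₀ δ
  have hε : 0 < ε := lt_min hε₀ hδ
  have hne : ∀ i, orb a x i ≠ 0 := fun i h0 => by have := hav i; rw [h0, abs_zero] at this; linarith
  by_cases hfar : ∀ N, ∃ n ≥ N, ∀ e ∈ postcrit a P, ε ≤ |orb a x n - e|
  · have hout : ∀ n, orb a x n ∉ postcrit a P := by
      intro n hn
      obtain ⟨n', hn', hd⟩ := hfar n
      obtain ⟨j, rfl⟩ := Nat.exists_eq_add_of_le hn'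
      have := hd (orb a x (n + j)) (by rw [orb_add]; exact h.orb_postcrit hn j)
      simp at this; linarith
    set A : ℕ → ℝ → Prop := fun n c => ∃ l ∈ postcrit a P, ∃ r ∈ postcrit a P, -P ≤ l ∧ r ≤ P ∧ 
      orb a x n ∈ Ioo l r ∧ (∀ y ∈ Ioo l r, y ∉ postcrit a P) ∧ c ≤ hlen l (orb a x n) r * dprod (orb a x) n
    have hP2 := h.P_lt_two
    have hgap : ∀ y ∈ Ioo (-P) P, y ∉ postcrit a P → ∃ l ∈ postcrit a P, ∃ r ∈ postcrit a P, -P ≤ l ∧ r ≤ P ∧ 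
        y ∈ Ioo l r ∧ ∀ y ∈ Ioo l r, y ∉ postcrit a P := by
      intro y hy hyE
      exact exists_gap h.finite_postcrit.isClosed neg_P_mem P_mem hy.1 hy.2 hyE
    have hA0 : ∃ c > 0, A 0 c := by
      obtain ⟨l, hl, r, hr, hl1, hr1, hxlr, hg⟩ := hgap x hx (hout 0)
      refine ⟨_, ?_, l, hl, r, hr, hl1, hr1, hxlr, hg, le_rfl⟩
      rw [dprod_zero, mul_one]
      exact hlen_pos (mul_pos (sub_pos.2 hxlr.1) (sub_pos.2 hxlr.2))
    have hstep : ∀ n c g, A n c → 0 ≤ g → (g = 0 ∨ (g = ε ^ 2 / 16 ∧ ∀ e ∈ postcrit a P, ε ≤ |orb a x n - e|)) → 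
        0 ≤ c → A (n + 1) (c * (1 + g)) := by
      rintro n c g ⟨l, hl, r, hr, hl1, hr1, hxlr, hg, hc⟩ hg0 hgg hc0
      have h0 : (0 : ℝ) ∉ Ioo l r := fun h0 => hg 0 h0 (orb_zero_mem 0)
      have hA : 0 < (orb a x n - l) * (r - orb a x n) := mul_pos (sub_pos.2 hxlr.1) (sub_pos.2 hxlr.2)
      have hlx : 0 ≤ l * orb a x n ∧ 0 ≤ r * orb a x n := by
        rcases le_or_gt 0 l with h1 | h1
        · have : 0 ≤ orb a x n := by linarith [hxlr.1]
          have : 0 ≤ r := by linarith [hxlr.2]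
          constructor <;> positivity
        · have hr0 : r ≤ 0 := by
            by_contra h2
            push Not at h2
            exact h0 ⟨h1, h2⟩
          have : orb a x n ≤ 0 := by linarith [hxlr.2]
          exact ⟨mul_nonneg_of_nonpos_of_nonpos h1.le this, mul_nonneg_of_nonpos_of_nonpos hr0 this⟩
      have hxx := h.abs_orb_le ⟨hx.1.le, hx.2.le⟩ n
      obtain ⟨s1, s2⟩ := hlen_step a hA hlx.1 hlx.2 (hne n) (abs_le.2 ⟨by linarith, by linarith [hxlr.1, hxlr.2]⟩) 
        hxx (abs_le.2 ⟨by linarith [hxlr.1, hxlr.2], by linarith⟩)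
      obtain ⟨l', hl', r', hr', hl1', hr1', hxlr', hg'⟩ := hgap (orb a x (n + 1)) (h.orb_mem_Ioo hx _) (hout _)
      refine ⟨l', hl', r', hr', hl1', hr1', hxlr', hg', ?_⟩
      have hgain : g ≤ (orb a x n - l) * (r - orb a x n) / 16 := by
        rcases hgg with rfl | ⟨rfl, hd⟩
        · positivity
        · have d1 := hd l hl
          have d2 := hd r hr
          rw [abs_of_pos (sub_pos.2 hxlr.1)] at d1
          rw [abs_sub_comm, abs_of_pos (sub_pos.2 hxlr.2)] at d2
          have := mul_le_mul d1 d2 hε.le (by linarith)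
          rw [sq]; linarith
      have himg : ∀ y, y ∈ postcrit a P → qm a y ∉ Ioo l' r' := by
        intro y hy hy'
        exact hg' _ hy' (h.orb_postcrit hy 1)
      have hmono : hlen (qm a l) (qm a (orb a x n)) (qm a r) ≤ hlen l' (orb a x (n + 1)) r' := by
        rw [← orb_succ] at s1 ⊢
        have hA' : 0 < (orb a x (n + 1) - l') * (r' - orb a x (n + 1)) := mul_pos (sub_pos.2 hxlr'.1) (sub_pos.2 hxlr'.2)
        have b1 := himg l hl
        have b2 := himg r hr
        simp only [mem_Ioo, not_and_or, not_lt] at b1 b2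
        rw [hlen_eq s1, hlen_eq hA', abs_of_pos (sub_pos.2 hxlr'.1), abs_of_pos (sub_pos.2 hxlr'.2)]
        have p1 := sub_pos.2 hxlr'.1
        have p2 := sub_pos.2 hxlr'.2
        rcases pos_and_pos_or_neg_and_neg_of_mul_pos s1 with ⟨q1, q2⟩ | ⟨q1, q2⟩
        · rw [abs_of_pos q1, abs_of_pos q2]
          have : qm a l ≤ l' := by
            rcases b1 with b1 | b1
            · exact b1
            · linarith
          have : r' ≤ qm a r := by
            rcases b2 with b2 | b2
            · linarith
            · exact b2
          gcongr
        · rw [abs_of_neg q1, abs_of_neg q2, add_comm]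
          have : qm a r ≤ l' := by
            rcases b2 with b1 | b1
            · exact b1
            · linarith
          have : r' ≤ qm a l := by
            rcases b1 with b2 | b2
            · linarith
            · exact b2
          gcongr <;> linarith
      rw [dprod_succ]
      have hd := dprod_nonneg (orb a x) n
      calc c * (1 + g) ≤ (hlen l (orb a x n) r * dprod (orb a x) n) * (1 + (orb a x n - l) * (r - orb a x n) / 16) :=
            mul_le_mul hc (by linarith) (by linarith) (hc0.trans hc)
        _ = hlen l (orb a x n) r * (1 + (orb a x n - l) * (r - orb a x n) / 16) * dprod (orb a x) n := by ring
        _ ≤ hlen (qm a l) (qm a (orb a x n)) (qm a r) * |2 * orb a x n| * dprod (orb a x) n :=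
            mul_le_mul_of_nonneg_right s2 hd
        _ = hlen (qm a l) (qm a (orb a x n)) (qm a r) * (dprod (orb a x) n * |2 * orb a x n|) := by ring
        _ ≤ _ := mul_le_mul_of_nonneg_right hmono (by positivity)
    obtain ⟨c, hc, hAc⟩ := hA0
    have hlater : ∀ n j c, 0 ≤ c → A n c → A (n + j) c := by
      intro n j c hc hn
      induction j with
      | zero => exact hn
      | succ j ih => 
        have := hstep (n + j) c 0 ih le_rfl (Or.inl rfl) hc
        rwa [add_zero, mul_one] at this
    have hK : ∀ K : ℕ, ∃ n, A n (c * (1 + ε ^ 2 / 16) ^ K) := by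
      intro K
      induction K with
      | zero => exact ⟨0, by simpa using hAc⟩
      | succ K ih =>
        obtain ⟨n, hn⟩ := ih
        obtain ⟨n', hn', hd⟩ := hfar n
        obtain ⟨j, rfl⟩ := Nat.exists_eq_add_of_le hn'
        refine ⟨n + j + 1, ?_⟩
        rw [pow_succ, ← mul_assoc]
        exact hstep _ _ _ (hlater n j _ (by positivity) hn) (by positivity) (Or.inr ⟨rfl, hd⟩) (by positivity)
    obtain ⟨K, hK'⟩ := pow_unbounded_of_one_lt (M * (2 / ε) / c) (show 1 < 1 + ε ^ 2 / 16 by 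
      have : 0 < ε ^ 2 / 16 := by positivity
      linarith)
    obtain ⟨n, hn⟩ := hK K
    obtain ⟨n', hn', hd⟩ := hfar n
    obtain ⟨j, rfl⟩ := Nat.exists_eq_add_of_le hn'
    obtain ⟨l, hl, r, hr, hl1, hr1, hxlr, hg, hc'⟩ := hlater n j _ (by positivity) hn
    refine ⟨n + j, ?_⟩
    have hA : 0 < (orb a x (n + j) - l) * (r - orb a x (n + j)) := mul_pos (sub_pos.2 hxlr.1) (sub_pos.2 hxlr.2)
    have d1 := hd l hl
    have d2 := hd r hr
    rw [abs_sub_comm] at d2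
    have hlen2 : hlen l (orb a x (n + j)) r ≤ 2 / ε := by
      rw [hlen_eq hA]
      have := one_div_le_one_div_of_le hε d1
      have := one_div_le_one_div_of_le hε d2
      have : 2 / ε = 1 / ε + 1 / ε := by ring
      linarith
    rw [div_lt_iff₀ hc] at hK'
    have h5 : M * (2 / ε) < (2 / ε) * dprod (orb a x) (n + j) := by
      calc M * (2 / ε) < (1 + ε ^ 2 / 16) ^ K * c := hK'
        _ = c * (1 + ε ^ 2 / 16) ^ K := by ring
        _ ≤ _ := hc'
        _ ≤ _ := mul_le_mul_of_nonneg_right hlen2 (dprod_nonneg _ _)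
    rw [mul_comm] at h5
    exact (lt_of_mul_lt_mul_left h5 (by positivity)).le
  · push Not at hfar
    obtain ⟨N, hN⟩ := hfar
    have h2 : ∀ n ≥ N, 2 ≤ dprod (orb a (orb a x n)) k := by
      intro n hn
      obtain ⟨e, he, hd⟩ := hN n hn
      refine hexp e he ?_ _ (hd.trans_le (min_le_left _ _))
      rintro rfl
      have := hav n
      rw [sub_zero] at hd
      have := min_le_right ε₀ δ
      linarith
    have hgrow : ∀ j, dprod (orb a x) N * 2 ^ j ≤ dprod (orb a x) (N + k * j) := by
      intro j
      induction j with
      | zero => simp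
      | succ j ih =>
        rw [show N + k * (j + 1) = N + k * j + k by ring, dprod_add, pow_succ, ← mul_assoc]
        have e : (fun i => orb a x (N + k * j + i)) = orb a (orb a x (N + k * j)) := by
          ext i; rw [orb_add]
        rw [e]
        exact mul_le_mul ih (h2 _ (by omega)) (by norm_num) (dprod_nonneg _ _)
    have hpos : 0 < dprod (orb a x) N := dprod_pos fun i _ => hne i
    obtain ⟨j, hj⟩ := pow_unbounded_of_one_lt (M / dprod (orb a x) N) (show (1 : ℝ) < 2 by norm_num)
    refine ⟨_, le_trans ?_ (hgrow j)⟩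
    rw [div_lt_iff₀ hpos] at hj
    linarith

end Misiurewicz

/-- Pseudo-orbits of the quadratic map with errors at most `α`, inside `[-β, β]`. -/
structure PseudoOrbit (a α β : ℝ) (x : ℕ → ℝ) : Prop where
  step : ∀ i, |x (i + 1) - qm a (x i)| ≤ α
  mem : ∀ i, |x i| ≤ β

lemma PseudoOrbit.shift {a α β : ℝ} {x : ℕ → ℝ} (h : PseudoOrbit a α β x) (m : ℕ) :
    PseudoOrbit a α β (fun i => x (m + i)) :=
  ⟨fun i => h.step (m + i), fun i => h.mem (m + i)⟩

lemma PseudoOrbit.mono {a α α' β : ℝ} {x : ℕ → ℝ} (h : PseudoOrbit a α β x) (hα : α ≤ α') :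
    PseudoOrbit a α' β x :=
  ⟨fun i => (h.step i).trans hα, h.mem⟩

lemma continuous_dprod (k : ℕ) : Continuous fun x : ℕ → ℝ => dprod x k := by
  unfold dprod
  exact continuous_finsetProd _ fun i _ => (continuous_const.mul (continuous_apply i)).abs

/-- Pseudo-orbits with errors tending to zero accumulate on true orbits. -/
lemma exists_limit_orbit {a β : ℝ} (X : ℕ → ℕ → ℝ)
    (hX : ∀ n : ℕ, PseudoOrbit a (1 / ((n : ℝ) + 1)) β (X n)) :
    ∃ y : ℝ, ∃ ψ : ℕ → ℕ, StrictMono ψ ∧ |y| ≤ β ∧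
      Tendsto (fun n => X (ψ n)) atTop (nhds (orb a y)) := by
  have hc : IsCompact (Set.pi univ fun _ : ℕ => Icc (-β) β) := isCompact_univ_pi fun _ => isCompact_Icc
  obtain ⟨z, hz, ψ, hψ, hlim⟩ := hc.tendsto_subseq (x := X) fun n i _ => abs_le.1 ((hX n).mem i)
  have hlim' := tendsto_pi_nhds.1 hlim
  have hz' : ∀ i, z i = orb a (z 0) i := by
    intro i
    induction i with
    | zero => rfl
    | succ i ih =>
      rw [orb_succ, ← ih]
      have h1 : Tendsto (fun n => X (ψ n) (i + 1) - qm a (X (ψ n) i)) atTop (nhds (z (i + 1) - qm a (z i))) :=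
        (hlim' (i + 1)).sub (((continuous_qm a).tendsto _).comp (hlim' i))
      have h2 : Tendsto (fun n => X (ψ n) (i + 1) - qm a (X (ψ n) i)) atTop (nhds 0) := by
        refine squeeze_zero_norm (fun n => (hX (ψ n)).step i) ?_
        exact (tendsto_one_div_add_atTop_nhds_zero_nat (𝕜 := ℝ)).comp hψ.tendsto_atTop
      exact sub_eq_zero.1 (tendsto_nhds_unique h1 h2)
  refine ⟨z 0, ψ, hψ, abs_le.2 (hz 0 (mem_univ _)), ?_⟩
  have : orb a (z 0) = z := by ext i; exact (hz' i).symm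
  rw [this]; exact hlim

/-- Exponential growth data for the derivative along the critical orbit. -/
structure Growth (a lam c C : ℝ) : Prop where
  one_lt : 1 < lam
  c_pos : 0 < c
  C_pos : 0 < C
  lower : ∀ k, c * lam ^ k ≤ dprod (fun i => orb a 0 (i + 1)) k
  upper : ∀ k, dprod (fun i => orb a 0 (i + 1)) k ≤ C * lam ^ k

namespace Misiurewicz

variable {a P : ℝ} (h : Misiurewicz a P)
include h

lemma exists_growth : ∃ lam c C, Growth a lam c C := by
  obtain ⟨lam, c, C, h1, h2, h3, h4⟩ := h.growth
  exact ⟨lam, c, C, h1, h2, h3, fun k => (h4 k).1, fun k => (h4 k).2⟩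

lemma pseudo_expand {β δ : ℝ} (hβ : β < P) (hδ : 0 < δ) : ∃ n₁, 1 ≤ n₁ ∧ ∃ α₁ > 0, ∀ x,
    PseudoOrbit a α₁ β x → (∀ i < n₁, δ ≤ |x i|) → ∃ n, 1 ≤ n ∧ n ≤ n₁ ∧ 2 ≤ dprod x n := by
  by_contra hcon
  push Not at hcon
  choose X hX hav hlt using fun n : ℕ => hcon (n + 1) (by omega) (1 / ((n : ℝ) + 1)) (by positivity)
  obtain ⟨y, ψ, hψ, hy, hlim⟩ := exists_limit_orbit X hX
  have hlim' := tendsto_pi_nhds.1 hlim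
  have hyP : y ∈ Ioo (-P) P := by
    rw [abs_le] at hy; exact ⟨by linarith, by linarith⟩
  have hge : ∀ i, δ ≤ |orb a y i| := by
    intro i
    refine ge_of_tendsto (hlim' i).abs ?_
    filter_upwards [eventually_ge_atTop i] with n hn
    exact hav (ψ n) i (by have := hψ.le_apply (x := n); omega)
  obtain ⟨n, hn⟩ := h.dprod_unbounded hδ hyP hge 3
  have hn1 : 1 ≤ n := by
    rcases Nat.eq_zero_or_pos n with rfl | h1
    · rw [dprod_zero] at hn; norm_num at hn
    · exact h1
  have : dprod (orb a y) n ≤ 2 := by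
    refine le_of_tendsto (((continuous_dprod n).tendsto _).comp hlim) ?_
    filter_upwards [eventually_ge_atTop n] with k hk
    exact (hlt (ψ k) n hn1 (by have := hψ.le_apply (x := k); omega)).le
  linarith

lemma pseudo_return {β : ℝ} (hβ : β < P) : ∃ δ₁ > 0, ∀ δ > 0, ∀ k, ∃ α₁ > 0, ∀ x,
    PseudoOrbit a α₁ β x → (∀ i < k, δ ≤ |x i|) → |x k| ≤ δ₁ → δ₁ / 4 ≤ dprod x k := by
  obtain ⟨δ₁, hδ₁, hret⟩ := h.dprod_lower_of_return
  refine ⟨δ₁, hδ₁, fun δ hδ k => ?_⟩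
  by_contra hcon
  push Not at hcon
  choose X hX hav hle hlt using fun n : ℕ => hcon (1 / ((n : ℝ) + 1)) (by positivity)
  obtain ⟨y, ψ, hψ, hy, hlim⟩ := exists_limit_orbit X hX
  have hlim' := tendsto_pi_nhds.1 hlim
  have hyP : y ∈ Ioo (-P) P := by
    rw [abs_le] at hy; exact ⟨by linarith, by linarith⟩
  have hge : ∀ i < k, δ ≤ |orb a y i| := fun i hi =>
    ge_of_tendsto (hlim' i).abs (Eventually.of_forall fun n => hav (ψ n) i hi)
  have hk : |orb a y k| ≤ δ₁ := le_of_tendsto (hlim' k).abs (Eventually.of_forall fun n => hle (ψ n))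
  have hle2 : dprod (orb a y) k ≤ δ₁ / 4 :=
    le_of_tendsto (((continuous_dprod k).tendsto _).comp hlim) (Eventually.of_forall fun n => (hlt (ψ n)).le)
  have hpos : 0 < dprod (orb a y) k := dprod_pos fun i hi h0 => by
    have := hge i hi
    rw [h0, abs_zero] at this; linarith
  have := hret y hyP k hpos.ne' hk
  linarith

/-- Uniform expansion of pseudo-orbits outside a neighbourhood of the critical point. -/
lemma pseudo_outside {β : ℝ} (hβ : β < P) : ∃ δ₁ C₂ : ℝ, 0 < δ₁ ∧ 0 < C₂ ∧ C₂ ≤ 1 ∧ ∀ δ > 0, ∃ α₁ > 0, ∃ σ₀ > 1,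
    ∀ σ, 1 < σ → σ ≤ σ₀ → ∃ cδ > 0, ∀ x, PseudoOrbit a α₁ β x → ∀ k, (∀ i < k, δ ≤ |x i|) →
      cδ * σ ^ k ≤ dprod x k ∧ (|x k| ≤ δ₁ → C₂ * σ ^ k ≤ dprod x k) := by
  obtain ⟨δ₁, hδ₁, hret⟩ := h.pseudo_return hβ
  refine ⟨δ₁, min 1 (δ₁ / 8), hδ₁, by positivity, min_le_left _ _, fun δ hδ => ?_⟩
  obtain ⟨n₁, hn₁, α₁, hα₁, hexp⟩ := h.pseudo_expand hβ hδ
  choose α₂ hα₂ hret' using hret δ hδ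
  obtain ⟨α₃, hα₃, hmin⟩ : ∃ α₃ > 0, ∀ k < n₁, α₃ ≤ α₂ k := by
    obtain ⟨j, -, hj⟩ := Finset.exists_min_image (Finset.range n₁) α₂ ⟨0, by simp; omega⟩
    exact ⟨α₂ j, hα₂ j, fun k hk => hj k (by simpa using hk)⟩
  refine ⟨min α₁ α₃, lt_min hα₁ hα₃, (2 : ℝ) ^ (1 / (n₁ : ℝ)), ?_, fun σ hσ hσ' => ?_⟩
  · exact Real.one_lt_rpow (by norm_num) (by positivity)
  have hσ2 : σ ^ n₁ ≤ 2 := by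
    calc σ ^ n₁ ≤ ((2 : ℝ) ^ (1 / (n₁ : ℝ))) ^ n₁ := pow_le_pow_left₀ (by linarith) hσ' _
      _ = 2 := by
        rw [← Real.rpow_natCast, ← Real.rpow_mul (by norm_num)]
        field_simp; simp
  have hσk : ∀ k ≤ n₁, σ ^ k ≤ 2 := fun k hk => (pow_le_pow_right₀ hσ.le hk).trans hσ2
  set b := min 1 (2 * δ) with hb
  have hb0 : 0 < b := by positivity
  refine ⟨b ^ n₁ / 2, by positivity, ?_⟩
  intro x hx k
  induction k using Nat.strong_induction_on generalizing x with
  | _ k ih =>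
    intro hav
    rcases lt_or_ge k n₁ with hk | hk
    · constructor
      · have h1 : b ^ k ≤ dprod x k := dprod_ge_pow hb0.le fun i hi => by
          rw [abs_mul, abs_two]
          exact (min_le_right _ _).trans (by linarith [hav i hi])
        have h2 : b ^ n₁ ≤ b ^ k := pow_le_pow_of_le_one hb0.le (min_le_left _ _) hk.le
        have h3 := hσk k hk.le
        have : 0 < b ^ n₁ := by positivity
        nlinarith
      · intro hxk
        have h1 := hret' k x (hx.mono ((min_le_right _ _).trans (hmin k hk))) hav hxk
        have h3 := hσk k hk.le
        have h4 : min 1 (δ₁ / 8) ≤ δ₁ / 8 := min_le_right _ _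
        have : 0 < min 1 (δ₁ / 8) := by positivity
        nlinarith
    · obtain ⟨n, hn1, hn2, hn⟩ := hexp x (hx.mono (min_le_left _ _)) fun i hi => hav i (by omega)
      obtain ⟨j, rfl⟩ := Nat.exists_eq_add_of_le (hn2.trans hk)
      have := ih j (by omega) _ (hx.shift n) fun i hi => hav (n + i) (by omega)
      rw [dprod_add, pow_add]
      have h5 : σ ^ n ≤ dprod x n := (hσk n hn2).trans hn
      have hs : 0 < σ ^ n := by positivity
      have hs' : 0 < σ ^ j := by positivity
      refine ⟨?_, fun hxk => ?_⟩
      · calc _ = σ ^ n * (b ^ n₁ / 2 * σ ^ j) := by ring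
          _ ≤ _ := mul_le_mul h5 this.1 (by positivity) (dprod_nonneg _ _)
      · calc _ = σ ^ n * (min 1 (δ₁ / 8) * σ ^ j) := by ring
          _ ≤ _ := mul_le_mul h5 (this.2 hxk) (by positivity) (dprod_nonneg _ _)

lemma exists_crit_lower : ∃ η > 0, ∀ k, η ≤ |orb a 0 (k + 1)| := by
  have hfin : (postcrit a P \ {0}).Finite := h.finite_postcrit.subset sdiff_subset
  obtain ⟨ε, hε, hball⟩ := Metric.isOpen_iff.1 hfin.isClosed.isOpen_compl 0 (by simp)
  refine ⟨ε, hε, fun k => ?_⟩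
  by_contra hlt
  push Not at hlt
  exact hball (by simpa using hlt) ⟨orb_zero_mem _, h.orb_zero_ne (by omega)⟩

omit h in
lemma abs_prod_one_add_sub_one_le {z : ℕ → ℝ} {k : ℕ} (hz : ∑ i ∈ Finset.range k, |z i| ≤ 1 / 4) :
    |∏ i ∈ Finset.range k, (1 + z i) - 1| ≤ 1 / 2 := by
  have h1 := Finset.norm_prod_one_add_sub_one_le (Finset.range k) z
  simp only [Real.norm_eq_abs] at h1
  refine h1.trans ?_
  have h2 : Real.exp (∑ i ∈ Finset.range k, |z i|) ≤ Real.exp (1 / 4) := Real.exp_le_exp.2 hz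
  have h3 : Real.exp (1 / 4) ≤ 3 / 2 := by
    have := Real.exp_bound_div_one_sub_of_interval (x := 1 / 4) (by norm_num) (by norm_num)
    norm_num at this ⊢
    linarith
  linarith

omit h in
lemma geom_sum_le {lam : ℝ} (hl : 1 < lam) (k : ℕ) :
    ∑ i ∈ Finset.range k, lam ^ i ≤ lam ^ k / (lam - 1) := by
  rw [geom_sum_eq hl.ne']
  exact div_le_div_of_nonneg_right (by linarith) (by linarith)

omit h in
lemma geom_sum_inv_le {lam : ℝ} (hl : 1 < lam) (k : ℕ) :
    ∑ i ∈ Finset.range k, 1 / lam ^ i ≤ lam / (lam - 1) := by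
  have h0 : 0 < lam := by linarith
  have h1 : ∑ i ∈ Finset.range k, 1 / lam ^ i = ∑ i ∈ Finset.range k, (lam⁻¹) ^ i :=
    Finset.sum_congr rfl fun i _ => by rw [inv_pow, one_div]
  have h2 : lam⁻¹ < 1 := inv_lt_one_of_one_lt₀ hl
  rw [h1, geom_sum_eq h2.ne, ← neg_div_neg_eq]
  have h3 : lam / (lam - 1) = 1 / -(lam⁻¹ - 1) := by
    rw [show -(lam⁻¹ - 1) = (lam - 1) / lam by field_simp; ring, one_div_div]
  rw [h3]
  have : 0 ≤ lam⁻¹ ^ k := by positivity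
  exact div_le_div_of_nonneg_right (by linarith) (by linarith)

/-- Pseudo-orbits starting near the critical value shadow the critical orbit during a
bound period. -/
lemma bound_period {lam c C : ℝ} (hg : Growth a lam c C) : ∃ K η δ₀ : ℝ, 0 < K ∧ 0 < η ∧ 0 < δ₀ ∧
    ∀ μ α : ℝ, α ≤ μ → ∀ y : ℕ → ℝ, |y 0 - orb a 0 1| ≤ μ → (∀ i, |y (i + 1) - qm a (y i)| ≤ α) →
      ∀ k, lam ^ k * μ ≤ δ₀ → |y k - orb a 0 (k + 1)| ≤ K * (lam ^ k * μ) ∧ η ≤ |y k| ∧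
        dprod (fun i => orb a 0 (i + 1)) k / 2 ≤ dprod y k ∧
        dprod (fun i => orb a 0 (i + 1)) k / 2 ≤ ∏ i ∈ Finset.range k, |y i + orb a 0 (i + 1)| ∧
        ∏ i ∈ Finset.range k, |y i + orb a 0 (i + 1)| ≤ 2 * dprod (fun i => orb a 0 (i + 1)) k := by
  obtain ⟨η, hη, hηe⟩ := h.exists_crit_lower
  have hl := hg.one_lt
  have hc := hg.c_pos
  have hC := hg.C_pos
  have hl1 : 0 < lam - 1 := by linarith
  have hl0 : 0 < lam := by linarith
  set e : ℕ → ℝ := fun i => orb a 0 (i + 1) with he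
  set D := dprod e with hD
  have he0 : ∀ i, e i ≠ 0 := fun i => h.orb_zero_ne (by omega)
  have hDpos : ∀ k, 0 < D k := fun k => dprod_pos fun i _ => he0 i
  set K := 2 * C * (1 + 2 / c) * (lam / (lam - 1)) + 1 with hK
  have hK0 : 0 < K := by positivity
  set δ₀ := min (η / (2 * K)) (η * (lam - 1) / (4 * K)) with hδ₀
  have hδpos : 0 < δ₀ := by positivity
  refine ⟨K, η / 2, δ₀, hK0, by positivity, hδpos, ?_⟩
  intro μ α hαμ y hy0 hy
  have hμ : 0 ≤ μ := (abs_nonneg _).trans hy0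
  have hprod : ∀ k, lam ^ k * μ ≤ δ₀ → (∀ i < k, |y i - e i| ≤ K * (lam ^ i * μ)) → 
      ∀ t : ℝ, 0 ≤ t → t ≤ 1 → D k / 2 ≤ ∏ i ∈ Finset.range k, |2 * e i + 2 * t * (y i - e i)| ∧
        ∏ i ∈ Finset.range k, |2 * e i + 2 * t * (y i - e i)| ≤ 2 * D k := by
    intro k hk hv t ht0 ht1
    have h1 : ∑ i ∈ Finset.range k, |t * (y i - e i) / e i| ≤ 1 / 4 := by
      calc ∑ i ∈ Finset.range k, |t * (y i - e i) / e i| ≤ ∑ i ∈ Finset.range k, (K * μ / η) * lam ^ i := by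
            refine Finset.sum_le_sum fun i hi => ?_
            have hvi := hv i (Finset.mem_range.1 hi)
            rw [abs_div, abs_mul, abs_of_nonneg ht0, div_le_iff₀ (abs_pos.2 (he0 i))]
            calc t * |y i - e i| ≤ 1 * (K * (lam ^ i * μ)) := mul_le_mul ht1 hvi (abs_nonneg _) (by norm_num)
              _ = K * μ / η * lam ^ i * η := by field_simp
              _ ≤ _ := mul_le_mul_of_nonneg_left (hηe i) (by positivity)
        _ = (K * μ / η) * ∑ i ∈ Finset.range k, lam ^ i := by rw [Finset.mul_sum]
        _ ≤ (K * μ / η) * (lam ^ k / (lam - 1)) := mul_le_mul_of_nonneg_left (geom_sum_le hl k) (by positivity)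
        _ = (lam ^ k * μ) * (K / (η * (lam - 1))) := by field_simp
        _ ≤ (η * (lam - 1) / (4 * K)) * (K / (η * (lam - 1))) := 
            mul_le_mul_of_nonneg_right (hk.trans (min_le_right _ _)) (by positivity)
        _ = 1 / 4 := by field_simp
    have h2 := abs_prod_one_add_sub_one_le h1
    have h3 : ∏ i ∈ Finset.range k, |2 * e i + 2 * t * (y i - e i)| = 
        D k * |∏ i ∈ Finset.range k, (1 + t * (y i - e i) / e i)| := by
      rw [hD, dprod, Finset.abs_prod, ← Finset.prod_mul_distrib]
      refine Finset.prod_congr rfl fun i _ => ?_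
      rw [← abs_mul]
      congr 1
      have := he0 i
      field_simp
    rw [h3]
    rw [abs_le] at h2
    rw [abs_of_nonneg (by linarith)]
    have := hDpos k
    constructor <;> nlinarith
  have hmain : ∀ k, lam ^ k * μ ≤ δ₀ → ∀ j ≤ k, |y j - e j| ≤ K * (lam ^ j * μ) := by
    intro k hk j
    induction j using Nat.strong_induction_on with
    | _ j ih =>
    intro hj
    have hv : ∀ i < j, |y i - e i| ≤ K * (lam ^ i * μ) := fun i hi => ih i hi (by omega)
    have hle : ∀ i ≤ k, lam ^ i * μ ≤ δ₀ := fun i hi =>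
      (mul_le_mul_of_nonneg_right (pow_le_pow_right₀ hl.le hi) hμ).trans hk
    set Q : ℕ → ℝ := fun k => ∏ i ∈ Finset.range k, |y i + e i| with hQ
    have hQb : ∀ i ≤ j, D i / 2 ≤ Q i ∧ Q i ≤ 2 * D i := by
      intro i hi
      have := hprod i (hle i (by omega)) (fun i' hi' => hv i' (by omega)) (1 / 2) (by norm_num) (by norm_num)
      have e1 : ∏ i' ∈ Finset.range i, |2 * e i' + 2 * (1 / 2) * (y i' - e i')| = Q i :=
        Finset.prod_congr rfl fun i' _ => by congr 1; ring
      rwa [e1] at this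
    have hQpos : ∀ i ≤ j, 0 < Q i := fun i hi => by have := hQb i hi; have := hDpos i; linarith
    have hsum : ∀ i ≤ j, |y i - e i| ≤ Q i * (μ + μ * ∑ l ∈ Finset.range i, 1 / Q (l + 1)) := by
      intro i
      induction i with
      | zero => intro _; simpa [hQ] using hy0
      | succ i ih2 =>
        intro hi
        have ih3 := ih2 (by omega)
        have hQs : Q (i + 1) = Q i * |y i + e i| := by simp only [hQ]; rw [Finset.prod_range_succ]
        have e2 : y (i + 1) - e (i + 1) = (y (i + 1) - qm a (y i)) + (-(y i + e i)) * (y i - e i) := by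
          have : e (i + 1) = qm a (e i) := orb_succ a 0 (i + 1)
          rw [this]; unfold qm; ring
        have hp := hQpos (i + 1) hi
        calc |y (i + 1) - e (i + 1)| ≤ μ + |y i + e i| * |y i - e i| := by
              rw [e2]
              refine (abs_add_le _ _).trans ?_
              rw [abs_mul, abs_neg]
              exact add_le_add ((hy i).trans hαμ) le_rfl
          _ ≤ μ + |y i + e i| * (Q i * (μ + μ * ∑ l ∈ Finset.range i, 1 / Q (l + 1))) :=
              add_le_add le_rfl (mul_le_mul_of_nonneg_left ih3 (abs_nonneg _))
          _ = μ + Q (i + 1) * (μ + μ * ∑ l ∈ Finset.range i, 1 / Q (l + 1)) := by rw [hQs]; ring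
          _ = Q (i + 1) * (μ + μ * ∑ l ∈ Finset.range (i + 1), 1 / Q (l + 1)) := by
              have hq : Q (i + 1) * (1 / Q (i + 1)) = 1 := by field_simp
              rw [Finset.sum_range_succ]; linear_combination (-μ) * hq
    have h4 : ∑ l ∈ Finset.range j, 1 / Q (l + 1) ≤ (2 / c) * (lam / (lam - 1)) := by
      calc ∑ l ∈ Finset.range j, 1 / Q (l + 1) ≤ ∑ l ∈ Finset.range j, (2 / c) * (1 / lam ^ l) := by
            refine Finset.sum_le_sum fun l hl' => ?_
            have h5 := (hQb (l + 1) (by have := Finset.mem_range.1 hl'; omega)).1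
            have h6 := hg.lower (l + 1)
            have h7 : lam ^ l ≤ lam ^ (l + 1) := pow_le_pow_right₀ hl.le (by omega)
            rw [div_mul_div_comm, mul_one]
            rw [div_le_div_iff₀ (hQpos _ (by have := Finset.mem_range.1 hl'; omega)) (by positivity)]
            have : c * lam ^ (l + 1) ≤ D (l + 1) := h6
            nlinarith
        _ = (2 / c) * ∑ l ∈ Finset.range j, 1 / lam ^ l := by rw [Finset.mul_sum]
        _ ≤ _ := mul_le_mul_of_nonneg_left (geom_sum_inv_le hl j) (by positivity)
    have h8 : 1 ≤ lam / (lam - 1) := by rw [le_div_iff₀ hl1]; linarith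
    have h9 : Q j ≤ 2 * (C * lam ^ j) := (hQb j le_rfl).2.trans (by
      have : D j ≤ C * lam ^ j := hg.upper j
      linarith)
    calc |y j - e j| ≤ Q j * (μ + μ * ∑ l ∈ Finset.range j, 1 / Q (l + 1)) := hsum j le_rfl
      _ ≤ (2 * (C * lam ^ j)) * (μ * (lam / (lam - 1)) + μ * ((2 / c) * (lam / (lam - 1)))) := by
          refine mul_le_mul h9 ?_ ?_ (by positivity)
          · exact add_le_add (le_mul_of_one_le_right hμ h8) (mul_le_mul_of_nonneg_left h4 hμ)
          · have : 0 ≤ ∑ l ∈ Finset.range j, 1 / Q (l + 1) := Finset.sum_nonneg fun l hl' =>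
              one_div_nonneg.2 (hQpos _ (by have := Finset.mem_range.1 hl'; omega)).le
            positivity
      _ = (K - 1) * (lam ^ j * μ) := by rw [hK]; ring
      _ ≤ K * (lam ^ j * μ) := mul_le_mul_of_nonneg_right (by linarith) (by positivity)
  intro k hk
  have hm := hmain k hk
  have p1 := hprod k hk (fun i hi => hm i hi.le) 1 (by norm_num) le_rfl
  have p2 := hprod k hk (fun i hi => hm i hi.le) (1 / 2) (by norm_num) (by norm_num)
  have e1 : ∏ i ∈ Finset.range k, |2 * e i + 2 * 1 * (y i - e i)| = dprod y k :=
    Finset.prod_congr rfl fun i' _ => by congr 1; ring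
  have e2 : ∏ i ∈ Finset.range k, |2 * e i + 2 * (1 / 2) * (y i - e i)| = 
      ∏ i ∈ Finset.range k, |y i + e i| :=
    Finset.prod_congr rfl fun i' _ => by congr 1; ring
  rw [e1] at p1
  rw [e2] at p2
  refine ⟨hm k le_rfl, ?_, p1.1, p2⟩
  have h1 : |y k - e k| ≤ η / 2 := by
    calc |y k - e k| ≤ K * (lam ^ k * μ) := hm k le_rfl
      _ ≤ K * (η / (2 * K)) := mul_le_mul_of_nonneg_left (hk.trans (min_le_left _ _)) hK0.le
      _ = η / 2 := by field_simp
  have h2 := hηe k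
  have h3 := abs_sub_abs_le_abs_sub (e k) (y k)
  rw [abs_sub_comm] at h3
  have : η ≤ |e k| := h2
  linarith

end Misiurewicz

/-- The lower bound for the derivative gained along one excursion starting at `y`. -/
def visitWeight (α w y : ℝ) : ℝ := if √α ≤ |y| then 1 else w * min 1 (|y| / α)

lemma visitWeight_nonneg {α w : ℝ} (hα : 0 ≤ α) (hw : 0 ≤ w) (y : ℝ) : 0 ≤ visitWeight α w y := by
  unfold visitWeight
  split_ifs
  · norm_num
  · have : 0 ≤ min 1 (|y| / α) := by positivity
    positivity

lemma dprod_succ_left (x : ℕ → ℝ) (k : ℕ) :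
    dprod x (k + 1) = |2 * x 0| * dprod (fun i => x (i + 1)) k := by
  simp [dprod, Finset.prod_range_succ', mul_comm]

namespace Misiurewicz

variable {a P : ℝ} (h : Misiurewicz a P)
include h

lemma bound_of_close {lam c C : ℝ} (hg : Growth a lam c C) : ∃ η δ₀ : ℝ, 0 < η ∧ 0 < δ₀ ∧
    ∀ μ α β : ℝ, ∀ x, PseudoOrbit a α β x → x 0 ^ 2 + α ≤ μ → 0 ≤ α → ∀ k, lam ^ k * μ ≤ δ₀ →
      ∀ j ≤ k, η ≤ |x (j + 1)| ∧ |x 0| * (c * lam ^ j) ≤ dprod x (j + 1) := by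
  obtain ⟨K, η, δ₀, hK, hη, hδ₀, hb⟩ := h.bound_period hg
  refine ⟨η, δ₀, hη, hδ₀, fun μ α β x hx hμ hα k hk j hj => ?_⟩
  have h0 : |x (0 + 1) - orb a 0 1| ≤ μ := by
    have e : x (0 + 1) - orb a 0 1 = (x (0 + 1) - qm a (x 0)) + (-(x 0 ^ 2)) := by
      rw [orb_succ, orb_zero]; unfold qm; ring
    rw [e]
    refine (abs_add_le _ _).trans ?_
    rw [abs_neg, abs_of_nonneg (sq_nonneg (x 0))]
    linarith [hx.step 0]
  have hμ0 : 0 ≤ μ := (abs_nonneg _).trans h0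
  have hj' : lam ^ j * μ ≤ δ₀ :=
    (mul_le_mul_of_nonneg_right (pow_le_pow_right₀ hg.one_lt.le hj) hμ0).trans hk
  obtain ⟨-, h2, h3, -⟩ := hb μ α (by nlinarith [sq_nonneg (x 0)]) (fun i => x (i + 1)) h0
    (fun i => hx.step (i + 1)) j hj'
  refine ⟨h2, ?_⟩
  have h4 := hg.lower j
  rw [dprod_succ_left, abs_mul, abs_two]
  have h5 : c * lam ^ j / 2 ≤ dprod (fun i => x (i + 1)) j := by linarith
  nlinarith [mul_le_mul_of_nonneg_left h5 (abs_nonneg (x 0))]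

/-- Bound periods for passages at distance at least `√α` from the critical point. -/
lemma bound_free {lam c C : ℝ} (hg : Growth a lam c C) : ∃ c₃ η r₀ b : ℝ, 0 < c₃ ∧ 0 < η ∧ 0 < r₀ ∧ 0 < b ∧
    ∀ α β : ℝ, ∀ x, PseudoOrbit a α β x → 0 ≤ α → √α ≤ |x 0| → x 0 ≠ 0 → |x 0| ≤ r₀ → ∃ q, 1 ≤ q ∧
      (∀ s, 1 ≤ s → s ≤ q → η ≤ |x s|) ∧ c₃ * lam ^ q ≤ dprod x q ^ 2 ∧ b < lam ^ q * x 0 ^ 2 := by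
  obtain ⟨η, δ₀, hη, hδ₀, hb⟩ := h.bound_of_close hg
  have hc := hg.c_pos
  have hl := hg.one_lt
  have hl0 : 0 < lam := by linarith
  refine ⟨δ₀ * c ^ 2 / (2 * lam ^ 2), η, √(δ₀ / 2), δ₀ / 2, by positivity, hη, by positivity, by positivity, ?_⟩
  intro α β x hx hα hxα hx0 hxr
  set μ := 2 * x 0 ^ 2
  have hμ : 0 < μ := by positivity
  have hα' : α ≤ x 0 ^ 2 := by
    rw [← sq_abs]
    exact (Real.sqrt_le_left (abs_nonneg _)).1 hxα
  have hr : μ ≤ δ₀ := by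
    have := (Real.le_sqrt (abs_nonneg _) (by positivity)).1 hxr
    rw [sq_abs] at this
    simp only [μ]; linarith
  obtain ⟨p, hp1, hp2⟩ := exists_nat_pow_near (show 1 ≤ δ₀ / μ by rwa [le_div_iff₀ hμ, one_mul]) hl
  rw [le_div_iff₀ hμ] at hp1
  rw [div_lt_iff₀ hμ] at hp2
  have hbb := hb μ α β x hx (by simp only [μ]; linarith) hα p hp1
  refine ⟨p + 1, by omega, fun s hs1 hs2 => ?_, ?_, ?_⟩
  · obtain ⟨j, rfl⟩ : ∃ j, s = j + 1 := ⟨s - 1, by omega⟩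
    exact (hbb j (by omega)).1
  · have h1 := (hbb p le_rfl).2
    have h2 : (|x 0| * (c * lam ^ p)) ^ 2 ≤ dprod x (p + 1) ^ 2 := pow_le_pow_left₀ (by positivity) h1 2
    refine le_trans ?_ h2
    rw [mul_pow, sq_abs, mul_pow, div_mul_eq_mul_div, div_le_iff₀ (by positivity)]
    calc δ₀ * c ^ 2 * lam ^ (p + 1) ≤ (lam ^ (p + 1) * μ) * c ^ 2 * lam ^ (p + 1) := by gcongr
      _ = x 0 ^ 2 * (c ^ 2 * (lam ^ p) ^ 2) * (2 * lam ^ 2) := by simp only [μ]; ring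
  · simp only [μ] at hp2; linarith

/-- Uniform expansion of pseudo-orbits outside `(-√α, √α)`. -/
lemma free_expansion {β lam c C : ℝ} (hβ : β < P) (hg : Growth a lam c C) : ∃ C₂ σ α₁ : ℝ, 0 < C₂ ∧ 1 < σ ∧ 0 < α₁ ∧
    ∀ α, 0 < α → α ≤ α₁ → (∀ x, PseudoOrbit a α β x → ∀ k, (∀ i < k, √α ≤ |x i|) → |x k| ≤ √α →
        C₂ * σ ^ k ≤ dprod x k) ∧
      ∃ Cα > 0, ∀ x, PseudoOrbit a α β x → ∀ k, (∀ i < k, √α ≤ |x i|) → Cα * σ ^ k ≤ dprod x k := by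
  obtain ⟨c₃, η, r₀, b, hc₃, hη, hr₀, hb, hfree⟩ := h.bound_free hg
  obtain ⟨δ₁, C₂, hδ₁, hC₂, hC₂1, hout⟩ := h.pseudo_outside hβ
  have hl := hg.one_lt
  have hl0 : 0 < lam := by linarith
  set A := (C₂ ^ 2 * c₃) ^ 2 with hA
  have hA0 : 0 < A := by positivity
  set δ := min (min r₀ δ₁) (min η (√(b * A)))
  have hδ : 0 < δ := by
    have : 0 < b * A := by positivity
    positivity
  have hδr : δ ≤ r₀ := (min_le_left _ _).trans (min_le_left _ _)
  have hδδ : δ ≤ δ₁ := (min_le_left _ _).trans (min_le_right _ _)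
  have hδη : δ ≤ η := (min_le_right _ _).trans (min_le_left _ _)
  have hδb : δ ≤ √(b * A) := (min_le_right _ _).trans (min_le_right _ _)
  obtain ⟨α₁, hα₁, σ₀, hσ₀, hσ'⟩ := hout δ hδ
  set σ := min σ₀ (lam ^ (1 / (4 : ℝ)))
  have hσ1 : 1 < σ := lt_min hσ₀ (Real.one_lt_rpow hl (by norm_num))
  have hσ0 : 0 < σ := by linarith
  have hσ4 : σ ^ 4 ≤ lam := by
    calc σ ^ 4 ≤ (lam ^ (1 / (4 : ℝ))) ^ 4 := pow_le_pow_left₀ hσ0.le (min_le_right _ _) 4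
      _ = lam := by
        rw [← Real.rpow_natCast, ← Real.rpow_mul hl0.le]; norm_num
  obtain ⟨cδ, hcδ, hσ⟩ := hσ' σ hσ1 (min_le_left _ _)
  have hpass : ∀ α, 0 < α → ∀ x, PseudoOrbit a α β x → √α ≤ |x 0| → |x 0| ≤ δ → ∃ q, 1 ≤ q ∧ 
      (∀ s, 1 ≤ s → s ≤ q → δ ≤ |x s|) ∧ σ ^ q ≤ C₂ * dprod x q := by
    intro α hα x hx hxα hxδ
    have hx0 : x 0 ≠ 0 := by
      intro h0
      rw [h0, abs_zero] at hxα
      have := Real.sqrt_pos.2 hα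
      linarith
    obtain ⟨q, hq1, hq2, hq3, hq4⟩ := hfree α β x hx hα.le hxα hx0 (hxδ.trans hδr)
    refine ⟨q, hq1, fun s h1 h2 => hδη.trans (hq2 s h1 h2), ?_⟩
    have hd := dprod_nonneg x q
    have hx2 : x 0 ^ 2 ≤ b * A := by
      rw [← sq_abs]
      exact (Real.le_sqrt (abs_nonneg _) (by positivity)).1 (hxδ.trans hδb)
    have hlq : 0 < lam ^ q := by positivity
    have hAq : 1 ≤ A * lam ^ q := by
      have : b * 1 ≤ b * (A * lam ^ q) := by nlinarith
      exact le_of_mul_le_mul_left this hb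
    have h4 : (σ ^ q) ^ 4 ≤ (C₂ * dprod x q) ^ 4 := by
      calc (σ ^ q) ^ 4 = (σ ^ 4) ^ q := by rw [← pow_mul, ← pow_mul, mul_comm]
        _ ≤ lam ^ q := pow_le_pow_left₀ (by positivity) hσ4 q
        _ ≤ A * lam ^ q * lam ^ q := le_mul_of_one_le_left hlq.le hAq
        _ = (C₂ ^ 2 * (c₃ * lam ^ q)) ^ 2 := by rw [hA]; ring
        _ ≤ (C₂ ^ 2 * dprod x q ^ 2) ^ 2 := by gcongr
        _ = _ := by ring
    exact le_of_pow_le_pow_left₀ (by norm_num) (by positivity) h4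
  have hmain : ∀ α, 0 < α → α ≤ α₁ → ∀ k x, PseudoOrbit a α β x → (∀ i < k, √α ≤ |x i|) → |x k| < δ → 
      C₂ * σ ^ k ≤ dprod x k := by
    intro α hα hαα k
    induction k using Nat.strong_induction_on with
    | _ k ih =>
    intro x hx hav hk
    by_cases hall : ∀ i < k, δ ≤ |x i|
    · exact (hσ x (hx.mono hαα) k hall).2 (hk.le.trans hδδ)
    · push Not at hall
      classical
      set i := Nat.find hall
      obtain ⟨hik, hiδ⟩ := Nat.find_spec hall
      have hmin : ∀ j < i, δ ≤ |x j| := by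
        intro j hj
        have := Nat.find_min hall hj
        push Not at this
        exact this (by omega)
      have e1 := (hσ x (hx.mono hαα) i hmin).2 (hiδ.le.trans hδδ)
      obtain ⟨q, hq1, hq2, hq3⟩ := hpass α hα _ (hx.shift i) (hav i hik) hiδ.le
      have hiq : i + q < k := by
        by_contra hge
        push Not at hge
        have := hq2 (k - i) (by omega) (by omega)
        rw [show i + (k - i) = k by omega] at this
        linarith
      obtain ⟨m, hm⟩ := Nat.exists_eq_add_of_le hiq.le
      have e2 := ih m (by omega) _ (hx.shift (i + q)) (fun j hj => hav _ (by omega)) (by rwa [← hm])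
      rw [hm, dprod_add, dprod_add]
      have hpos1 : 0 < σ ^ i := by positivity
      have hpos2 : 0 < σ ^ m := by positivity
      calc C₂ * σ ^ (i + q + m) = σ ^ i * σ ^ q * (C₂ * σ ^ m) := by ring
        _ ≤ σ ^ i * (C₂ * dprod (fun j => x (i + j)) q) * (C₂ * σ ^ m) := by gcongr
        _ = (C₂ * σ ^ i) * dprod (fun j => x (i + j)) q * (C₂ * σ ^ m) := by ring
        _ ≤ _ := by
          have := dprod_nonneg (fun j => x (i + j)) q
          have := dprod_nonneg x i
          gcongr
  refine ⟨C₂, σ, min α₁ (δ ^ 2 / 4), hC₂, hσ1, by positivity, fun α hα hαα => ⟨?_, ?_⟩⟩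
  · intro x hx k hav hk
    refine hmain α hα (hαα.trans (min_le_left _ _)) k x hx hav (hk.trans_lt ?_)
    rw [Real.sqrt_lt' hδ]
    have := hαα.trans (min_le_right _ _)
    have : 0 < δ ^ 2 := by positivity
    linarith
  · have hsα := Real.sqrt_pos.2 hα
    refine ⟨min cδ (C₂ * (2 * √α) * cδ / σ), by positivity, fun x hx k hav => ?_⟩
    by_cases hall : ∀ i < k, δ ≤ |x i|
    · have := (hσ x (hx.mono (hαα.trans (min_le_left _ _))) k hall).1
      exact (mul_le_mul_of_nonneg_right (min_le_left _ _) (by positivity)).trans this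
    · push Not at hall
      obtain ⟨i₀, hi₀, hi₀'⟩ := hall
      have hex := Finset.exists_max_image ((Finset.range k).filter fun i => |x i| < δ) id 
        ⟨i₀, by simp; exact ⟨hi₀, hi₀'⟩⟩
      simp only [Finset.mem_filter, Finset.mem_range, id] at hex
      obtain ⟨i, ⟨hik, hiδ⟩, hmax⟩ := hex
      obtain ⟨m, rfl⟩ : ∃ m, k = i + (1 + m) := ⟨k - i - 1, by omega⟩
      have e1 := hmain α hα (hαα.trans (min_le_left _ _)) i x hx (fun j hj => hav j (by omega)) hiδ
      have e2 := (hσ _ ((hx.mono (hαα.trans (min_le_left _ _))).shift (i + 1)) m (fun j hj => by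
        by_contra hlt
        push Not at hlt
        have := hmax (i + 1 + j) ⟨by omega, hlt⟩
        omega)).1
      have e3 := hav i (by omega)
      rw [dprod_add, dprod_add, dprod_one, add_zero, abs_mul, abs_two]
      simp only [← add_assoc]
      have hp := dprod_nonneg (fun j => x (i + 1 + j)) m
      have hp' := dprod_nonneg x i
      calc _ ≤ (C₂ * (2 * √α) * cδ / σ) * σ ^ (i + 1 + m) := mul_le_mul_of_nonneg_right (min_le_right _ _) (by positivity)
        _ = C₂ * σ ^ i * ((2 * √α) * (cδ * σ ^ m)) := by field_simp; ring
        _ ≤ _ := by gcongr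

/-- The deterministic lower bound for derivatives of pseudo-orbits. -/
theorem deterministic_bound {β lam c C : ℝ} (hβ : β < P) (hg : Growth a lam c C) : ∃ δ₀' > 0, ∀ δ₀ > 0, δ₀ ≤ δ₀' →
    ∃ σ c₁ α₁ : ℝ, 1 < σ ∧ 0 < c₁ ∧ 0 < α₁ ∧ ∀ α, 0 < α → α ≤ α₁ → ∀ N : ℕ, lam ^ N * (5 * α) ≤ δ₀ →
      δ₀ < lam ^ (N + 1) * (5 * α) → 
      (∀ x, PseudoOrbit a α β x → |x 0| < 2 * √α → ∀ i, 1 ≤ i → i ≤ N → 2 * √α ≤ |x i|) ∧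
      ∃ Cα > 0, ∀ x, PseudoOrbit a α β x → ∀ n,
        Cα * σ ^ n * ∏ i ∈ Finset.range n, visitWeight α (c₁ / σ ^ N) (x i) ≤ dprod x n := by
  obtain ⟨η, δ₀', hη, hδ₀', hbd⟩ := h.bound_of_close hg
  obtain ⟨C₂, σ, α₂, hC₂, hσ1, hα₂, hfree⟩ := h.free_expansion hβ hg
  have hl := hg.one_lt
  have hl0 : 0 < lam := by linarith
  have hc := hg.c_pos
  have hσ0 : 0 < σ := by linarith
  refine ⟨δ₀', hδ₀', fun δ₀ hδ₀ hδδ => ?_⟩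
  set c₀ := c * (δ₀ / (5 * lam ^ 2)) with hc₀
  have hc₀0 : 0 < c₀ := by positivity
  refine ⟨σ, min 1 (C₂ * c₀), min α₂ (min (δ₀ / (5 * lam)) (η ^ 2 / 4)), hσ1, by positivity, by positivity, ?_⟩
  intro α hα hαα N hN1 hN2
  have hαα₂ := hαα.trans (min_le_left _ _)
  have hαδ := hαα.trans ((min_le_right _ _).trans (min_le_left _ _))
  have hαη := hαα.trans ((min_le_right _ _).trans (min_le_right _ _))
  have hsα := Real.sqrt_pos.2 hα
  have hN : 1 ≤ N := by
    rcases Nat.eq_zero_or_pos N with rfl | hN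
    · rw [le_div_iff₀ (by positivity)] at hαδ
      rw [zero_add, pow_one] at hN2
      linarith
    · exact hN
  have hsη : 2 * √α ≤ η := by
    have : √α ≤ η / 2 := by
      rw [Real.sqrt_le_left (by positivity)]; linarith
    linarith
  have hb : ∀ x, PseudoOrbit a α β x → |x 0| < 2 * √α → ∀ j ≤ N, η ≤ |x (j + 1)| ∧ 
      |x 0| * (c * lam ^ j) ≤ dprod x (j + 1) := by
    intro x hx hx0 j hj
    refine hbd (5 * α) α β x hx ?_ hα.le N (hN1.trans hδδ) j hj
    have : x 0 ^ 2 < (2 * √α) ^ 2 := by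
      rw [← sq_abs]
      exact pow_lt_pow_left₀ hx0 (abs_nonneg _) (by norm_num)
    rw [mul_pow, Real.sq_sqrt hα.le] at this
    linarith
  have hsp : ∀ x, PseudoOrbit a α β x → |x 0| < 2 * √α → ∀ i, 1 ≤ i → i ≤ N → 2 * √α ≤ |x i| := by
    intro x hx hx0 i hi1 hi2
    obtain ⟨j, rfl⟩ : ∃ j, i = j + 1 := ⟨i - 1, by omega⟩
    exact hsη.trans (hb x hx hx0 j (by omega)).1
  refine ⟨hsp, ?_⟩
  obtain ⟨hf1, Cα, hCα, hf2⟩ := hfree α hα hαα₂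
  set c₁ := min 1 (C₂ * c₀) with hc₁
  have hc₁0 : 0 < c₁ := by positivity
  have hc₁1 : c₁ ≤ 1 := min_le_left _ _
  have hc₁2 : c₁ ≤ C₂ * c₀ := min_le_right _ _
  set w := c₁ / σ ^ N with hw
  have hw0 : 0 < w := by positivity
  set M := min Cα (C₂ * c * α) with hM
  have hM0 : 0 < M := by positivity
  have hM2 : M ≤ C₂ * c * α := min_le_right _ _
  refine ⟨M, hM0, fun x hx n => ?_⟩
  have hWnn : ∀ (y : ℕ → ℝ) m, 0 ≤ ∏ i ∈ Finset.range m, visitWeight α w (y i) := fun y m =>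
    Finset.prod_nonneg fun i _ => visitWeight_nonneg hα.le hw0.le _
  induction n using Nat.strong_induction_on generalizing x with
  | _ n ih =>
  by_cases hall : ∀ i < n, √α ≤ |x i|
  · have h1 : ∏ i ∈ Finset.range n, visitWeight α w (x i) = 1 :=
      Finset.prod_eq_one fun i hi => if_pos (hall i (Finset.mem_range.1 hi))
    rw [h1, mul_one]
    exact (mul_le_mul_of_nonneg_right (min_le_left _ _) (by positivity)).trans (hf2 x hx n hall)
  · push Not at hall
    classical
    obtain ⟨hin, hix⟩ := Nat.find_spec hall
    have hmin : ∀ j < Nat.find hall, √α ≤ |x j| := by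
      intro j hj
      have := Nat.find_min hall hj
      push Not at this
      exact this (by omega)
    generalize Nat.find hall = i at hin hix hmin
    obtain ⟨m, rfl⟩ := Nat.exists_eq_add_of_le hin.le
    have hm : 1 ≤ m := by omega
    have e1 := hf1 x hx i hmin hix.le
    rw [dprod_add, Finset.prod_range_add]
    have h1 : ∏ j ∈ Finset.range i, visitWeight α w (x j) = 1 :=
      Finset.prod_eq_one fun j hj => if_pos (hmin j (Finset.mem_range.1 hj))
    rw [h1, one_mul]
    set z : ℕ → ℝ := fun j => x (i + j) with hz
    have hzP : PseudoOrbit a α β z := hx.shift i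
    have hz0 : |z 0| < √α := hix
    have hz0' : |z 0| < 2 * √α := by linarith
    have hvis : ∀ m', 1 ≤ m' → m' ≤ N → ∏ j ∈ Finset.range m', visitWeight α w (z j) = w * min 1 (|z 0| / α) := by
      intro m' h1 h2
      rw [Finset.prod_eq_single_of_mem 0 (by simp; omega)]
      · exact if_neg (by push Not; exact hz0)
      · intro j hj hj0
        refine if_pos ?_
        have := hsp z hzP hz0' j (by omega) (by have := Finset.mem_range.1 hj; omega)
        linarith
    have hzmin : min 1 (|z 0| / α) ≤ |z 0| / α := min_le_right _ _
    have hzmin0 : 0 ≤ min 1 (|z 0| / α) := by positivity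
    rcases le_or_gt N m with hNm | hNm
    · obtain ⟨m', rfl⟩ := Nat.exists_eq_add_of_le hNm
      have e2 := ih m' (by omega) _ (hzP.shift N)
      have e3 : c₀ * (|z 0| / α) ≤ dprod z N := by
        obtain ⟨N', rfl⟩ : ∃ N', N = N' + 1 := ⟨N - 1, by omega⟩
        refine le_trans ?_ (hb z hzP hz0' N' (by omega)).2
        have : δ₀ / (5 * lam ^ 2 * α) ≤ lam ^ N' := by
          rw [div_le_iff₀ (by positivity)]
          calc δ₀ ≤ lam ^ (N' + 1 + 1) * (5 * α) := hN2.le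
            _ = _ := by ring
        calc c₀ * (|z 0| / α) = |z 0| * (c * (δ₀ / (5 * lam ^ 2 * α))) := by rw [hc₀]; field_simp
          _ ≤ _ := by gcongr
      rw [Finset.prod_range_add, hvis N hN le_rfl, dprod_add]
      have hR := hWnn (fun j => z (N + j)) m'
      set R := ∏ j ∈ Finset.range m', visitWeight α w (z (N + j))
      calc M * σ ^ (i + (N + m')) * (w * min 1 (|z 0| / α) * R)
          = σ ^ i * (c₁ * min 1 (|z 0| / α)) * (M * σ ^ m' * R) := by rw [hw]; field_simp; ring
        _ ≤ σ ^ i * (C₂ * c₀ * (|z 0| / α)) * (M * σ ^ m' * R) := by gcongr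
        _ = (C₂ * σ ^ i) * ((c₀ * (|z 0| / α)) * (M * σ ^ m' * R)) := by ring
        _ ≤ _ := by
          have := dprod_nonneg z N
          have := dprod_nonneg x i
          gcongr
    · rw [hvis m hm hNm.le]
      have e3 : |z 0| * c ≤ dprod z m := by
        obtain ⟨m', rfl⟩ : ∃ m', m = m' + 1 := ⟨m - 1, by omega⟩
        refine le_trans ?_ (hb z hzP hz0' m' (by omega)).2
        have : 1 ≤ lam ^ m' := one_le_pow₀ hl.le
        gcongr
        nlinarith
      have hσm : σ ^ m * w ≤ 1 := by
        rw [hw, mul_div_assoc', div_le_one (by positivity)]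
        calc σ ^ m * c₁ ≤ σ ^ N * 1 := by
              gcongr
              exact hσ1.le
          _ = _ := mul_one _
      calc M * σ ^ (i + m) * (w * min 1 (|z 0| / α)) = M * σ ^ i * ((σ ^ m * w) * min 1 (|z 0| / α)) := by ring
        _ ≤ (C₂ * c * α) * σ ^ i * (1 * (|z 0| / α)) := by gcongr
        _ = C₂ * σ ^ i * (|z 0| * c) := by field_simp
        _ ≤ _ := by
          have := dprod_nonneg x i
          gcongr

end Misiurewicz

/-- `F` is a holomorphic function on the disc of radius `ρ` about `0` that extends `f`. -/
structure IsCExt (f : ℝ → ℝ) (ρ : ℝ) (F : ℂ → ℂ) : Prop where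
  diff : DifferentiableOn ℂ F (Metric.ball 0 ρ)
  ext : ∀ s : ℝ, |s| < ρ → F s = f s

namespace IsCExt

variable {f : ℝ → ℝ} {ρ : ℝ} {F : ℂ → ℂ}

lemma iteratedDeriv (h : IsCExt f ρ F) (m : ℕ) :
    IsCExt (_root_.iteratedDeriv m f) ρ (_root_.iteratedDeriv m F) ∧
      ∀ s : ℝ, |s| < ρ →
        HasDerivAt (_root_.iteratedDeriv m f) (_root_.iteratedDeriv (m + 1) f s) s := by
  have step : ∀ (f : ℝ → ℝ) (F : ℂ → ℂ), IsCExt f ρ F →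
      IsCExt (deriv f) ρ (deriv F) ∧ ∀ s : ℝ, |s| < ρ → HasDerivAt f (deriv f s) s := by
    intro f F h
    have key : ∀ s : ℝ, |s| < ρ → HasDerivAt F (deriv F s) (s : ℂ) := fun s hs =>
      (h.diff.differentiableAt (Metric.isOpen_ball.mem_nhds (by simpa using hs))).hasDerivAt
    have ev : ∀ s : ℝ, |s| < ρ → f =ᶠ[nhds s] fun x : ℝ => (F x).re := fun s hs => by
      have : {x : ℝ | |x| < ρ} ∈ nhds s := (isOpen_lt continuous_abs continuous_const).mem_nhds hs
      filter_upwards [this] with x hx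
      rw [h.ext x hx, Complex.ofReal_re]
    have hd : ∀ s : ℝ, |s| < ρ → HasDerivAt f (deriv F s).re s := fun s hs =>
      (key s hs).real_of_complex.congr_of_eventuallyEq (ev s hs)
    have hd2 : ∀ s : ℝ, |s| < ρ → HasDerivAt (fun x : ℝ => (f x : ℂ)) (deriv F s) s := fun s hs => by
      have h1 : HasDerivAt (fun x : ℝ => F x) (deriv F s) s := (key s hs).comp_ofReal
      refine h1.congr_of_eventuallyEq ?_
      have : {x : ℝ | |x| < ρ} ∈ nhds s := (isOpen_lt continuous_abs continuous_const).mem_nhds hs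
      filter_upwards [this] with x hx
      rw [h.ext x hx]
    refine ⟨⟨h.diff.deriv Metric.isOpen_ball, fun s hs => ?_⟩, fun s hs => ?_⟩
    · rw [(hd s hs).deriv]
      have h3 := (hd s hs).ofReal_comp
      exact (hd2 s hs).unique (by rw [(hd s hs).deriv.symm] at h3 ⊢; exact h3)
    · rw [(hd s hs).deriv]; exact hd s hs
  induction m with
  | zero =>
    simp only [iteratedDeriv_zero, zero_add, iteratedDeriv_one]
    exact ⟨h, (step f F h).2⟩
  | succ m ih =>
    have h1 : IsCExt (_root_.iteratedDeriv (m + 1) f) ρ (_root_.iteratedDeriv (m + 1) F) := by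
      rw [iteratedDeriv_succ, iteratedDeriv_succ]
      exact (step _ _ ih.1).1
    refine ⟨h1, fun s hs => ?_⟩
    rw [iteratedDeriv_succ (n := m + 1)]
    exact (step _ _ h1).2 s hs

lemma iteratedDeriv_zero_eq (h : IsCExt f ρ F) (hρ : 0 < ρ) (m : ℕ) :
    _root_.iteratedDeriv m F 0 = ((_root_.iteratedDeriv m f 0 : ℝ) : ℂ) := by
  simpa using (h.iteratedDeriv m).1.ext 0 (by simpa using hρ)

/-- Cauchy's estimate at the centre. -/
lemma abs_iteratedDeriv_le (h : IsCExt f ρ F) (hρ : 0 < ρ) {C : ℝ}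
    (hC : ∀ z ∈ Metric.ball (0 : ℂ) ρ, ‖F z‖ ≤ C) (m : ℕ) :
    |_root_.iteratedDeriv m f 0| ≤ m.factorial * C / (ρ / 2) ^ m := by
  have h1 := Complex.norm_iteratedDeriv_le_of_forall_mem_sphere_norm_le (c := 0) (R := ρ / 2)
    (C := C) (f := F) m (by positivity) (h.diff.diffContOnCl_ball (c := 0) (by
      intro z hz
      simp only [Metric.mem_closedBall, dist_zero_right, Metric.mem_ball] at hz ⊢
      linarith)) (fun z hz => hC z (by
      simp only [mem_sphere_iff_norm, sub_zero, Metric.mem_ball, dist_zero_right] at hz ⊢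
      linarith))
  rwa [h.iteratedDeriv_zero_eq hρ, Complex.norm_real, Real.norm_eq_abs] at h1

end IsCExt

/-- A periodic real-analytic function extends to discs of a uniform radius about all real points,
with a uniform Lipschitz constant at the centre. -/
lemma exists_uniform_cext {φ : ℝ → ℝ} (hφa : ∀ x : ℝ, AnalyticAt ℝ φ x)
    (hφp : Function.Periodic φ 1) :
    ∃ ρ > 0, ∃ M > 0, ∀ c : ℝ, ∃ Φ : ℂ → ℂ, IsCExt (fun s => φ (c + s)) ρ Φ ∧
      ∀ z ∈ Metric.ball (0 : ℂ) ρ, ‖Φ z - φ c‖ ≤ M * ‖z‖ := by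
  have loc : ∃ ρ > 0, ∃ M > 0, ∀ c ∈ Icc (0 : ℝ) 1, ∃ Φ : ℂ → ℂ,
      IsCExt (fun s => φ (c + s)) ρ Φ ∧
      ∀ z ∈ Metric.ball (0 : ℂ) ρ, ‖Φ z - φ c‖ ≤ M * ‖z‖ := by
    refine isCompact_Icc.induction_on (p := fun S => ∃ ρ > 0, ∃ M > 0, ∀ c ∈ S, ∃ Φ : ℂ → ℂ,
      IsCExt (fun s => φ (c + s)) ρ Φ ∧
      ∀ z ∈ Metric.ball (0 : ℂ) ρ, ‖Φ z - φ c‖ ≤ M * ‖z‖) ?_ ?_ ?_ ?_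
    · exact ⟨1, one_pos, 1, one_pos, fun c hc => hc.elim⟩
    · rintro s t hst ⟨ρ, hρ, M, hM, h⟩
      exact ⟨ρ, hρ, M, hM, fun c hc => h c (hst hc)⟩
    · rintro s t ⟨ρ, hρ, M, hM, h⟩ ⟨ρ', hρ', M', hM', h'⟩
      have mono : ∀ {ρ₁ ρ₂ M₁ M₂ c : ℝ} {Φ : ℂ → ℂ}, ρ₂ ≤ ρ₁ → M₁ ≤ M₂ →
          (IsCExt (fun s => φ (c + s)) ρ₁ Φ ∧
            ∀ z ∈ Metric.ball (0 : ℂ) ρ₁, ‖Φ z - φ c‖ ≤ M₁ * ‖z‖) →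
          IsCExt (fun s => φ (c + s)) ρ₂ Φ ∧
            ∀ z ∈ Metric.ball (0 : ℂ) ρ₂, ‖Φ z - φ c‖ ≤ M₂ * ‖z‖ := by
        rintro ρ₁ ρ₂ M₁ M₂ c Φ hρ hM ⟨h1, h2⟩
        exact ⟨⟨h1.diff.mono (Metric.ball_subset_ball hρ), fun s hs => h1.ext s (hs.trans_le hρ)⟩,
          fun z hz => (h2 z (Metric.ball_subset_ball hρ hz)).trans (by gcongr)⟩
      refine ⟨min ρ ρ', lt_min hρ hρ', max M M', lt_max_of_lt_left hM, fun c hc => ?_⟩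
      rcases hc with hc | hc
      · obtain ⟨Φ, hΦ⟩ := h c hc
        exact ⟨Φ, mono (min_le_left _ _) (le_max_left _ _) hΦ⟩
      · obtain ⟨Φ, hΦ⟩ := h' c hc
        exact ⟨Φ, mono (min_le_right _ _) (le_max_right _ _) hΦ⟩
    · intro x₀ _
      obtain ⟨p, r, hp⟩ := hφa x₀
      obtain ⟨r', hr'0, hr'⟩ : ∃ r' : NNReal, 0 < r' ∧ (r' : ℝ≥0∞) < r := by
        obtain ⟨q, hq1, hq2⟩ := ENNReal.lt_iff_exists_nnreal_btwn.1 hp.r_pos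
        exact ⟨q, by exact_mod_cast hq1, hq2⟩
      have hr0 : (0 : ℝ) < r' := hr'0
      have hsum : Summable fun n => ‖p.coeff n‖ * (r' : ℝ) ^ n := by
        simpa only [FormalMultilinearSeries.norm_apply_eq_norm_coef] using
          p.summable_norm_mul_pow (hr'.trans_le hp.r_le)
      have hbd : ∀ (n : ℕ), ∀ w ∈ Metric.ball (0 : ℂ) r',
          ‖((p.coeff n : ℝ) : ℂ) * w ^ n‖ ≤ ‖p.coeff n‖ * (r' : ℝ) ^ n := by
        intro n w hw
        rw [norm_mul, norm_pow, Complex.norm_real]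
        have : ‖w‖ ≤ r' := by simpa using (Metric.mem_ball.1 hw).le
        gcongr
      set Ψ : ℂ → ℂ := fun w => ∑' n, ((p.coeff n : ℝ) : ℂ) * w ^ n with hΨ
      have hΨd : DifferentiableOn ℂ Ψ (Metric.ball 0 r') :=
        Complex.differentiableOn_tsum_of_summable_norm hsum
          (fun n => by fun_prop) Metric.isOpen_ball hbd
      have hΨr : ∀ s : ℝ, |s| < r' → Ψ s = φ (x₀ + s) := by
        intro s hs
        have h1 := hp.hasSum (y := s) (by
          rw [Metric.mem_eball, edist_zero_right]
          refine lt_trans ?_ hr'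
          rw [← ofReal_norm, ← ENNReal.ofReal_coe_nnreal]
          exact (ENNReal.ofReal_lt_ofReal_iff hr0).2 hs)
        have h2 := (Complex.hasSum_ofReal (L := SummationFilter.unconditional ℕ)).2 h1
        rw [← h2.tsum_eq]
        refine tsum_congr fun n => ?_
        rw [FormalMultilinearSeries.apply_eq_pow_smul_coeff]
        push_cast [smul_eq_mul]
        ring
      set B := ∑' n, ‖p.coeff n‖ * (r' : ℝ) ^ n
      have hB0 : 0 ≤ B := tsum_nonneg fun n => by positivity
      have hΨb : ∀ w ∈ Metric.ball (0 : ℂ) r', ‖Ψ w‖ ≤ B := fun w hw =>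
        tsum_of_norm_bounded hsum.hasSum fun n => hbd n w hw
      refine ⟨Metric.ball x₀ (r' / 2), mem_nhdsWithin_of_mem_nhds
        (Metric.ball_mem_nhds _ (by positivity)), r' / 2, by positivity,
        (2 * B + 1) / (r' / 2), by positivity, fun c hc => ?_⟩
      have hc' : |c - x₀| < r' / 2 := by simpa [Real.dist_eq] using hc
      have hin : ∀ z ∈ Metric.ball (0 : ℂ) (r' / 2),
          z + ((c - x₀ : ℝ) : ℂ) ∈ Metric.ball (0 : ℂ) r' := by
        intro z hz
        simp only [Metric.mem_ball, dist_zero_right] at hz ⊢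
        have h1 := norm_add_le z ((c - x₀ : ℝ) : ℂ)
        rw [Complex.norm_real, Real.norm_eq_abs] at h1
        linarith
      have hD : DifferentiableOn ℂ (fun z : ℂ => Ψ (z + ((c - x₀ : ℝ) : ℂ)))
          (Metric.ball 0 (r' / 2)) := by
        refine hΨd.comp (f := fun z : ℂ => z + ((c - x₀ : ℝ) : ℂ)) (by fun_prop) hin
      have hval : ∀ s : ℝ, |s| < r' / 2 → Ψ (s + ((c - x₀ : ℝ) : ℂ)) = φ (c + s) := by
        intro s hs
        rw [← Complex.ofReal_add, hΨr]
        · congr 2; ring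
        · have := abs_add_le s (c - x₀)
          linarith
      refine ⟨fun z => Ψ (z + ((c - x₀ : ℝ) : ℂ)), ⟨hD, hval⟩, fun z hz => ?_⟩
      have h0 : Ψ (0 + ((c - x₀ : ℝ) : ℂ)) = φ c := by
        have := hval 0 (by simpa using hr0)
        simpa using this
      have h1 := Complex.dist_le_div_mul_dist_of_mapsTo_ball (R₂ := 2 * B + 1) hD (fun w hw => by
        rw [Metric.mem_closedBall, dist_eq_norm]
        refine (norm_sub_le _ _).trans ?_
        have h2 := hΨb _ (hin w hw)
        have h3 := hΨb _ (hin 0 (by simpa using hr0))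
        linarith) hz
      simp only [dist_eq_norm, sub_zero] at h1
      rw [h0] at h1
      exact h1
  obtain ⟨ρ, hρ, M, hM, h⟩ := loc
  refine ⟨ρ, hρ, M, hM, fun c => ?_⟩
  obtain ⟨Φ, h1, h2⟩ := h (Int.fract c) ⟨Int.fract_nonneg c, (Int.fract_lt_one c).le⟩
  have e : ∀ s, φ (Int.fract c + s) = φ (c + s) := fun s => by
    have := (hφp.int_mul ⌊c⌋) (Int.fract c + s)
    rw [mul_one] at this
    rw [← this]
    congr 1
    have := Int.fract_add_floor c
    linarith
  have e0 : φ (Int.fract c) = φ c := by simpa using e 0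
  simp only [e] at h1
  rw [e0] at h2
  exact ⟨Φ, h1, h2⟩

section Fibre

variable (a : ℝ) (d : ℕ) (φ : ℝ → ℝ) (α : ℝ)

lemma viana_iterate_fst (n : ℕ) (p : ℝ × ℝ) : ((Viana a d φ α)^[n] p).1 = (d : ℝ) ^ n * p.1 := by
  induction n with
  | zero => simp
  | succ n ih =>
    rw [Function.iterate_succ_apply', pow_succ']
    simp only [Viana, ih]
    ring

lemma fn_zero (θ x : ℝ) : fn a d φ α 0 θ x = x := rfl

lemma fn_succ (n : ℕ) (θ x : ℝ) :
    fn a d φ α (n + 1) θ x = qm a (fn a d φ α n θ x) + α * φ ((d : ℝ) ^ n * θ) := by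
  have := viana_iterate_fst a d φ α n (θ, x)
  unfold fn
  rw [Function.iterate_succ_apply']
  simp only [Viana, this]

lemma fn_add (m n : ℕ) (θ x : ℝ) :
    fn a d φ α (m + n) θ x = fn a d φ α n ((d : ℝ) ^ m * θ) (fn a d φ α m θ x) := by
  induction n with
  | zero => rfl
  | succ n ih =>
    rw [← add_assoc, fn_succ, fn_succ, ih, pow_add]
    congr 3
    ring

variable {φ} in
lemma fn_add_int (hφp : Function.Periodic φ 1) (n : ℕ) (θ x : ℝ) (j : ℤ) :
    fn a d φ α n (θ + j) x = fn a d φ α n θ x := by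
  induction n with
  | zero => rfl
  | succ n ih =>
    rw [fn_succ, fn_succ, ih]
    congr 2
    have := (hφp.int_mul (d ^ n * j)) ((d : ℝ) ^ n * θ)
    rw [← this]
    push_cast
    congr 1
    ring

lemma hasDerivAt_fn (n : ℕ) (θ x : ℝ) :
    HasDerivAt (fun y => fn a d φ α n θ y)
      (∏ i ∈ Finset.range n, (-2 * fn a d φ α i θ x)) x := by
  induction n with
  | zero =>
    simp only [Finset.range_zero, Finset.prod_empty, fn_zero]
    exact hasDerivAt_id x
  | succ n ih =>
    simp only [fn_succ, qm, Finset.prod_range_succ]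
    have := ((ih.pow 2).const_sub a).add_const (α * φ ((d : ℝ) ^ n * θ))
    refine this.congr_deriv ?_
    push_cast
    ring

lemma abs_deriv_fn (n : ℕ) (θ x : ℝ) :
    |deriv (fun y => fn a d φ α n θ y) x| = dprod (fun i => fn a d φ α i θ x) n := by
  rw [(hasDerivAt_fn a d φ α n θ x).deriv, Finset.abs_prod, dprod]
  simp [abs_mul]

end Fibre

/-- For small noise the fibre maps leave `[-β, β]` invariant. -/
lemma exists_fn_mem {a β : ℝ} (hβ : 0 < β) (hβmap : ∀ x ∈ Icc (-β) β, qm a x ∈ Ioo (-β) β) :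
    ∃ α₀ > 0, ∀ α, 0 ≤ α → α ≤ α₀ → ∀ (d : ℕ) (φ : ℝ → ℝ), (∀ θ, |φ θ| ≤ 1) →
      ∀ n θ x, x ∈ Icc (-β) β → fn a d φ α n θ x ∈ Icc (-β) β := by
  have hc : IsCompact (Icc (-β) β) := isCompact_Icc
  obtain ⟨x₀, hx₀, hmax⟩ := hc.exists_isMaxOn ⟨0, by constructor <;> linarith⟩
    (continuous_abs.comp (continuous_qm a)).continuousOn
  have h0 := hβmap x₀ hx₀
  refine ⟨β - |qm a x₀|, by have := abs_lt.2 h0; linarith, fun α hα hα' d φ hφ n θ x hx => ?_⟩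
  induction n with
  | zero => exact hx
  | succ n ih =>
    rw [fn_succ]
    have h1 : |qm a (fn a d φ α n θ x)| ≤ |qm a x₀| := hmax ih
    have h2 : |α * φ ((d : ℝ) ^ n * θ)| ≤ α := by
      rw [abs_mul, abs_of_nonneg hα]
      exact mul_le_of_le_one_right hα (hφ _)
    have h3 := abs_add_le (qm a (fn a d φ α n θ x)) (α * φ ((d : ℝ) ^ n * θ))
    exact abs_le.1 (by linarith)

section NonDegenerate

variable {φ : ℝ → ℝ}

lemma periodic_iteratedDeriv (hφp : Function.Periodic φ 1) (m : ℕ) :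
    Function.Periodic (iteratedDeriv m φ) 1 := by
  intro x
  have h : (fun z => φ (z + 1)) = φ := funext hφp
  have := congrFun (iteratedDeriv_comp_add_const m φ 1) x
  rw [h] at this
  exact this.symm

lemma contDiff_of_analyticAt (hφa : ∀ x : ℝ, AnalyticAt ℝ φ x) (n : WithTop ℕ∞) :
    ContDiff ℝ n φ := contDiff_iff_contDiffAt.2 fun x => (hφa x).contDiffAt

lemma hasDerivAt_iteratedDeriv (hφa : ∀ x : ℝ, AnalyticAt ℝ φ x) (m : ℕ) (x : ℝ) :
    HasDerivAt (iteratedDeriv m φ) (iteratedDeriv (m + 1) φ x) x := by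
  rw [iteratedDeriv_succ]
  exact (((contDiff_of_analyticAt hφa (m + 1)).differentiable_iteratedDeriv m
    (by exact_mod_cast Nat.lt_succ_self m)) x).hasDerivAt

/-- The derivatives of a continuous periodic function attain their maximal modulus. -/
lemma exists_max_iteratedDeriv (hφa : ∀ x : ℝ, AnalyticAt ℝ φ x) (hφp : Function.Periodic φ 1)
    (m : ℕ) : ∃ y, ∀ x, |iteratedDeriv m φ x| ≤ |iteratedDeriv m φ y| := by
  have hc : Continuous (iteratedDeriv m φ) :=
    continuous_iff_continuousAt.2 fun x => (hasDerivAt_iteratedDeriv hφa m x).continuousAt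
  obtain ⟨y, -, hy⟩ := isCompact_Icc.exists_isMaxOn (nonempty_Icc.2 (zero_le_one (α := ℝ)))
    (continuous_abs.comp hc).continuousOn
  refine ⟨y, fun x => ?_⟩
  obtain ⟨z, hz, e⟩ := (periodic_iteratedDeriv hφp m).exists_mem_Ico₀ one_pos x
  rw [e]
  exact hy (Ico_subset_Icc_self hz)

lemma exists_iteratedDeriv_ne_zero (hφa : ∀ x : ℝ, AnalyticAt ℝ φ x)
    (hφp : Function.Periodic φ 1) (hφnc : ∃ s t : ℝ, φ s ≠ φ t) (m : ℕ) :
    ∃ x, iteratedDeriv (m + 1) φ x ≠ 0 := by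
  have step : ∀ k, (∀ x, iteratedDeriv (k + 1) φ x = 0) →
      ∀ x y, iteratedDeriv k φ x = iteratedDeriv k φ y := fun k hk =>
    is_const_of_deriv_eq_zero (fun x => (hasDerivAt_iteratedDeriv hφa k x).differentiableAt)
      fun x => (hasDerivAt_iteratedDeriv hφa k x).deriv.trans (hk x)
  have step2 : ∀ k, (∀ x, iteratedDeriv (k + 2) φ x = 0) → ∀ x, iteratedDeriv (k + 1) φ x = 0 := by
    intro k hk x
    have h1 := step (k + 1) hk
    obtain ⟨ξ, -, hξ⟩ := exists_hasDerivAt_eq_slope (iteratedDeriv k φ)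
      (iteratedDeriv (k + 1) φ) (a := 0) (b := 1) one_pos
      (fun z _ => (hasDerivAt_iteratedDeriv hφa k z).continuousAt.continuousWithinAt)
      (fun z _ => hasDerivAt_iteratedDeriv hφa k z)
    have h2 := periodic_iteratedDeriv hφp k 0
    rw [zero_add] at h2
    rw [h1 x ξ, hξ, h2]
    simp
  have main : ∀ k, (∀ x, iteratedDeriv (k + 1) φ x = 0) → ∀ x, iteratedDeriv 1 φ x = 0 := by
    intro k
    induction k with
    | zero => exact fun h => h
    | succ k ih => exact fun h => ih (step2 k h)
  by_contra hcon
  push Not at hcon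
  obtain ⟨s, t, hst⟩ := hφnc
  have := step 0 (main m hcon) s t
  simp only [iteratedDeriv_zero] at this
  exact hst this

end NonDegenerate

namespace IsCExt

variable {f : ℝ → ℝ} {ρ : ℝ} {F : ℂ → ℂ}

lemma analyticAt (h : IsCExt f ρ F) (hρ : 0 < ρ) : AnalyticAt ℝ f 0 := by
  have h1 : AnalyticAt ℂ F 0 := h.diff.analyticAt (Metric.ball_mem_nhds _ hρ)
  have h3 : AnalyticAt ℝ (fun s : ℝ => F s) 0 :=
    h1.restrictScalars.comp_of_eq (Complex.ofRealCLM.analyticAt 0) (by simp)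
  refine ((Complex.reCLM.analyticAt _).comp h3).congr ?_
  have : {x : ℝ | |x| < ρ} ∈ nhds (0 : ℝ) :=
    (isOpen_lt continuous_abs continuous_const).mem_nhds (by simpa using hρ)
  filter_upwards [this] with x hx
  simp [h.ext x hx]

lemma eventually_eq_zero (h : IsCExt f ρ F) (hρ : 0 < ρ)
    (h0 : ∀ m, _root_.iteratedDeriv m f 0 = 0) : ∀ᶠ s in nhds (0 : ℝ), f s = 0 := by
  have : {x : ℝ | |x| < ρ} ∈ nhds (0 : ℝ) :=
    (isOpen_lt continuous_abs continuous_const).mem_nhds (by simpa using hρ)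
  filter_upwards [this] with x hx
  have h1 := Complex.hasSum_taylorSeries_on_ball h.diff (z := x) (by simpa using hx)
  simp only [h.iteratedDeriv_zero_eq hρ, h0, Complex.ofReal_zero, smul_zero] at h1
  have h2 := h1.unique hasSum_zero
  rw [h.ext x hx] at h2
  exact_mod_cast h2

end IsCExt

section NonDegenerate

variable {ψ : ℝ → ℝ}

/-- A lacunary sum of dilates of `ψ` cannot be flat at a point. -/
lemma exists_lacunary_deriv_ne_zero (hψa : ∀ x : ℝ, AnalyticAt ℝ ψ x)
    (hψp : Function.Periodic ψ 1) (hψ0 : ∀ m, ∃ x, iteratedDeriv m ψ x ≠ 0)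
    {d : ℕ} (hd : 2 ≤ d) {c e : ℕ → ℝ} (hc : Summable c) (hc0 : c 0 ≠ 0) :
    ∃ m, ∑' i, c i / ((d : ℝ) ^ (i + 1)) ^ m * iteratedDeriv m ψ (e i) ≠ 0 := by
  have hd1 : (1 : ℝ) < d := by exact_mod_cast (show 1 < d by omega)
  have hdi : ∀ i : ℕ, (1 : ℝ) ≤ (d : ℝ) ^ (i + 1) := fun i => one_le_pow₀ hd1.le
  have hca : Summable fun i => |c i| := hc.abs
  choose y hy using exists_max_iteratedDeriv hψa hψp
  set Mx : ℕ → ℝ := fun m => |iteratedDeriv m ψ (y m)| with hMx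
  have hMx0 : ∀ m, 0 ≤ Mx m := fun m => abs_nonneg _
  set D : ℕ → ℝ → ℝ := fun m s =>
    ∑' i, c i / ((d : ℝ) ^ (i + 1)) ^ m * iteratedDeriv m ψ (e i + s / (d : ℝ) ^ (i + 1)) with hD
  have hterm : ∀ m s i,
      |c i / ((d : ℝ) ^ (i + 1)) ^ m * iteratedDeriv m ψ (e i + s / (d : ℝ) ^ (i + 1))| ≤
        |c i| * Mx m := by
    intro m s i
    rw [abs_mul, abs_div, abs_of_pos (pow_pos (zero_lt_one.trans_le (hdi i)) m)]
    exact mul_le_mul (div_le_self (abs_nonneg _) (one_le_pow₀ (hdi i))) (hy _ _) (abs_nonneg _)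
      (abs_nonneg _)
  have hsum : ∀ m s, Summable fun i =>
      c i / ((d : ℝ) ^ (i + 1)) ^ m * iteratedDeriv m ψ (e i + s / (d : ℝ) ^ (i + 1)) :=
    fun m s => Summable.of_norm_bounded (hca.mul_right (Mx m)) (hterm m s)
  have hder : ∀ m s, HasDerivAt (D m) (D (m + 1) s) s := by
    intro m s
    refine hasDerivAt_tsum (g := fun i s =>
        c i / ((d : ℝ) ^ (i + 1)) ^ m * iteratedDeriv m ψ (e i + s / (d : ℝ) ^ (i + 1)))
      (g' := fun i s => c i / ((d : ℝ) ^ (i + 1)) ^ (m + 1) *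
        iteratedDeriv (m + 1) ψ (e i + s / (d : ℝ) ^ (i + 1)))
      (y₀ := 0) (hca.mul_right (Mx (m + 1))) (fun i s => ?_) (fun i s => hterm (m + 1) s i)
      (hsum m 0) s
    have h1 : HasDerivAt (fun s => e i + s / (d : ℝ) ^ (i + 1)) (1 / (d : ℝ) ^ (i + 1)) s :=
      ((hasDerivAt_id s).div_const _).const_add _
    have h2 := ((hasDerivAt_iteratedDeriv hψa m _).comp s h1).const_mul
      (c i / ((d : ℝ) ^ (i + 1)) ^ m)
    refine h2.congr_deriv ?_
    have := (zero_lt_one.trans_le (hdi i)).ne'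
    rw [pow_succ ((d : ℝ) ^ (i + 1)) m]
    field_simp
  have hit : ∀ m, iteratedDeriv m (D 0) = D m := by
    intro m
    induction m with
    | zero => simp
    | succ m ih => rw [iteratedDeriv_succ, ih]; exact funext fun s => (hder m s).deriv
  by_contra hcon
  push Not at hcon
  have hD0 : ∀ m, D m 0 = 0 := fun m => by simpa [hD] using hcon m
  obtain ⟨ρ, hρ, M, hM, hΦ⟩ := exists_uniform_cext hψa hψp
  have hext : ∀ t, ∃ F, IsCExt (fun s => D 0 (t + s)) ρ F := by
    intro t
    choose Φ hΦ1 hΦ2 using fun i => hΦ (e i + t / (d : ℝ) ^ (i + 1))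
    have hin : ∀ (i : ℕ), ∀ z ∈ Metric.ball (0 : ℂ) ρ, z / (d : ℂ) ^ (i + 1) ∈ Metric.ball (0 : ℂ) ρ := by
      intro i z hz
      simp only [Metric.mem_ball, dist_zero_right] at hz ⊢
      rw [norm_div, norm_pow, Complex.norm_natCast]
      exact (div_le_self (norm_nonneg _) (hdi i)).trans_lt hz
    refine ⟨fun z => ∑' i, (c i : ℂ) * Φ i (z / (d : ℂ) ^ (i + 1)), ⟨?_, fun s hs => ?_⟩⟩
    · refine Complex.differentiableOn_tsum_of_summable_norm (hca.mul_right (Mx 0 + M * ρ))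
        (fun i => ?_) Metric.isOpen_ball fun i z hz => ?_
      · exact ((hΦ1 i).diff.comp (by fun_prop) (hin i)).const_mul _
      · rw [norm_mul, Complex.norm_real, Real.norm_eq_abs]
        have h1 := hΦ2 i _ (hin i z hz)
        have h2 := norm_le_norm_sub_add (Φ i (z / (d : ℂ) ^ (i + 1)))
          (ψ (e i + t / (d : ℝ) ^ (i + 1)) : ℂ)
        have h3 := hy 0 (e i + t / (d : ℝ) ^ (i + 1))
        rw [Complex.norm_real, Real.norm_eq_abs] at h2
        simp only [iteratedDeriv_zero] at h3
        have h4 : ‖z / (d : ℂ) ^ (i + 1)‖ ≤ ρ := by simpa using (Metric.mem_ball.1 (hin i z hz)).le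
        have h5 : Mx 0 = |ψ (y 0)| := by simp [hMx]
        gcongr
        nlinarith
    · simp only [hD, pow_zero, div_one, iteratedDeriv_zero]
      push_cast
      refine tsum_congr fun i => ?_
      congr 1
      have h1 : |s / (d : ℝ) ^ (i + 1)| < ρ := by
        rw [abs_div, abs_of_pos (zero_lt_one.trans_le (hdi i))]
        exact (div_le_self (abs_nonneg _) (hdi i)).trans_lt hs
      have h2 := (hΦ1 i).ext _ h1
      push_cast at h2
      rw [h2]
      congr 2
      ring
  have hana : AnalyticOnNhd ℝ (D 0) univ := by
    intro t _
    obtain ⟨F, hF⟩ := hext t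
    have h1 := hF.analyticAt hρ
    have h2 : AnalyticAt ℝ (fun s => D 0 (t + (s - t))) t :=
      h1.comp_of_eq (g := fun s => D 0 (t + s)) (f := fun s => s - t) (by fun_prop) (by simp)
    simpa using h2
  have hev : D 0 =ᶠ[nhds 0] 0 := by
    obtain ⟨F, hF⟩ := hext 0
    simp only [zero_add] at hF
    exact hF.eventually_eq_zero hρ fun m => by
      rw [show (fun s => D 0 s) = D 0 from rfl, hit]; exact hD0 m
  have hzero : D 0 = fun _ => 0 := funext fun s =>
    hana.eqOn_zero_of_preconnected_of_eventuallyEq_zero isPreconnected_univ (mem_univ 0) hev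
      (mem_univ s)
  have hDz : ∀ m s, D m s = 0 := by
    intro m s
    rw [← hit m, hzero, iteratedDeriv_const]
    split_ifs <;> rfl
  set S := ∑' i, |c i| with hS
  have hS0 : 0 ≤ S := tsum_nonneg fun _ => abs_nonneg _
  obtain ⟨k, hk⟩ := pow_unbounded_of_one_lt (S / |c 0|) hd1
  have hc0' := abs_pos.2 hc0
  rw [div_lt_iff₀ hc0'] at hk
  have hdk : (0 : ℝ) < (d : ℝ) ^ k := by positivity
  have hMk : 0 < Mx k := by
    obtain ⟨x, hx⟩ := hψ0 k
    exact (abs_pos.2 hx).trans_le (hy k x)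
  set s₀ := (y k - e 0) * d with hs₀
  have h1 := hDz k s₀
  have hd0 : (d : ℝ) ≠ 0 := by positivity
  rw [hD] at h1
  simp only at h1
  rw [(hsum k s₀).tsum_eq_zero_add] at h1
  have e1 : e 0 + s₀ / (d : ℝ) ^ (0 + 1) = y k := by rw [hs₀]; field_simp; ring
  rw [e1, zero_add, pow_one] at h1
  have h2 : |∑' i, c (i + 1) / ((d : ℝ) ^ (i + 1 + 1)) ^ k *
      iteratedDeriv k ψ (e (i + 1) + s₀ / (d : ℝ) ^ (i + 1 + 1))| ≤
      (S / ((d : ℝ) ^ k * (d : ℝ) ^ k)) * Mx k := by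
    have hb : HasSum (fun i => |c (i + 1)| / ((d : ℝ) ^ k * (d : ℝ) ^ k) * Mx k)
        ((∑' i, |c (i + 1)|) / ((d : ℝ) ^ k * (d : ℝ) ^ k) * Mx k) :=
      (((summable_nat_add_iff 1).2 hca).hasSum.div_const _).mul_right _
    have h3 := tsum_of_norm_bounded (f := fun i => c (i + 1) / ((d : ℝ) ^ (i + 1 + 1)) ^ k *
      iteratedDeriv k ψ (e (i + 1) + s₀ / (d : ℝ) ^ (i + 1 + 1))) hb fun i => by
        rw [Real.norm_eq_abs, abs_mul, abs_div, abs_of_pos (pow_pos (zero_lt_one.trans_le (hdi _)) k)]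
        refine mul_le_mul ?_ (hy _ _) (abs_nonneg _) (by positivity)
        refine div_le_div_of_nonneg_left (abs_nonneg _) (by positivity) ?_
        rw [← pow_add, ← pow_mul]
        exact pow_le_pow_right₀ hd1.le (by nlinarith)
    refine h3.trans ?_
    have h4 : ∑' i, |c (i + 1)| ≤ S := by
      rw [hS, hca.tsum_eq_zero_add]
      linarith [abs_nonneg (c 0)]
    gcongr
  have h3 : |c 0 / (d : ℝ) ^ k * iteratedDeriv k ψ (y k)| = |c 0| / (d : ℝ) ^ k * Mx k := by
    rw [abs_mul, abs_div, abs_of_pos hdk]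
  have h4 : |c 0 / (d : ℝ) ^ k * iteratedDeriv k ψ (y k)| ≤ S / ((d : ℝ) ^ k * (d : ℝ) ^ k) * Mx k := by
    rw [eq_neg_of_add_eq_zero_left h1, abs_neg]
    exact h2
  rw [h3] at h4
  have h5 := le_of_mul_le_mul_right h4 hMk
  rw [← div_div, div_le_div_iff_of_pos_right hdk, le_div_iff₀ hdk] at h5
  linarith

end NonDegenerate

/-- Uniform non-degeneracy of lacunary sums, by compactness of the space of coefficients and
phases. -/
lemma exists_uniform_lacunary {ψ : ℝ → ℝ} (hψa : ∀ x : ℝ, AnalyticAt ℝ ψ x)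
    (hψp : Function.Periodic ψ 1) (hψ0 : ∀ m, ∃ x, iteratedDeriv m ψ x ≠ 0)
    {d : ℕ} (hd : 2 ≤ d) (C : ℝ) {q c₀ : ℝ} (hq0 : 0 ≤ q) (hq1 : q < 1) (hc₀ : c₀ ≠ 0) :
    ∃ ℓ : ℕ, ∃ κ > 0, ∀ c e : ℕ → ℝ, c 0 = c₀ → (∀ i, |c i| ≤ C * q ^ i) →
      ∃ m ≤ ℓ, κ ≤ |∑' i, c i / ((d : ℝ) ^ (i + 1)) ^ m * iteratedDeriv m ψ (e i)| := by
  have hd1 : (1 : ℝ) < d := by exact_mod_cast (show 1 < d by omega)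
  have hdi : ∀ i : ℕ, (1 : ℝ) ≤ (d : ℝ) ^ (i + 1) := fun i => one_le_pow₀ hd1.le
  have hgs : Summable fun i => C * q ^ i := (summable_geometric_of_lt_one hq0 hq1).mul_left C
  set K : Set ((ℕ → ℝ) × (ℕ → ℝ)) :=
    (univ.pi fun i => Icc (-(C * q ^ i)) (C * q ^ i)) ×ˢ (univ.pi fun _ => Icc (0 : ℝ) 1) ∩
      {p | p.1 0 = c₀} with hK
  have hKc : IsCompact K :=
    ((isCompact_univ_pi fun _ => isCompact_Icc).prod
      (isCompact_univ_pi fun _ => isCompact_Icc)).inter_right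
      (isClosed_eq (by fun_prop) continuous_const)
  have hKabs : ∀ p ∈ K, ∀ i, |p.1 i| ≤ C * q ^ i := fun p hp i =>
    abs_le.2 (hp.1.1 i (mem_univ i))
  set D : ℕ → (ℕ → ℝ) × (ℕ → ℝ) → ℝ := fun m p =>
    ∑' i, p.1 i / ((d : ℝ) ^ (i + 1)) ^ m * iteratedDeriv m ψ (p.2 i) with hD
  have hcont : ∀ m, ContinuousOn (D m) K := by
    intro m
    obtain ⟨y, hy⟩ := exists_max_iteratedDeriv hψa hψp m
    have hc : Continuous (iteratedDeriv m ψ) :=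
      continuous_iff_continuousAt.2 fun x => (hasDerivAt_iteratedDeriv hψa m x).continuousAt
    refine continuousOn_tsum (u := fun i => C * q ^ i * |iteratedDeriv m ψ y|)
      (fun i => ?_) (hgs.mul_right _) fun i p hp => ?_
    · exact Continuous.continuousOn (by fun_prop)
    · rw [Real.norm_eq_abs, abs_mul, abs_div, abs_of_pos (pow_pos (zero_lt_one.trans_le (hdi i)) m)]
      exact mul_le_mul ((div_le_self (abs_nonneg _) (one_le_pow₀ (hdi i))).trans (hKabs p hp i))
        (hy _) (abs_nonneg _) ((abs_nonneg _).trans (hKabs p hp i))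
  have main : ∃ ℓ : ℕ, ∃ κ > 0, ∀ p ∈ K, ∃ m ≤ ℓ, κ ≤ |D m p| := by
    refine hKc.induction_on (p := fun S => ∃ ℓ : ℕ, ∃ κ > 0, ∀ p ∈ S, ∃ m ≤ ℓ, κ ≤ |D m p|)
      ⟨0, 1, one_pos, fun p hp => hp.elim⟩ ?_ ?_ ?_
    · rintro s t hst ⟨ℓ, κ, hκ, h⟩
      exact ⟨ℓ, κ, hκ, fun p hp => h p (hst hp)⟩
    · rintro s t ⟨ℓ, κ, hκ, h⟩ ⟨ℓ', κ', hκ', h'⟩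
      refine ⟨max ℓ ℓ', min κ κ', lt_min hκ hκ', fun p hp => ?_⟩
      rcases hp with hp | hp
      · obtain ⟨m, hm, h1⟩ := h p hp
        exact ⟨m, hm.trans (le_max_left _ _), (min_le_left _ _).trans h1⟩
      · obtain ⟨m, hm, h1⟩ := h' p hp
        exact ⟨m, hm.trans (le_max_right _ _), (min_le_right _ _).trans h1⟩
    · intro p hp
      obtain ⟨m, hm⟩ := exists_lacunary_deriv_ne_zero hψa hψp hψ0 hd (c := p.1) (e := p.2)
        (Summable.of_norm_bounded hgs (hKabs p hp)) (by rw [hp.2]; exact hc₀)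
      have hm' : 0 < |D m p| := abs_pos.2 hm
      refine ⟨{x | |D m p| / 2 < |D m x|}, ?_, m, |D m p| / 2, by positivity,
        fun x hx => ⟨m, le_rfl, le_of_lt hx⟩⟩
      exact ((hcont m p hp).abs).eventually (lt_mem_nhds (half_lt_self hm'))
  obtain ⟨ℓ, κ, hκ, h⟩ := main
  refine ⟨ℓ, κ, hκ, fun c e hc hb => ?_⟩
  obtain ⟨m, hm, h1⟩ := h (c, fun i => Int.fract (e i)) ⟨⟨fun i _ => abs_le.1 (hb i),
    fun i _ => ⟨Int.fract_nonneg _, (Int.fract_lt_one _).le⟩⟩, hc⟩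
  refine ⟨m, hm, h1.trans_eq ?_⟩
  simp only [hD]
  congr 1
  refine tsum_congr fun i => ?_
  congr 1
  have := ((periodic_iteratedDeriv hψp m).int_mul ⌊e i⌋) (Int.fract (e i))
  rw [← this, mul_one, Int.fract_add_floor]

/-- Points of a set at which a function is small force a small value of a higher derivative. -/
lemma exists_small_deriv {g : ℕ → ℝ → ℝ} (hg : ∀ m s, HasDerivAt (g m) (g (m + 1) s) s)
    {η : ℝ} (hη : 0 < η) (k : ℕ) :
    ∀ (m : ℕ) (ε : ℝ) (x : ℕ → ℝ), (∀ i < 2 ^ k, |g m (x i)| ≤ ε) →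
      (∀ i, i + 1 < 2 ^ k → x i + η ≤ x (i + 1)) →
      ∃ ξ ∈ Icc (x 0) (x (2 ^ k - 1)), |g (m + k) ξ| ≤ ε * (2 / η) ^ k := by
  induction k with
  | zero =>
    intro m ε x h1 _
    exact ⟨x 0, by simp, by simpa using h1 0 (by norm_num)⟩
  | succ k ih =>
    intro m ε x h1 h2
    have h2k : 2 ^ (k + 1) = 2 * 2 ^ k := by ring
    have hp : 1 ≤ 2 ^ k := Nat.one_le_two_pow
    have key : ∀ i < 2 ^ k, ∃ ξ ∈ Ioo (x (2 * i)) (x (2 * i + 1)), |g (m + 1) ξ| ≤ ε * (2 / η) := by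
      intro i hi
      have hlt := h2 (2 * i) (by omega)
      obtain ⟨ξ, hξ, e⟩ := exists_hasDerivAt_eq_slope (g m) (g (m + 1))
        (show x (2 * i) < x (2 * i + 1) by linarith)
        (fun z _ => (hg m z).continuousAt.continuousWithinAt) (fun z _ => hg m z)
      refine ⟨ξ, hξ, ?_⟩
      have a1 := h1 (2 * i) (by omega)
      have a2 := h1 (2 * i + 1) (by omega)
      have a3 := abs_sub (g m (x (2 * i + 1))) (g m (x (2 * i)))
      rw [e, abs_div, abs_of_pos (show 0 < x (2 * i + 1) - x (2 * i) by linarith), div_le_iff₀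
        (by linarith)]
      have hε : 0 ≤ ε := (abs_nonneg _).trans a1
      calc _ ≤ 2 * ε := by linarith
        _ = ε * (2 / η) * η := by field_simp
        _ ≤ _ := by gcongr; linarith
    have key' : ∀ i, ∃ ξ, i < 2 ^ k → ξ ∈ Ioo (x (2 * i)) (x (2 * i + 1)) ∧
        |g (m + 1) ξ| ≤ ε * (2 / η) := by
      intro i
      by_cases hi : i < 2 ^ k
      · obtain ⟨ξ, h, h'⟩ := key i hi
        exact ⟨ξ, fun _ => ⟨h, h'⟩⟩
      · exact ⟨0, fun h => absurd h hi⟩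
    choose y hy using key'
    obtain ⟨ξ, hξ, hξ'⟩ := ih (m + 1) (ε * (2 / η)) y (fun i hi => (hy i hi).2) (fun i hi => by
      have b1 := (hy i (by omega)).1.2
      have b2 := (hy (i + 1) hi).1.1
      have b3 := h2 (2 * i + 1) (by omega)
      rw [show 2 * (i + 1) = 2 * i + 1 + 1 by ring] at b2
      linarith)
    refine ⟨ξ, ⟨?_, ?_⟩, ?_⟩
    · have := (hy 0 (by omega)).1.1
      simp only [mul_zero] at this
      linarith [hξ.1]
    · have := (hy (2 ^ k - 1) (by omega)).1.2
      rw [show 2 * (2 ^ k - 1) + 1 = 2 ^ (k + 1) - 1 by omega] at this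
      linarith [hξ.2]
    · rw [show m + (k + 1) = m + 1 + k by ring, pow_succ']
      linarith

lemma exists_separated {η : ℝ} (hη : 0 < η) (n : ℕ) :
    ∀ S : Set ℝ, BddBelow S → ENNReal.ofReal (n * (2 * η)) < volume S →
      ∃ x : ℕ → ℝ, (∀ i ≤ n, x i ∈ S) ∧ ∀ i, i < n → x i + η ≤ x (i + 1) := by
  induction n with
  | zero =>
    intro S _ hS
    obtain ⟨x, hx⟩ := nonempty_of_measure_ne_zero (by simpa using hS.ne' : volume S ≠ 0)
    exact ⟨fun _ => x, fun _ _ => hx, fun i hi => by omega⟩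
  | succ n ih =>
    intro S hb hS
    have hne : S.Nonempty := nonempty_of_measure_ne_zero (bot_lt_of_lt hS).ne'
    obtain ⟨x₀, hx₀, hx₀'⟩ := Real.lt_sInf_add_pos hne hη
    have hsub : S ⊆ (S ∩ Ici (x₀ + η)) ∪ Icc (sInf S) (sInf S + 2 * η) := by
      intro y hy
      rcases le_or_gt (x₀ + η) y with h | h
      · exact Or.inl ⟨hy, h⟩
      · exact Or.inr ⟨csInf_le hb hy, by linarith⟩
    have hlt : ENNReal.ofReal (n * (2 * η)) < volume (S ∩ Ici (x₀ + η)) := by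
      by_contra hcon
      push Not at hcon
      have h1 := (measure_mono hsub).trans (measure_union_le (μ := volume) _ _)
      rw [Real.volume_Icc, show sInf S + 2 * η - sInf S = 2 * η by ring] at h1
      have h2 := h1.trans (add_le_add_left hcon _)
      rw [← ENNReal.ofReal_add (by positivity) (by positivity)] at h2
      refine absurd (hS.trans_le h2) (not_lt.2 (ENNReal.ofReal_le_ofReal ?_))
      push_cast
      linarith
    obtain ⟨x, hx1, hx2⟩ := ih _ (hb.mono inter_subset_left) hlt
    refine ⟨fun i => Nat.casesOn i x₀ x, fun i hi => ?_, fun i hi => ?_⟩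
    · cases i with
      | zero => exact hx₀
      | succ i => exact (hx1 i (by omega)).1
    · cases i with
      | zero => exact (hx1 0 (by omega)).2
      | succ i => exact hx2 i (by omega)

/-- Sublevel sets of a function with a derivative of order `k` bounded below. -/
lemma volume_sublevel_le {g : ℕ → ℝ → ℝ} (hg : ∀ m s, HasDerivAt (g m) (g (m + 1) s) s)
    {η ε u v κ : ℝ} (hη : 0 < η) (k : ℕ) (hκ : ∀ s ∈ Icc u v, κ ≤ |g k s|)
    (hε : ε * (2 / η) ^ k < κ) :
    volume {s ∈ Icc u v | |g 0 s| ≤ ε} ≤ ENNReal.ofReal (2 ^ k * (2 * η)) := by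
  by_contra hcon
  push Not at hcon
  obtain ⟨x, hx1, hx2⟩ := exists_separated hη (2 ^ k) {s ∈ Icc u v | |g 0 s| ≤ ε}
    ⟨u, fun s hs => hs.1.1⟩ (by push_cast; exact hcon)
  obtain ⟨ξ, hξ, hξ'⟩ := exists_small_deriv hg hη k 0 ε x (fun i hi => (hx1 i hi.le).2)
    (fun i hi => hx2 i (by omega))
  rw [zero_add] at hξ'
  have h1 := hκ ξ ⟨(hx1 0 (Nat.zero_le _)).1.1.trans hξ.1,
    hξ.2.trans (hx1 (2 ^ k - 1) (Nat.sub_le _ _)).1.2⟩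
  linarith

lemma linear_recursion {x : ℕ → ℝ} {w v : ℕ → ℂ} (h0 : w 0 = 0)
    (h : ∀ k, w (k + 1) = (-2 * x k : ℝ) * w k + v k) (k : ℕ) :
    w k = ∑ l ∈ Finset.range k, ((∏ i ∈ Finset.Ico (l + 1) k, (-2 * x i) : ℝ) : ℂ) * v l := by
  induction k with
  | zero => simpa using h0
  | succ k ih =>
    rw [h, Finset.sum_range_succ, Finset.Ico_self, Finset.prod_empty, Complex.ofReal_one, one_mul,
      ih, Finset.mul_sum]
    congr 1
    refine Finset.sum_congr rfl fun l hl => ?_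
    rw [Finset.prod_Ico_succ_top (by have := Finset.mem_range.1 hl; omega)]
    push_cast
    ring

/-- A perturbation of an orbit, driven by a forcing that grows faster than the derivatives. -/
lemma perturbation_bound {x : ℕ → ℝ} {w u : ℕ → ℂ} {C R D M ρ α r : ℝ} {n : ℕ} (h0 : w 0 = 0)
    (h : ∀ k, w (k + 1) = -2 * x k * w k - w k ^ 2 + α * u k)
    (hR : 0 ≤ R) (hRD : R < D) (hD : 1 ≤ D) (hC : 0 < C) (hM : 0 < M) (hα : 0 ≤ α) (hr : 0 ≤ r)
    (hb : ∀ l k, l ≤ k → |∏ i ∈ Finset.Ico l k, (-2 * x i)| ≤ C * R ^ (k - l))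
    (hu : ∀ k < n, ‖u k‖ ≤ M * (r * D ^ k)) (hρ : r * D ^ n ≤ ρ)
    (hs : α * (2 * M * C / (D - R)) ^ 2 * ρ ≤ M) :
    (∀ k ≤ n, ‖w k‖ ≤ 2 * M * C / (D - R) * α * (r * D ^ k)) ∧
      ‖w n - α * ∑ l ∈ Finset.range n,
        ((∏ i ∈ Finset.Ico (l + 1) n, (-2 * x i) : ℝ) : ℂ) * u l‖ ≤
        C * (2 * M * C / (D - R)) ^ 2 * ρ ^ 2 / (D - R) * α ^ 2 := by
  set A := 2 * M * C / (D - R) with hA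
  have hDR : 0 < D - R := sub_pos.2 hRD
  have hA0 : 0 < A := by positivity
  have hD0 : 0 < D := by linarith
  have hrec : ∀ k, w (k + 1) = (-2 * x k : ℝ) * w k + (α * u k - w k ^ 2) := fun k => by
    rw [h]; push_cast; ring
  have hgeom : ∀ k, ∑ l ∈ Finset.range k, R ^ (k - (l + 1)) * D ^ l ≤ D ^ k / (D - R) := by
    intro k
    rw [le_div_iff₀ hDR]
    have := geom_sum₂_mul D R k
    have e : ∑ l ∈ Finset.range k, R ^ (k - (l + 1)) * D ^ l =
        ∑ i ∈ Finset.range k, D ^ i * R ^ (k - 1 - i) :=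
      Finset.sum_congr rfl fun l _ => by rw [mul_comm, Nat.sub_sub, add_comm]
    rw [e, this]
    have := pow_nonneg hR k
    linarith
  have hsmall : ∀ k ≤ n, r * D ^ k ≤ ρ := fun k hk =>
    (mul_le_mul_of_nonneg_left (pow_le_pow_right₀ hD hk) hr).trans hρ
  have hB : ∀ k, ∀ l ∈ Finset.range k,
      ‖((∏ i ∈ Finset.Ico (l + 1) k, (-2 * x i) : ℝ) : ℂ)‖ ≤ C * R ^ (k - (l + 1)) :=
    fun k l hl => by
      rw [Complex.norm_real, Real.norm_eq_abs]
      exact hb _ _ (by have := Finset.mem_range.1 hl; omega)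
  have h1 : ∀ k ≤ n, ‖w k‖ ≤ A * α * (r * D ^ k) := by
    intro k
    induction k using Nat.strong_induction_on with
    | _ k ih =>
      intro hk
      rw [linear_recursion h0 hrec k]
      calc _ ≤ ∑ l ∈ Finset.range k, (C * R ^ (k - (l + 1))) * (2 * M * α * (r * D ^ l)) := by
            refine norm_sum_le_of_le _ fun l hl => ?_
            have hl' := Finset.mem_range.1 hl
            rw [norm_mul]
            refine mul_le_mul (hB k l hl) ?_ (norm_nonneg _) (by positivity)
            refine (norm_sub_le _ _).trans ?_
            rw [norm_mul, norm_pow, Complex.norm_real, Real.norm_eq_abs, abs_of_nonneg hα]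
            have a1 := hu l (by omega)
            have a2 := ih l hl' (by omega)
            have a3 := hsmall l (by omega)
            have a4 : 0 ≤ r * D ^ l := by positivity
            have a5 : ‖w l‖ ^ 2 ≤ (A * α * (r * D ^ l)) ^ 2 := by gcongr
            have a6 : α * A ^ 2 * (r * D ^ l) ≤ M :=
              (mul_le_mul_of_nonneg_left a3 (by positivity)).trans hs
            have a7 : (A * α * (r * D ^ l)) ^ 2 ≤ M * (α * (r * D ^ l)) := by
              calc _ = (α * A ^ 2 * (r * D ^ l)) * (α * (r * D ^ l)) := by ring
                _ ≤ _ := by gcongr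
            have a8 := mul_le_mul_of_nonneg_left a1 hα
            linarith
        _ = 2 * M * α * r * C * ∑ l ∈ Finset.range k, R ^ (k - (l + 1)) * D ^ l := by
            rw [Finset.mul_sum]
            exact Finset.sum_congr rfl fun l _ => by ring
        _ ≤ 2 * M * α * r * C * (D ^ k / (D - R)) := by
            exact mul_le_mul_of_nonneg_left (hgeom k) (by positivity)
        _ = _ := by rw [hA]; field_simp
  refine ⟨h1, ?_⟩
  rw [linear_recursion h0 hrec n, Finset.mul_sum, ← Finset.sum_sub_distrib]
  calc _ ≤ ∑ l ∈ Finset.range n, (C * R ^ (n - (l + 1))) * (A ^ 2 * α ^ 2 * (r * ρ * D ^ l)) := by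
        refine norm_sum_le_of_le _ fun l hl => ?_
        have hl' := Finset.mem_range.1 hl
        rw [show ((∏ i ∈ Finset.Ico (l + 1) n, (-2 * x i) : ℝ) : ℂ) * (α * u l - w l ^ 2) -
          α * (((∏ i ∈ Finset.Ico (l + 1) n, (-2 * x i) : ℝ) : ℂ) * u l) =
          -(((∏ i ∈ Finset.Ico (l + 1) n, (-2 * x i) : ℝ) : ℂ) * w l ^ 2) by ring, norm_neg, norm_mul]
        refine mul_le_mul (hB n l hl) ?_ (norm_nonneg _) (by positivity)
        rw [norm_pow]
        have a2 := h1 l (by omega)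
        have a3 := hsmall l (by omega)
        have a4 : 0 ≤ r * D ^ l := by positivity
        calc ‖w l‖ ^ 2 ≤ (A * α * (r * D ^ l)) ^ 2 := by gcongr
          _ = A ^ 2 * α ^ 2 * ((r * D ^ l) * (r * D ^ l)) := by ring
          _ ≤ A ^ 2 * α ^ 2 * (ρ * (r * D ^ l)) := by gcongr
          _ = _ := by ring
    _ = A ^ 2 * α ^ 2 * r * ρ * C * ∑ l ∈ Finset.range n, R ^ (n - (l + 1)) * D ^ l := by
        rw [Finset.mul_sum]
        exact Finset.sum_congr rfl fun l _ => by ring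
    _ ≤ A ^ 2 * α ^ 2 * r * ρ * C * (D ^ n / (D - R)) := by
        have : 0 ≤ ρ := le_trans (by positivity) hρ
        exact mul_le_mul_of_nonneg_left (hgeom n) (by positivity)
    _ = A ^ 2 * α ^ 2 * ρ * C / (D - R) * (r * D ^ n) := by ring
    _ ≤ A ^ 2 * α ^ 2 * ρ * C / (D - R) * ρ := by
        have : 0 ≤ ρ := le_trans (by positivity) hρ
        gcongr
    _ = _ := by ring

/-- The noise level `α` is small enough for the fibre maps to leave `[-β, β]` invariant and for
their derivatives to be dominated by the expansion of the base. -/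
structure Dominated (a : ℝ) (d : ℕ) (φ : ℝ → ℝ) (β C R α : ℝ) : Prop where
  pos : 0 < α
  mem : ∀ n θ x, x ∈ Icc (-β) β → fn a d φ α n θ x ∈ Icc (-β) β
  le : ∀ n θ x, x ∈ Icc (-β) β → dprod (fun i => fn a d φ α i θ x) n ≤ C * R ^ n

/-- Images of horizontal lines under `F^n`, rescaled to the line. -/
def IsCurve (a : ℝ) (d : ℕ) (φ : ℝ → ℝ) (α β : ℝ) (X : ℝ → ℝ) : Prop :=
  ∃ n : ℕ, 1 ≤ n ∧ ∃ c : ℝ, ∃ x₀ ∈ Icc (-β) β, ∀ t, X t = fn a d φ α n ((t + c) / (d : ℝ) ^ n) x₀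

lemma Dominated.abs_prod_le {a : ℝ} {d : ℕ} {φ : ℝ → ℝ} {β C R α : ℝ}
    (h : Dominated a d φ β C R α) {x₀ : ℝ} (hx₀ : x₀ ∈ Icc (-β) β) (θ : ℝ) (l k : ℕ) :
    |∏ i ∈ Finset.Ico l k, (-2 * fn a d φ α i θ x₀)| ≤ C * R ^ (k - l) := by
  have h1 := h.le (k - l) ((d : ℝ) ^ l * θ) _ (h.mem l θ x₀ hx₀)
  refine le_trans (le_of_eq ?_) h1
  rw [Finset.prod_Ico_eq_prod_range, Finset.abs_prod, dprod]
  refine Finset.prod_congr rfl fun i _ => ?_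
  rw [fn_add, neg_mul, abs_neg]

lemma analyticAt_fn {φ : ℝ → ℝ} (hφa : ∀ x : ℝ, AnalyticAt ℝ φ x) (a : ℝ) (d : ℕ) (α : ℝ) (n : ℕ)
    (x₀ θ : ℝ) : AnalyticAt ℝ (fun θ => fn a d φ α n θ x₀) θ := by
  induction n with
  | zero => exact analyticAt_const
  | succ n ih =>
    simp only [fn_succ, qm]
    exact (analyticAt_const.sub (ih.pow 2)).add (analyticAt_const.mul
      ((hφa _).comp_of_eq (analyticAt_const.mul analyticAt_id) rfl))

lemma IsCurve.analyticAt {a : ℝ} {d : ℕ} {φ : ℝ → ℝ} {α β : ℝ} {X : ℝ → ℝ}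
    (hX : IsCurve a d φ α β X) (hφa : ∀ x : ℝ, AnalyticAt ℝ φ x) (t : ℝ) : AnalyticAt ℝ X t := by
  obtain ⟨n, -, c, x₀, -, h⟩ := hX
  rw [funext h]
  exact (analyticAt_fn hφa a d α n x₀ _).comp_of_eq
    (f := fun t => (t + c) / (d : ℝ) ^ n) (by fun_prop) rfl

/-- The first-order part of a curve: a finite lacunary sum, with all its derivatives. -/
lemma iteratedDeriv_finite_lacunary {φ : ℝ → ℝ} (hφa : ∀ x : ℝ, AnalyticAt ℝ φ x)
    {d : ℕ} (hd : 2 ≤ d) (b e : ℕ → ℝ) (n m : ℕ) :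
    iteratedDeriv (m + 1) (fun s => ∑ i ∈ Finset.range n,
      b i * (φ (e i + s / (d : ℝ) ^ (i + 1)) - φ (e i))) = fun s => ∑ i ∈ Finset.range n,
      b i / ((d : ℝ) ^ (i + 1)) ^ (m + 1) * iteratedDeriv (m + 1) φ (e i + s / (d : ℝ) ^ (i + 1)) := by
  have hd0 : (d : ℝ) ≠ 0 := by positivity
  have inner : ∀ (i : ℕ) (s : ℝ), HasDerivAt (fun s => e i + s / (d : ℝ) ^ (i + 1))
      (1 / (d : ℝ) ^ (i + 1)) s := fun i s => ((hasDerivAt_id s).div_const _).const_add _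
  have comp : ∀ (k i : ℕ) (s : ℝ),
      HasDerivAt (fun s => iteratedDeriv k φ (e i + s / (d : ℝ) ^ (i + 1)))
        (iteratedDeriv (k + 1) φ (e i + s / (d : ℝ) ^ (i + 1)) * (1 / (d : ℝ) ^ (i + 1))) s :=
    fun k i s => (hasDerivAt_iteratedDeriv hφa k _).comp s (inner i s)
  induction m with
  | zero =>
    rw [zero_add, iteratedDeriv_one]
    funext s
    refine HasDerivAt.deriv ?_
    refine HasDerivAt.fun_sum fun i _ => ?_
    have h := ((comp 0 i s).sub_const (φ (e i))).const_mul (b i)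
    simp only [iteratedDeriv_zero] at h
    refine h.congr_deriv ?_
    rw [zero_add, pow_one]
    ring
  | succ m ih =>
    rw [iteratedDeriv_succ, ih]
    funext s
    refine HasDerivAt.deriv ?_
    refine HasDerivAt.fun_sum fun i _ => ?_
    refine ((comp (m + 1) i s).const_mul _).congr_deriv ?_
    rw [pow_succ ((d : ℝ) ^ (i + 1)) (m + 1)]
    field_simp

/-- Local structure of curves: to first order in `α` they are lacunary sums, with holomorphic
control of the error. -/
lemma exists_curve_expansion {φ : ℝ → ℝ} (hφa : ∀ x : ℝ, AnalyticAt ℝ φ x)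
    (hφp : Function.Periodic φ 1) {d : ℕ} (hd : 2 ≤ d) {C R : ℝ} (hC : 0 < C) (hR : 0 ≤ R)
    (hRd : R < d) :
    ∃ A > 0, ∃ E > 0, ∃ ρ > 0, ∃ α₀ > 0, ∀ a β α, Dominated a d φ β C R α → α ≤ α₀ →
      ∀ X, IsCurve a d φ α β X → ∀ t, ∃ F : ℂ → ℂ, ∃ b e : ℕ → ℝ, ∃ n, ∃ T : ℂ → ℂ, 1 ≤ n ∧
        b 0 = 1 ∧ (∀ i, |b i| ≤ C * R ^ i) ∧
        IsCExt (fun s => X (t + s) - X t) ρ F ∧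
        IsCExt (fun s => ∑ i ∈ Finset.range n,
          b i * (φ (e i + s / (d : ℝ) ^ (i + 1)) - φ (e i))) ρ T ∧
        (∀ z ∈ Metric.ball (0 : ℂ) ρ, ‖F z‖ ≤ A * α * ‖z‖) ∧
        ∀ z ∈ Metric.ball (0 : ℂ) ρ, ‖F z - α * T z‖ ≤ E * α ^ 2 := by
  have hd1 : (1 : ℝ) ≤ d := by exact_mod_cast (show 1 ≤ d by omega)
  have hd0 : (d : ℝ) ≠ 0 := by positivity
  have hdR : 0 < (d : ℝ) - R := sub_pos.2 hRd
  obtain ⟨ρ, hρ, M, hM, hΦ⟩ := exists_uniform_cext hφa hφp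
  set A := 2 * M * C / (d - R) with hA
  have hA0 : 0 < A := by positivity
  refine ⟨A, hA0, C * A ^ 2 * ρ ^ 2 / (d - R), by positivity, ρ, hρ, M / (A ^ 2 * ρ), by positivity,
    fun a β α h hα X hX t => ?_⟩
  obtain ⟨n, hn, c, x₀, hx₀, hXe⟩ := hX
  set θ₀ := (t + c) / (d : ℝ) ^ n with hθ₀
  choose Φ hΦ1 hΦ2 using fun k : ℕ => hΦ ((d : ℝ) ^ k * θ₀)
  set x : ℕ → ℝ := fun k => fn a d φ α k θ₀ x₀ with hx
  set u : ℂ → ℕ → ℂ := fun z k => Φ k (z * (d : ℂ) ^ k / (d : ℂ) ^ n) - φ ((d : ℝ) ^ k * θ₀) with hu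
  set W : ℂ → ℕ → ℂ := fun z k =>
    Nat.rec 0 (fun k w => -2 * x k * w - w ^ 2 + α * u z k) k with hW
  have hW0 : ∀ z, W z 0 = 0 := fun z => rfl
  have hWs : ∀ z k, W z (k + 1) = -2 * x k * W z k - W z k ^ 2 + α * u z k := fun z k => rfl
  have hin : ∀ z ∈ Metric.ball (0 : ℂ) ρ, ∀ k ≤ n,
      ‖z * (d : ℂ) ^ k / (d : ℂ) ^ n‖ = ‖z‖ / (d : ℝ) ^ n * (d : ℝ) ^ k ∧
      z * (d : ℂ) ^ k / (d : ℂ) ^ n ∈ Metric.ball (0 : ℂ) ρ := by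
    intro z hz k hk
    have h1 : ‖z * (d : ℂ) ^ k / (d : ℂ) ^ n‖ = ‖z‖ / (d : ℝ) ^ n * (d : ℝ) ^ k := by
      rw [norm_div, norm_mul, norm_pow, norm_pow, Complex.norm_natCast]; ring
    refine ⟨h1, ?_⟩
    rw [Metric.mem_ball, dist_zero_right] at hz ⊢
    rw [h1, div_mul_eq_mul_div, div_lt_iff₀ (by positivity)]
    exact mul_lt_mul_of_lt_of_le_of_nonneg_of_pos hz (pow_le_pow_right₀ hd1 hk) (norm_nonneg _) (by positivity)
  have hp := fun z (hz : z ∈ Metric.ball (0 : ℂ) ρ) =>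
    perturbation_bound (x := x) (w := W z) (u := u z) (C := C) (R := R) (D := d) (M := M) (ρ := ρ)
      (α := α) (r := ‖z‖ / (d : ℝ) ^ n) (n := n) (hW0 z) (hWs z) hR hRd hd1 hC hM h.pos.le
      (by positivity) (fun l k _ => h.abs_prod_le hx₀ θ₀ l k)
      (fun k hk => by
        have := hΦ2 k _ (hin z hz k hk.le).2
        rwa [(hin z hz k hk.le).1] at this)
      (by
        rw [div_mul_cancel₀ _ (pow_ne_zero _ hd0)]
        simpa using (Metric.mem_ball.1 hz).le)
      (by
        rw [le_div_iff₀ (by positivity)] at hα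
        linarith)
  have hWd : ∀ k ≤ n, DifferentiableOn ℂ (fun z => W z k) (Metric.ball 0 ρ) := by
    intro k
    induction k with
    | zero => intro _; simp only [hW0]; fun_prop
    | succ k ih =>
      intro hk
      have h1 := ih (by omega)
      have h2 : DifferentiableOn ℂ (fun z => u z k) (Metric.ball 0 ρ) :=
        ((hΦ1 k).diff.comp (f := fun z : ℂ => z * (d : ℂ) ^ k / (d : ℂ) ^ n) (by fun_prop)
          fun z hz => (hin z hz k (by omega)).2).sub_const _
      simp only [hWs]
      exact ((h1.const_mul _).sub (h1.pow 2)).add (h2.const_mul _)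
  have habs : ∀ s : ℝ, |s| < ρ → (s : ℂ) ∈ Metric.ball (0 : ℂ) ρ := fun s hs => by simpa using hs
  have hur : ∀ s : ℝ, |s| < ρ → ∀ k ≤ n, u s k =
      (φ ((d : ℝ) ^ k * θ₀ + s * (d : ℝ) ^ k / (d : ℝ) ^ n) - φ ((d : ℝ) ^ k * θ₀) : ℝ) := by
    intro s hs k hk
    have h1 := (hin s (habs s hs) k hk).2
    have h2 := (hΦ1 k).ext (s * (d : ℝ) ^ k / (d : ℝ) ^ n) (by
      have e : ((s * (d : ℝ) ^ k / (d : ℝ) ^ n : ℝ) : ℂ) = s * (d : ℂ) ^ k / (d : ℂ) ^ n := by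
        push_cast; rfl
      rw [← e] at h1
      simpa only [Metric.mem_ball, dist_zero_right, Complex.norm_real, Real.norm_eq_abs] using h1)
    push_cast at h2
    simp only [hu]
    rw [h2]
    push_cast
    rfl
  have hWr : ∀ s : ℝ, |s| < ρ → ∀ k ≤ n,
      W s k = (fn a d φ α k (θ₀ + s / (d : ℝ) ^ n) x₀ - x k : ℝ) := by
    intro s hs k
    induction k with
    | zero => intro _; simp [hW0, hx, fn_zero]
    | succ k ih =>
      intro hk
      rw [hWs, ih (by omega), hur s hs k (by omega)]
      simp only [hx, fn_succ, qm]
      rw [show (d : ℝ) ^ k * (θ₀ + s / (d : ℝ) ^ n) =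
        (d : ℝ) ^ k * θ₀ + s * (d : ℝ) ^ k / (d : ℝ) ^ n by ring]
      push_cast
      ring
  set b : ℕ → ℝ := fun i => if i < n then ∏ j ∈ Finset.Ico (n - i) n, (-2 * x j) else 0 with hb
  set e : ℕ → ℝ := fun i => (d : ℝ) ^ (n - 1 - i) * θ₀ with he
  set T : ℂ → ℂ := fun z => ∑ l ∈ Finset.range n,
    ((∏ i ∈ Finset.Ico (l + 1) n, (-2 * x i) : ℝ) : ℂ) * u z l with hT
  refine ⟨fun z => W z n, b, e, n, T, hn, ?_, ?_, ⟨hWd n le_rfl, fun s hs => ?_⟩,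
    ⟨?_, fun s hs => ?_⟩, fun z hz => ?_, fun z hz => (hp z hz).2⟩
  · simp [hb, show 0 < n by omega]
  · intro i
    simp only [hb]
    split_ifs with hi
    · have := h.abs_prod_le hx₀ θ₀ (n - i) n
      rwa [Nat.sub_sub_self hi.le] at this
    · simpa using by positivity
  · rw [hWr s hs n le_rfl, hXe, hXe]
    congr 2
    rw [hθ₀]
    congr 1
    ring
  · refine DifferentiableOn.fun_sum fun l hl => ?_
    have hl' := Finset.mem_range.1 hl
    exact (((hΦ1 l).diff.comp (f := fun z : ℂ => z * (d : ℂ) ^ l / (d : ℂ) ^ n) (by fun_prop)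
      fun z hz => (hin z hz l (by omega)).2).sub_const _).const_mul _
  · rw [hT]
    simp only
    rw [← Finset.sum_range_reflect (fun i => b i * (φ (e i + s / (d : ℝ) ^ (i + 1)) - φ (e i)))]
    rw [Complex.ofReal_sum]
    refine Finset.sum_congr rfl fun l hl => ?_
    have hl' := Finset.mem_range.1 hl
    rw [hur s hs l (by omega), ← Complex.ofReal_mul]
    simp only [hb, he]
    rw [if_pos (by omega), show n - (n - 1 - l) = l + 1 by omega,
      show n - 1 - (n - 1 - l) = l by omega, show n - 1 - l + 1 = n - l by omega]
    congr 5
    rw [div_eq_div_iff (pow_ne_zero _ hd0) (pow_ne_zero _ hd0), mul_assoc, ← pow_add,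
      Nat.add_sub_cancel' hl'.le]
  · have := (hp z hz).1 n le_rfl
    rwa [div_mul_cancel₀ _ (pow_ne_zero _ hd0)] at this

lemma exists_curve_deriv_bounds {φ : ℝ → ℝ} (hφa : ∀ x : ℝ, AnalyticAt ℝ φ x)
    (hφp : Function.Periodic φ 1) (hφnc : ∃ s t : ℝ, φ s ≠ φ t)
    {d : ℕ} (hd : 2 ≤ d) {C R : ℝ} (hC : 0 < C) (hR : 0 ≤ R) (hRd : R < d) :
    ∃ ℓ : ℕ, ∃ κ > 0, ∃ B : ℕ → ℝ, (∀ m, 0 < B m) ∧ ∃ α₀ > 0, ∀ a β α,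
      Dominated a d φ β C R α → α ≤ α₀ → ∀ X, IsCurve a d φ α β X → ∀ t,
        (∀ m, |iteratedDeriv (m + 1) X t| ≤ B (m + 1) * α) ∧
        ∃ m ≤ ℓ, κ * α ≤ |iteratedDeriv (m + 1) X t| := by
  have hd0 : (0 : ℝ) < d := by positivity
  obtain ⟨A, hA, E, hE, ρ, hρ, α₁, hα₁, hexp⟩ := exists_curve_expansion hφa hφp hd hC hR hRd
  obtain ⟨ℓ, κ, hκ, hnd⟩ := exists_uniform_lacunary (ψ := deriv φ) (fun x => (hφa x).deriv)
    (by have := periodic_iteratedDeriv hφp 1; rwa [iteratedDeriv_one] at this)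
    (fun m => by rw [← iteratedDeriv_succ']; exact exists_iteratedDeriv_ne_zero hφa hφp hφnc m)
    hd (C / d) (q := R / d) (c₀ := 1 / d) (by positivity) ((div_lt_one hd0).2 hRd) (by positivity)
  set G := ∑ m ∈ Finset.range (ℓ + 1), (m + 1).factorial * E / (ρ / 2) ^ (m + 1) with hG
  have hGm : ∀ m ≤ ℓ, (m + 1).factorial * E / (ρ / 2) ^ (m + 1) ≤ G := fun m hm =>
    Finset.single_le_sum (f := fun m : ℕ => ((m + 1).factorial : ℝ) * E / (ρ / 2) ^ (m + 1))
      (fun i _ => by positivity) (Finset.mem_range.2 (by omega))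
  have hG0 : 0 < G := lt_of_lt_of_le (by positivity) (hGm 0 (Nat.zero_le _))
  refine ⟨ℓ, κ / 2, by positivity, fun m => m.factorial * (A * ρ) / (ρ / 2) ^ m,
    fun m => by positivity, min α₁ (κ / (2 * G)), lt_min hα₁ (by positivity),
    fun a β α h hα X hX t => ?_⟩
  have hα0 := h.pos
  obtain ⟨F, b, e, n, T, hn, hb0, hb, hF, hT, hF1, hF2⟩ :=
    hexp a β α h (hα.trans (min_le_left _ _)) X hX t
  set g : ℝ → ℝ := fun s => X (t + s) - X t with hg
  set τ : ℝ → ℝ := fun s => ∑ i ∈ Finset.range n,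
    b i * (φ (e i + s / (d : ℝ) ^ (i + 1)) - φ (e i)) with hτ
  have hXg : ∀ m, iteratedDeriv (m + 1) g 0 = iteratedDeriv (m + 1) X t := by
    intro m
    have e1 : deriv g = fun s => deriv X (t + s) := by
      funext s
      simp only [hg, deriv_sub_const_fun]
      exact deriv_comp_const_add X t s
    rw [iteratedDeriv_succ', e1, iteratedDeriv_succ', iteratedDeriv_comp_const_add]
    simp
  refine ⟨fun m => ?_, ?_⟩
  · rw [← hXg]
    have := hF.abs_iteratedDeriv_le hρ (C := A * α * ρ) (fun z hz => (hF1 z hz).trans (by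
      have : ‖z‖ ≤ ρ := by simpa using (Metric.mem_ball.1 hz).le
      gcongr)) (m + 1)
    refine this.trans_eq ?_
    ring
  · set c : ℕ → ℝ := fun i => if i < n then b i / (d : ℝ) ^ (i + 1) else 0 with hc
    obtain ⟨m, hm, hm'⟩ := hnd c e (by simp [hc, show 0 < n by omega, hb0]) (fun i => by
      simp only [hc]
      split_ifs
      · rw [abs_div, abs_of_pos (by positivity : (0 : ℝ) < (d : ℝ) ^ (i + 1)), div_pow,
          div_mul_div_comm, ← pow_succ']
        exact div_le_div_of_nonneg_right (hb i) (by positivity)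
      · simpa using by positivity)
    refine ⟨m, hm, ?_⟩
    have hτ0 : iteratedDeriv (m + 1) τ 0 =
        ∑' i, c i / ((d : ℝ) ^ (i + 1)) ^ m * iteratedDeriv m (deriv φ) (e i) := by
      rw [hτ, iteratedDeriv_finite_lacunary hφa hd b e n m, tsum_eq_sum (s := Finset.range n)]
      · refine Finset.sum_congr rfl fun i hi => ?_
        simp only [hc, if_pos (Finset.mem_range.1 hi), zero_div, add_zero]
        rw [← iteratedDeriv_succ', pow_succ', ← div_div]
      · intro i hi
        simp only [hc, if_neg (fun h => hi (Finset.mem_range.2 h)), zero_div, zero_mul]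
    have hdiff : IsCExt (fun s => g s - α * τ s) ρ (fun z => F z - α * T z) :=
      ⟨hF.diff.sub (hT.diff.const_mul _), fun s hs => by
        rw [hF.ext s hs, hT.ext s hs]; push_cast; rfl⟩
    have h1 := hdiff.abs_iteratedDeriv_le hρ hF2 (m + 1)
    have e2 : iteratedDeriv (m + 1) (fun s => g s - α * τ s) 0 =
        iteratedDeriv (m + 1) X t - α * iteratedDeriv (m + 1) τ 0 := by
      have c1 : ContDiffAt ℝ ((m + 1 : ℕ) : WithTop ℕ∞) g 0 := (hF.analyticAt hρ).contDiffAt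
      have c2 : ContDiffAt ℝ ((m + 1 : ℕ) : WithTop ℕ∞) τ 0 := (hT.analyticAt hρ).contDiffAt
      have c3 : ContDiffAt ℝ ((m + 1 : ℕ) : WithTop ℕ∞) (fun s => α * τ s) 0 :=
        contDiffAt_const.mul c2
      rw [iteratedDeriv_fun_sub c1 c3, hXg, iteratedDeriv_const_mul_field]
    rw [e2] at h1
    have h2 : α ≤ κ / (2 * G) := hα.trans (min_le_right _ _)
    rw [le_div_iff₀ (by positivity)] at h2
    rw [← hτ0] at hm'
    have h3 := hGm m hm
    have h4 : ((m + 1).factorial : ℝ) * (E * α ^ 2) / (ρ / 2) ^ (m + 1) ≤ G * α ^ 2 := by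
      calc _ = ((m + 1).factorial : ℝ) * E / (ρ / 2) ^ (m + 1) * α ^ 2 := by ring
        _ ≤ _ := by gcongr
    have h5 := abs_sub_abs_le_abs_sub (α * iteratedDeriv (m + 1) τ 0) (iteratedDeriv (m + 1) X t)
    rw [abs_sub_comm, abs_mul, abs_of_pos hα0] at h5
    have h6 := mul_le_mul_of_nonneg_left hm' hα0.le
    have h7 : G * α ^ 2 ≤ κ / 2 * α := by nlinarith
    linarith

/-- Curves are Lipschitz at scale `α`, and they spend little time near the critical line. -/
theorem exists_power_law {φ : ℝ → ℝ} (hφa : ∀ x : ℝ, AnalyticAt ℝ φ x)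
    (hφp : Function.Periodic φ 1) (hφnc : ∃ s t : ℝ, φ s ≠ φ t)
    {d : ℕ} (hd : 2 ≤ d) {C R : ℝ} (hC : 0 < C) (hR : 0 ≤ R) (hRd : R < d) :
    ∃ A > 0, ∃ K > 0, ∃ τ, 0 < τ ∧ τ < 1 ∧ ∃ α₀ > 0, ∀ a β α,
      Dominated a d φ β C R α → α ≤ α₀ → ∀ X, IsCurve a d φ α β X →
        (∀ t t', |X t - X t'| ≤ A * α * |t - t'|) ∧
        ∀ k : ℕ, volume {t ∈ Ico (0 : ℝ) 1 | |X t| ≤ 2 * α / (d : ℝ) ^ k} ≤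
          ENNReal.ofReal (K * τ ^ k) := by
  obtain ⟨ℓ, κ, hκ, B, hB, α₀, hα₀, h⟩ := exists_curve_deriv_bounds hφa hφp hφnc hd hC hR hRd
  have hd2 : (2 : ℝ) ≤ d := by exact_mod_cast hd
  set τ : ℝ := 1 - 1 / (2 * (ℓ + 1)) with hτ
  have hτ0 : 0 < τ := by
    rw [hτ, sub_pos, div_lt_one (by positivity)]
    have : (0 : ℝ) ≤ ℓ := by positivity
    linarith
  have hτ1 : τ < 1 := by rw [hτ]; linarith [show (0 : ℝ) < 1 / (2 * (ℓ + 1)) by positivity]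
  have hτd : ∀ m ≤ ℓ, 1 ≤ d * τ ^ (m + 1) := by
    intro m hm
    have h1 := one_add_mul_le_pow (a := -(1 / (2 * ((ℓ : ℝ) + 1)))) (by
      have : 1 / (2 * ((ℓ : ℝ) + 1)) ≤ 1 := by
        rw [div_le_one (by positivity)]
        have : (0 : ℝ) ≤ ℓ := by positivity
        linarith
      linarith) (ℓ + 1)
    rw [← sub_eq_add_neg, ← hτ] at h1
    have h2 : (1 : ℝ) + ((ℓ + 1 : ℕ) : ℝ) * -(1 / (2 * ((ℓ : ℝ) + 1))) = 1 / 2 := by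
      push_cast; field_simp; norm_num
    rw [h2] at h1
    have h3 : τ ^ (ℓ + 1) ≤ τ ^ (m + 1) := pow_le_pow_of_le_one hτ0.le hτ1.le (by omega)
    nlinarith
  set Bm := ∑ m ∈ Finset.range (ℓ + 1), B (m + 2) with hBm
  have hBle : ∀ m ≤ ℓ, B (m + 2) ≤ Bm := fun m hm =>
    Finset.single_le_sum (f := fun m => B (m + 2)) (fun i _ => (hB _).le)
      (Finset.mem_range.2 (by omega))
  have hBm0 : 0 < Bm := (hB 2).trans_le (hBle 0 (Nat.zero_le _))
  set r := κ / (2 * Bm) with hr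
  have hr0 : 0 < r := by positivity
  obtain ⟨J, hJ⟩ := exists_nat_gt (1 / r)
  set E := 2 + 16 / κ with hE
  have hE2 : 2 ≤ E := by rw [hE]; linarith [show (0 : ℝ) < 16 / κ by positivity]
  refine ⟨B 1, hB 1, (J + 1) * (2 ^ (ℓ + 1) * (2 * E)), by positivity, τ, hτ0, hτ1, α₀, hα₀,
    fun a β α hdom hα X hX => ⟨fun t t' => ?_, fun k => ?_⟩⟩
  · have := Convex.norm_image_sub_le_of_norm_deriv_le (f := X) (s := univ) (x := t') (y := t)
      (C := B 1 * α) (fun x _ => (hX.analyticAt hφa x).differentiableAt) (fun x _ => by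
        have := (h a β α hdom hα X hX x).1 0
        rwa [zero_add, iteratedDeriv_one] at this) convex_univ (mem_univ _) (mem_univ _)
    simpa using this
  · have hα0 := hdom.pos
    set g : ℕ → ℝ → ℝ := fun m s => iteratedDeriv m X s / α with hg
    have hgd : ∀ m s, HasDerivAt (g m) (g (m + 1) s) s := fun m s =>
      (hasDerivAt_iteratedDeriv (hX.analyticAt hφa) m s).div_const _
    have hpiece : ∀ u, volume {s ∈ Icc u (u + r) | |X s| ≤ 2 * α / (d : ℝ) ^ k} ≤
        ENNReal.ofReal (2 ^ (ℓ + 1) * (2 * (E * τ ^ k))) := by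
      intro u
      obtain ⟨m, hm, hm'⟩ := (h a β α hdom hα X hX u).2
      have hder : ∀ s ∈ Icc u (u + r), κ / 2 ≤ |g (m + 1) s| := by
        intro s hs
        have h1 := Convex.norm_image_sub_le_of_norm_hasDerivWithin_le (f := g (m + 1))
          (f' := g (m + 2)) (s := univ) (x := u) (y := s) (C := Bm)
          (fun x _ => (hgd (m + 1) x).hasDerivWithinAt) (fun x _ => by
            have := (h a β α hdom hα X hX x).1 (m + 1)
            simp only [hg, Real.norm_eq_abs]
            rw [abs_div, abs_of_pos hα0, div_le_iff₀ hα0]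
            exact this.trans (mul_le_mul_of_nonneg_right (hBle m hm) hα0.le))
          convex_univ (mem_univ _) (mem_univ _)
        rw [Real.norm_eq_abs, Real.norm_eq_abs, abs_of_nonneg (sub_nonneg.2 hs.1)] at h1
        have h2 : κ ≤ |g (m + 1) u| := by
          simp only [hg]
          rw [abs_div, abs_of_pos hα0, le_div_iff₀ hα0]
          exact hm'
        have h3 : Bm * (s - u) ≤ κ / 2 := by
          calc Bm * (s - u) ≤ Bm * r := by
                have := hs.2
                exact mul_le_mul_of_nonneg_left (by linarith) hBm0.le
            _ = κ / 2 := by rw [hr]; field_simp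
        have h4 := abs_sub_abs_le_abs_sub (g (m + 1) u) (g (m + 1) s)
        rw [abs_sub_comm] at h4
        linarith
      have hη : 0 < E * τ ^ k := by positivity
      have h1 := volume_sublevel_le hgd (u := u) (v := u + r) (ε := 2 / (d : ℝ) ^ k) hη (m + 1) hder (by
        have e1 : 2 / (d : ℝ) ^ k * (2 / (E * τ ^ k)) ^ (m + 1) =
            2 * (2 / E) ^ (m + 1) / (d * τ ^ (m + 1)) ^ k := by
          rw [div_pow, div_pow, mul_pow, mul_pow, ← pow_mul, ← pow_mul, mul_comm k (m + 1)]
          field_simp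
        rw [e1]
        have e2 : (2 / E) ^ (m + 1) ≤ 2 / E :=
          pow_le_of_le_one (by positivity) ((div_le_one (by positivity)).2 hE2) (by omega)
        have e3 : (1 : ℝ) ≤ (d * τ ^ (m + 1)) ^ k := one_le_pow₀ (hτd m hm)
        have e4 : 2 * (2 / E) < κ / 2 := by
          rw [← mul_div_assoc, div_lt_iff₀ (by positivity), hE]
          have : κ / 2 * (2 + 16 / κ) = κ + 8 := by field_simp; ring
          linarith
        have e5 : 2 * (2 / E) ^ (m + 1) / (d * τ ^ (m + 1)) ^ k ≤ 2 * (2 / E) ^ (m + 1) :=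
          div_le_self (by positivity) e3
        linarith)
      refine (measure_mono fun s hs => ?_).trans (h1.trans (ENNReal.ofReal_le_ofReal ?_))
      · refine ⟨hs.1, ?_⟩
        simp only [hg, iteratedDeriv_zero]
        rw [abs_div, abs_of_pos hα0, div_le_iff₀ hα0]
        calc |X s| ≤ 2 * α / (d : ℝ) ^ k := hs.2
          _ = _ := by ring
      · exact mul_le_mul_of_nonneg_right (pow_le_pow_right₀ one_le_two (by omega)) (by positivity)
    have hcover : {t ∈ Ico (0 : ℝ) 1 | |X t| ≤ 2 * α / (d : ℝ) ^ k} ⊆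
        ⋃ j ∈ Finset.range (J + 1), {s ∈ Icc (j * r) (j * r + r) | |X s| ≤ 2 * α / (d : ℝ) ^ k} := by
      intro t ht
      have hfl := Nat.floor_le (div_nonneg ht.1.1 hr0.le)
      have hfl2 := Nat.lt_floor_add_one (t / r)
      rw [le_div_iff₀ hr0] at hfl
      rw [div_lt_iff₀ hr0] at hfl2
      refine mem_iUnion₂.2 ⟨⌊t / r⌋₊, ?_, ⟨hfl, by linarith⟩, ht.2⟩
      rw [Finset.mem_range]
      have h1 : (⌊t / r⌋₊ : ℝ) ≤ t / r := Nat.floor_le (div_nonneg ht.1.1 hr0.le)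
      have h2 : t / r ≤ 1 / r := div_le_div_of_nonneg_right ht.1.2.le hr0.le
      have h3 : (⌊t / r⌋₊ : ℝ) < J := by linarith
      have : ⌊t / r⌋₊ < J := by exact_mod_cast h3
      omega
    refine (measure_mono hcover).trans ((measure_biUnion_finset_le _ _).trans ?_)
    refine (Finset.sum_le_sum fun j _ => hpiece _).trans ?_
    rw [Finset.sum_const, Finset.card_range, nsmul_eq_mul, ← ENNReal.ofReal_natCast,
      ← ENNReal.ofReal_mul (by positivity)]
    refine ENNReal.ofReal_le_ofReal (le_of_eq ?_)
    push_cast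
    ring

lemma eq_const_of_small_periods {f : ℝ → ℝ} (hf : Continuous f) {t : ℕ → ℝ}
    (ht0 : ∀ n, 0 < t n) (ht : Tendsto t atTop (nhds 0)) (hp : ∀ n, Function.Periodic f (t n))
    (x y : ℝ) : f x = f y := by
  have h1 : ∀ n, f (x + ⌊(y - x) / t n⌋ * t n) = f x := fun n => (hp n).int_mul _ x
  have h2 : Tendsto (fun n => x + ⌊(y - x) / t n⌋ * t n) atTop (nhds y) := by
    rw [Metric.tendsto_atTop]
    intro ε hε
    obtain ⟨n₀, hn₀⟩ := Metric.tendsto_atTop.1 ht ε hε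
    refine ⟨n₀, fun n hn => lt_of_le_of_lt ?_ (hn₀ n hn)⟩
    have a1 := Int.floor_le ((y - x) / t n)
    have a2 := Int.lt_floor_add_one ((y - x) / t n)
    rw [le_div_iff₀ (ht0 n)] at a1
    rw [div_lt_iff₀ (ht0 n)] at a2
    rw [Real.dist_eq, Real.dist_eq, sub_zero, abs_of_pos (ht0 n), abs_le]
    constructor <;> linarith
  have h3 := (hf.tendsto y).comp h2
  simp only [Function.comp_def, h1] at h3
  exact (tendsto_nhds_unique h3 tendsto_const_nhds).symm

lemma eq_zero_of_infinite_zeros {f : ℝ → ℝ} (hf : ∀ x, AnalyticAt ℝ f x) {S : Set ℝ}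
    (hS : S.Infinite) (hS1 : S ⊆ Icc 0 1) (h0 : ∀ x ∈ S, f x = 0) (x : ℝ) : f x = 0 := by
  obtain ⟨z, -, hz⟩ := hS.exists_accPt_of_subset_isCompact isCompact_Icc hS1
  have h1 := accPt_iff_frequently_nhdsNE.1 hz
  exact congrFun (AnalyticOnNhd.eq_of_frequently_eq (f := f) (g := fun _ => (0 : ℝ))
    (fun x _ => hf x) (fun x _ => analyticAt_const) (h1.mono fun y hy => h0 y hy)) x

lemma eventually_volume_inter_translate_pos {K : Set ℝ} (hK : IsCompact K) (hK0 : 0 < volume K) :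
    ∃ ε > 0, ∀ t : ℝ, |t| < ε → 0 < volume (K ∩ {x | x + t ∈ K}) := by
  have hfin : volume K < ∞ := hK.measure_lt_top
  obtain ⟨U, hKU, hUo, hU⟩ := K.exists_isOpen_lt_of_lt (2 * volume K) (by
    rw [two_mul]; exact ENNReal.lt_add_right hfin.ne hK0.ne')
  obtain ⟨ε, hε, hεU⟩ := hK.exists_thickening_subset_open hUo hKU
  refine ⟨ε, hε, fun t ht => pos_iff_ne_zero.2 fun h0 => ?_⟩
  have hm : MeasurableSet {x | x + t ∈ K} :=
    (measurable_id.add_const t) hK.measurableSet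
  have h1 : volume {x | x + t ∈ K} = volume K := measure_preimage_add_right volume t K
  have h2 : K ∪ {x | x + t ∈ K} ⊆ U := by
    refine union_subset hKU fun x hx => hεU ?_
    refine Metric.mem_thickening_iff.2 ⟨x + t, hx, ?_⟩
    rw [Real.dist_eq]
    simpa using ht
  have h3 := measure_union_add_inter K hm (μ := volume)
  rw [h0, add_zero, h1, ← two_mul] at h3
  exact absurd (h3 ▸ measure_mono h2) (not_le.2 hU)

lemma tendsto_one_div_pow {r : ℝ} (hr : 1 < r) :
    Tendsto (fun j : ℕ => 1 / r ^ j) atTop (nhds 0) := by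
  simpa [Function.comp_def] using
    tendsto_inv_atTop_zero.comp (tendsto_pow_atTop_atTop_of_one_lt hr)

/-- The lacunary series `∑ w_k φ(d^k θ)`. -/
def lacunary (d : ℕ) (φ : ℝ → ℝ) (w : ℕ → ℝ) (θ : ℝ) : ℝ := ∑' k, w k * φ ((d : ℝ) ^ k * θ)

section lacunary

variable {d : ℕ} {φ : ℝ → ℝ} {w : ℕ → ℝ}

lemma summable_lacunary (hφb : ∀ θ, |φ θ| ≤ 1) (hw : Summable fun k => |w k|) (θ : ℝ) :
    Summable fun k => w k * φ ((d : ℝ) ^ k * θ) :=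
  Summable.of_norm_bounded hw fun k => by
    rw [norm_mul]
    exact mul_le_of_le_one_right (norm_nonneg _) (hφb _)

lemma abs_lacunary_le (hφb : ∀ θ, |φ θ| ≤ 1) (hw : Summable fun k => |w k|) (θ : ℝ) :
    |lacunary d φ w θ| ≤ ∑' k, |w k| :=
  tsum_of_norm_bounded (f := fun k => w k * φ ((d : ℝ) ^ k * θ)) hw.hasSum fun k => by
    rw [norm_mul]
    exact mul_le_of_le_one_right (norm_nonneg _) (hφb _)

lemma continuous_lacunary (hφc : Continuous φ) (hφb : ∀ θ, |φ θ| ≤ 1)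
    (hw : Summable fun k => |w k|) : Continuous (lacunary d φ w) :=
  continuous_tsum (fun k => by fun_prop) hw fun k θ => by
    rw [norm_mul]
    exact mul_le_of_le_one_right (norm_nonneg _) (hφb _)

lemma periodic_nat_mul (hφp : Function.Periodic φ 1) (n : ℕ) (x : ℝ) : φ (x + n) = φ x := by
  have := hφp.nat_mul n x
  rwa [mul_one] at this

lemma lacunary_periodic_scale (hd : 2 ≤ d) {j : ℕ}
    (hp : Function.Periodic φ (1 / (d : ℝ) ^ j)) (k : ℕ) (θ : ℝ) :
    φ ((d : ℝ) ^ (k + 1) * (θ + 1 / (d : ℝ) ^ (j + 1))) = φ ((d : ℝ) ^ (k + 1) * θ) := by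
  have hd0 : (d : ℝ) ≠ 0 := by positivity
  have := hp.nat_mul (d ^ k) ((d : ℝ) ^ (k + 1) * θ)
  rw [← this]
  congr 1
  push_cast
  field_simp
  try ring

lemma lacunary_eq_sum_add (hφb : ∀ θ, |φ θ| ≤ 1) (hw : Summable fun k => |w k|) (n : ℕ) (θ : ℝ) :
    lacunary d φ w θ = (∑ k ∈ Finset.range n, w k * φ ((d : ℝ) ^ k * θ)) +
      ∑' k, w (k + n) * φ ((d : ℝ) ^ (k + n) * θ) :=
  ((summable_lacunary hφb hw θ).sum_add_tsum_nat_add n).symm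

/-- A nontrivial lacunary series is not constant. -/
lemma exists_lacunary_ne (hd : 2 ≤ d) (hφc : Continuous φ) (hφp : Function.Periodic φ 1)
    (hφnc : ∃ s t, φ s ≠ φ t) (hφb : ∀ θ, |φ θ| ≤ 1) (hw : Summable fun k => |w k|)
    (hw0 : w 0 ≠ 0) : ∃ s t, lacunary d φ w s ≠ lacunary d φ w t := by
  by_contra! hcon
  have hd0 : (0 : ℝ) < d := by positivity
  have hd1 : (1 : ℝ) < d := by exact_mod_cast hd
  have hp : ∀ j : ℕ, Function.Periodic φ (1 / (d : ℝ) ^ j) := by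
    intro j
    induction j with
    | zero => simpa using hφp
    | succ j ih =>
      intro θ
      have h1 := hcon (θ + 1 / (d : ℝ) ^ (j + 1)) θ
      rw [lacunary_eq_sum_add hφb hw 1, lacunary_eq_sum_add hφb hw 1 θ] at h1
      simp only [lacunary_periodic_scale hd ih, Finset.sum_range_one, pow_zero, one_mul] at h1
      exact mul_left_cancel₀ hw0 (add_right_cancel h1)
  obtain ⟨s, t, hst⟩ := hφnc
  refine hst (eq_const_of_small_periods hφc (t := fun j => 1 / (d : ℝ) ^ j)
    (fun j => by positivity) ?_ hp s t)
  exact tendsto_one_div_pow hd1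

lemma volume_lacunary_eq (hd : 2 ≤ d) (hφa : ∀ x, AnalyticAt ℝ φ x) (hφp : Function.Periodic φ 1)
    (hφnc : ∃ s t, φ s ≠ φ t) (hφb : ∀ θ, |φ θ| ≤ 1) (hw : Summable fun k => |w k|)
    (hw0 : w 0 ≠ 0) (c : ℝ) : volume {θ ∈ Icc (0 : ℝ) 1 | lacunary d φ w θ = c} = 0 := by
  have hφc : Continuous φ := continuous_iff_continuousAt.2 fun x => (hφa x).continuousAt
  have hG := continuous_lacunary (d := d) hφc hφb hw
  by_contra hne
  set K := {θ ∈ Icc (0 : ℝ) 1 | lacunary d φ w θ = c} with hKdef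
  have hK : IsCompact K := isCompact_Icc.inter_right (isClosed_eq hG continuous_const)
  obtain ⟨ε, hε, hpos⟩ := eventually_volume_inter_translate_pos hK (pos_iff_ne_zero.2 hne)
  have hd0 : (0 : ℝ) < d := by positivity
  have hd1 : (1 : ℝ) < d := by exact_mod_cast hd
  have htend : Tendsto (fun j : ℕ => 1 / (d : ℝ) ^ j) atTop (nhds 0) :=
    tendsto_one_div_pow hd1
  obtain ⟨n₀, hn₀⟩ := Metric.tendsto_atTop.1 htend ε hε
  have hper : ∀ n, n₀ ≤ n → Function.Periodic (lacunary d φ w) (1 / (d : ℝ) ^ n) := by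
    intro n hn
    have h1 : ∀ θ, lacunary d φ w (θ + 1 / (d : ℝ) ^ n) - lacunary d φ w θ =
        ∑ k ∈ Finset.range n, w k *
          (φ ((d : ℝ) ^ k * (θ + 1 / (d : ℝ) ^ n)) - φ ((d : ℝ) ^ k * θ)) := by
      intro θ
      rw [lacunary_eq_sum_add hφb hw n, lacunary_eq_sum_add hφb hw n θ]
      have e : ∀ k : ℕ, φ ((d : ℝ) ^ (k + n) * (θ + 1 / (d : ℝ) ^ n)) =
          φ ((d : ℝ) ^ (k + n) * θ) := by
        intro k
        rw [← periodic_nat_mul hφp (d ^ k) ((d : ℝ) ^ (k + n) * θ)]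
        congr 1
        push_cast
        field_simp
        try ring
      simp only [e, mul_sub, Finset.sum_sub_distrib]
      ring
    have h2 := eq_zero_of_infinite_zeros (f := fun θ => ∑ k ∈ Finset.range n, w k *
          (φ ((d : ℝ) ^ k * (θ + 1 / (d : ℝ) ^ n)) - φ ((d : ℝ) ^ k * θ)))
      (S := K ∩ {x | x + 1 / (d : ℝ) ^ n ∈ K}) (fun x => ?_) ?_ ?_ ?_
    · intro θ
      have := h2 θ
      rw [← h1] at this
      linarith
    · refine Finset.analyticAt_fun_sum _ fun k _ => analyticAt_const.mul (AnalyticAt.sub ?_ ?_)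
      · exact (hφa _).comp_of_eq (f := fun θ : ℝ => (d : ℝ) ^ k * (θ + 1 / (d : ℝ) ^ n)) (by fun_prop) rfl
      · exact (hφa _).comp_of_eq (f := fun θ : ℝ => (d : ℝ) ^ k * θ) (by fun_prop) rfl
    · intro hfin
      have := hn₀ n hn
      rw [Real.dist_eq, sub_zero] at this
      exact (hpos _ this).ne' (hfin.measure_zero _)
    · exact fun x hx => hx.1.1
    · intro x hx
      simp only [← h1]
      rw [hx.1.2, hx.2.2, sub_self]
  obtain ⟨s, t, hst⟩ := exists_lacunary_ne hd hφc hφp hφnc hφb hw hw0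
  refine hst (eq_const_of_small_periods hG (t := fun j => 1 / (d : ℝ) ^ (j + n₀))
    (fun j => by positivity) ((tendsto_add_atTop_iff_nat n₀).2 htend) (fun j => hper _ (by omega)) s t)

/-- The distribution of a nontrivial lacunary series has no atoms, uniformly. -/
lemma exists_volume_lacunary_near_le (hd : 2 ≤ d) (hφa : ∀ x, AnalyticAt ℝ φ x)
    (hφp : Function.Periodic φ 1) (hφnc : ∃ s t, φ s ≠ φ t) (hφb : ∀ θ, |φ θ| ≤ 1)
    (hw : Summable fun k => |w k|) (hw0 : w 0 ≠ 0) {ε : ℝ≥0∞} (hε : 0 < ε) :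
    ∃ ρ > 0, ∀ c, volume {θ ∈ Icc (0 : ℝ) 1 | |lacunary d φ w θ - c| < ρ} ≤ ε := by
  have hφc : Continuous φ := continuous_iff_continuousAt.2 fun x => (hφa x).continuousAt
  have hG := continuous_lacunary (d := d) hφc hφb hw
  set G := lacunary d φ w
  have h1 : ∀ c, ∃ δ > 0, volume {θ ∈ Icc (0 : ℝ) 1 | |G θ - c| < δ} ≤ ε := by
    intro c
    have hmono : Antitone fun n : ℕ => {θ ∈ Icc (0 : ℝ) 1 | |G θ - c| < 1 / ((n : ℝ) + 1)} :=
      fun m n hmn θ hθ => ⟨hθ.1, lt_of_lt_of_le hθ.2 (Nat.one_div_le_one_div hmn)⟩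
    have hm : ∀ n : ℕ, MeasurableSet {θ ∈ Icc (0 : ℝ) 1 | |G θ - c| < 1 / ((n : ℝ) + 1)} :=
      fun n => measurableSet_Icc.inter
        (isOpen_lt (hG.sub continuous_const).abs continuous_const).measurableSet
    have ht := tendsto_measure_iInter_atTop (μ := volume) (fun n => (hm n).nullMeasurableSet) hmono
      ⟨0, ((measure_mono (fun θ hθ => hθ.1)).trans_lt
        (isCompact_Icc.measure_lt_top (μ := volume) (K := Icc (0 : ℝ) 1))).ne⟩
    have h0 : volume (⋂ n : ℕ, {θ ∈ Icc (0 : ℝ) 1 | |G θ - c| < 1 / ((n : ℝ) + 1)}) = 0 := by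
      refine measure_mono_null (fun θ hθ => ?_)
        (volume_lacunary_eq hd hφa hφp hφnc hφb hw hw0 c)
      rw [mem_iInter] at hθ
      refine ⟨(hθ 0).1, ?_⟩
      by_contra hne
      obtain ⟨n, hn⟩ := exists_nat_one_div_lt (abs_pos.2 (sub_ne_zero.2 hne))
      exact absurd (hθ n).2 (not_lt.2 hn.le)
    rw [h0] at ht
    obtain ⟨n, hn⟩ := (ht.eventually (Iio_mem_nhds hε)).exists
    exact ⟨1 / ((n : ℝ) + 1), by positivity, hn.le⟩
  choose δ hδ0 hδ using h1
  set M := ∑' k, |w k|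
  obtain ⟨ρ, hρ, hcov⟩ := lebesgue_number_lemma_of_metric (s := Icc (-(M + 1)) (M + 1))
    (c := fun c => Metric.ball c (δ c)) isCompact_Icc (fun c => Metric.isOpen_ball)
    (fun c _ => mem_iUnion.2 ⟨c, Metric.mem_ball_self (hδ0 c)⟩)
  refine ⟨min ρ 1, by positivity, fun c => ?_⟩
  by_cases hc : c ∈ Icc (-(M + 1)) (M + 1)
  · obtain ⟨c', hc'⟩ := hcov c hc
    refine le_trans (measure_mono fun θ hθ => And.intro hθ.1 ?_) (hδ c')
    have : G θ ∈ Metric.ball c ρ := by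
      rw [Metric.mem_ball, Real.dist_eq]
      exact lt_of_lt_of_le hθ.2 (min_le_left _ _)
    simpa [Real.dist_eq] using hc' this
  · have hempty : {θ ∈ Icc (0 : ℝ) 1 | |G θ - c| < min ρ 1} = ∅ := by
      refine eq_empty_of_forall_notMem fun θ hθ => hc ?_
      have a1 := abs_le.1 (abs_lacunary_le (d := d) hφb hw θ)
      have a2 := abs_lt.1 (lt_of_lt_of_le hθ.2 (min_le_right _ _))
      constructor <;> linarith [a1.1, a1.2, a2.1, a2.2]
    rw [hempty, measure_empty]
    exact bot_le

end lacunary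

lemma abs_prod_one_add_sub_one_le_two_mul {z : ℕ → ℝ} {k : ℕ} {S : ℝ}
    (hz : ∑ i ∈ Finset.range k, |z i| ≤ S) (hS : S ≤ 1 / 4) :
    |∏ i ∈ Finset.range k, (1 + z i) - 1| ≤ 2 * S := by
  have h1 := Finset.norm_prod_one_add_sub_one_le (Finset.range k) z
  simp only [Real.norm_eq_abs] at h1
  have h0 : 0 ≤ S := le_trans (Finset.sum_nonneg fun i _ => abs_nonneg _) hz
  have h2 := Real.exp_le_exp.2 hz
  have h3 := Real.exp_bound_div_one_sub_of_interval h0 (by linarith)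
  have h4 : 1 / (1 - S) ≤ 1 + 2 * S := by
    rw [div_le_iff₀ (by linarith)]
    nlinarith
  linarith

lemma div_prod_recursion {m b v : ℕ → ℝ} (h : ∀ k, v (k + 1) = m k * v k + b k) (k : ℕ)
    (hm : ∀ i < k, m i ≠ 0) :
    v k / ∏ i ∈ Finset.range k, m i =
      v 0 + ∑ j ∈ Finset.range k, b j / ∏ i ∈ Finset.range (j + 1), m i := by
  induction k with
  | zero => simp
  | succ k ih =>
    rw [Finset.sum_range_succ, ← add_assoc, ← ih fun i hi => hm i (by omega), h,
      Finset.prod_range_succ, add_div, mul_comm (m k) (v k),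
      mul_div_mul_right _ _ (hm k (by omega))]

/-- The inverse of the derivative of `(qm a)^[k]` along the critical orbit. -/
def critWeight (a : ℝ) (k : ℕ) : ℝ := 1 / ∏ i ∈ Finset.range k, (-2 * orb a 0 (i + 1))

lemma abs_critWeight (a : ℝ) (k : ℕ) :
    |critWeight a k| = 1 / dprod (fun i => orb a 0 (i + 1)) k := by
  rw [critWeight, abs_div, abs_one, Finset.abs_prod, dprod]
  congr 1
  exact Finset.prod_congr rfl fun i _ => by rw [neg_mul, abs_neg]

namespace Misiurewicz

variable {a P : ℝ} (h : Misiurewicz a P) {lam c C : ℝ}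

omit h in
lemma abs_critWeight_le (hg : Growth a lam c C) (k : ℕ) :
    |critWeight a k| ≤ 1 / c * (1 / lam) ^ k := by
  have := hg.one_lt
  have := hg.c_pos
  rw [abs_critWeight, one_div_pow, one_div_mul_one_div]
  exact one_div_le_one_div_of_le (by positivity) (hg.lower k)

omit h in
lemma summable_critWeight (hg : Growth a lam c C) : Summable fun k => |critWeight a k| := by
  have hl := hg.one_lt
  refine Summable.of_nonneg_of_le (fun _ => abs_nonneg _) (abs_critWeight_le hg)
    (Summable.mul_left _ (summable_geometric_of_lt_one (by positivity) ?_))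
  rw [div_lt_one (by linarith)]
  exact hl

include h

/-- Two pseudo-orbits near the critical orbit have mixed derivatives close to those of the
critical orbit. -/
lemma mixed_derivative_close (hg : Growth a lam c C) : ∃ δ₁ > 0, ∃ L > 0, ∀ α > 0,
    ∀ z z' : ℕ → ℝ, |z 0 - orb a 0 1| ≤ 5 * α → |z' 0 - orb a 0 1| ≤ 5 * α →
      (∀ i, |z (i + 1) - qm a (z i)| ≤ α) → (∀ i, |z' (i + 1) - qm a (z' i)| ≤ α) →
      ∀ k, lam ^ k * (5 * α) ≤ δ₁ →
        |1 / (∏ i ∈ Finset.range k, (-(z i + z' i))) - critWeight a k| ≤ L * α ∧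
        c * lam ^ k / 2 ≤ |∏ i ∈ Finset.range k, (-(z i + z' i))| := by
  obtain ⟨K, η, δ₀, hK, hη, hδ₀, hb⟩ := h.bound_period hg
  obtain ⟨η₁, hη₁, he⟩ := h.exists_crit_lower
  have hl := hg.one_lt
  have hl1 : 0 < lam - 1 := by linarith
  have hc := hg.c_pos
  refine ⟨min δ₀ (η₁ * (lam - 1) / (4 * K)), by positivity,
    20 * K / (η₁ * (lam - 1) * c), by positivity, ?_⟩
  intro α hα z z' hz0 hz0' hz hz' k hk
  have hkδ := hk.trans (min_le_left _ _)
  have hkS := hk.trans (min_le_right _ _)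
  have hlk : 0 < lam ^ k := by positivity
  set e : ℕ → ℝ := fun i => orb a 0 (i + 1) with he_def
  have he0 : ∀ i, e i ≠ 0 := fun i => abs_pos.1 (hη₁.trans_le (he i))
  set q : ℕ → ℝ := fun i => (z i + z' i - 2 * e i) / (2 * e i) with hq
  set S := K * (lam ^ k * (5 * α)) / (η₁ * (lam - 1)) with hS
  have hS4 : S ≤ 1 / 4 := by
    rw [le_div_iff₀ (by positivity)] at hkS
    rw [hS, div_le_iff₀ (by positivity)]
    linarith
  have hS0 : 0 ≤ S := by positivity
  have hqS : ∑ i ∈ Finset.range k, |q i| ≤ S := by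
    calc _ ≤ ∑ i ∈ Finset.range k, K * (5 * α) / η₁ * lam ^ i := by
          refine Finset.sum_le_sum fun i hi => ?_
          have hik : lam ^ i ≤ lam ^ k := pow_le_pow_right₀ hl.le (Finset.mem_range.1 hi).le
          have hi' : lam ^ i * (5 * α) ≤ δ₀ :=
            (mul_le_mul_of_nonneg_right hik (by positivity)).trans hkδ
          have a1 := (hb (5 * α) α (by linarith) z hz0 hz i hi').1
          have a2 := (hb (5 * α) α (by linarith) z' hz0' hz' i hi').1
          have a3 : |z i + z' i - 2 * e i| ≤ 2 * (K * (lam ^ i * (5 * α))) := by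
            have : z i + z' i - 2 * e i = (z i - e i) + (z' i - e i) := by ring
            rw [this]
            exact (abs_add_le _ _).trans (by linarith)
          rw [hq, abs_div, abs_mul, abs_two]
          calc _ ≤ 2 * (K * (lam ^ i * (5 * α))) / (2 * η₁) := by
                gcongr
                exact he i
            _ = _ := by field_simp
      _ = K * (5 * α) / η₁ * ∑ i ∈ Finset.range k, lam ^ i := by rw [Finset.mul_sum]
      _ ≤ K * (5 * α) / η₁ * (lam ^ k / (lam - 1)) := by
          gcongr
          exact geom_sum_le hl k
      _ = S := by rw [hS]; field_simp
  set W := ∏ i ∈ Finset.range k, (-2 * e i) with hW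
  have hprod : ∏ i ∈ Finset.range k, (-(z i + z' i)) = W * ∏ i ∈ Finset.range k, (1 + q i) := by
    rw [hW, ← Finset.prod_mul_distrib]
    refine Finset.prod_congr rfl fun i _ => ?_
    have := he0 i
    rw [hq]
    field_simp
    ring
  set Λ := ∏ i ∈ Finset.range k, (1 + q i) with hΛ
  have hΛ1 : |Λ - 1| ≤ 2 * S := abs_prod_one_add_sub_one_le_two_mul hqS hS4
  have hΛ2 : 1 / 2 ≤ Λ := by have := abs_le.1 hΛ1; linarith
  have hWabs : |W| = dprod e k := by
    rw [hW, Finset.abs_prod, dprod]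
    exact Finset.prod_congr rfl fun i _ => by rw [neg_mul, abs_neg]
  have hWl : c * lam ^ k ≤ |W| := hWabs ▸ hg.lower k
  have hW0 : 0 < |W| := lt_of_lt_of_le (by positivity) hWl
  have hW0' : W ≠ 0 := abs_pos.1 hW0
  have hΛ0 : 0 < Λ := by linarith
  rw [hprod]
  constructor
  · have e1 : 1 / (W * Λ) - critWeight a k = (1 - Λ) / (W * Λ) := by
      rw [critWeight, ← hW]
      field_simp
    rw [e1, abs_div, abs_mul, abs_of_pos hΛ0, abs_sub_comm]
    calc _ ≤ 2 * S / (c * lam ^ k * (1 / 2)) := by gcongr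
      _ = _ := by rw [hS]; field_simp; ring
  · rw [abs_mul, abs_of_pos hΛ0]
    nlinarith

/-- Two orbits that start together near the critical point are separated at the end of the bound
period by the difference of the weighted noise. -/
lemma difference_bound (hg : Growth a lam c C) : ∃ δ₁ > 0, ∀ δ₀ > 0, δ₀ ≤ δ₁ → ∀ A ≥ 0,
    ∃ κ > 0, ∃ L > 0, ∀ α > 0, ∀ N ≥ 1, lam ^ N * (5 * α) ≤ δ₀ → δ₀ < lam ^ (N + 1) * (5 * α) →
      ∀ u u' y y' : ℕ → ℝ, (∀ i, |u i| ≤ 1) → (∀ i, |u' i| ≤ 1) →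
        (∀ i, y (i + 1) = qm a (y i) + α * u i) → (∀ i, y' (i + 1) = qm a (y' i) + α * u' i) →
        |y 0| ≤ 2 * √α → |y' 0| ≤ 2 * √α → |y 0 - y' 0| ≤ A * α →
        κ * (|∑' k, critWeight a k * u k - ∑' k, critWeight a k * u' k| - L * √α) ≤
          |y N - y' N| := by
  obtain ⟨δ₁, hδ₁, L₁, hL₁, hcl⟩ := h.mixed_derivative_close hg
  have hl := hg.one_lt
  have hl0 : 0 < lam := by linarith
  have hl1 : 0 < lam - 1 := by linarith
  have hc := hg.c_pos
  have hs1 : 0 < √lam - 1 := by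
    have := Real.lt_sqrt_of_sq_lt (x := 1) (y := lam) (by linarith)
    linarith
  refine ⟨δ₁, hδ₁, fun δ₀ hδ₀ hδδ A hA => ?_⟩
  refine ⟨c * δ₀ / (10 * lam ^ 2), by positivity, 4 * A + 2 * L₁ * (√δ₀ / (√5 * (√lam - 1))) +
    2 / (c * (lam - 1)) * (5 * lam ^ 2 / δ₀) * √δ₀, by positivity, ?_⟩
  intro α hα N hN hN1 hN2 u u' y y' hu hu' hy hy' hy0 hy0' hyy
  obtain ⟨n, rfl⟩ : ∃ n, N = n + 1 := ⟨N - 1, by omega⟩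
  have hsα : 0 < √α := Real.sqrt_pos.2 hα
  have hsq : √α ^ 2 = α := Real.sq_sqrt hα.le
  have hstart : ∀ (u y : ℕ → ℝ), |u 0| ≤ 1 → (∀ i, y (i + 1) = qm a (y i) + α * u i) →
      |y 0| ≤ 2 * √α → |y (0 + 1) - orb a 0 1| ≤ 5 * α := by
    intro u y hu hy hy0
    have e : y (0 + 1) - orb a 0 1 = α * u 0 - y 0 ^ 2 := by
      rw [hy, orb_succ, orb_zero, qm, qm]; ring
    have a1 : y 0 ^ 2 ≤ 4 * α := by
      rw [← sq_abs, ← hsq]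
      have := abs_nonneg (y 0)
      nlinarith
    have a2 : |α * u 0| ≤ α := by
      rw [abs_mul, abs_of_pos hα]
      exact mul_le_of_le_one_right hα.le hu
    rw [e, abs_le]
    have := abs_le.1 a2
    constructor <;> nlinarith [sq_nonneg (y 0)]
  have hstep : ∀ (u y : ℕ → ℝ), (∀ i, |u i| ≤ 1) → (∀ i, y (i + 1) = qm a (y i) + α * u i) →
      ∀ i, |y (i + 1 + 1) - qm a (y (i + 1))| ≤ α := by
    intro u y hu hy i
    rw [hy (i + 1), add_sub_cancel_left, abs_mul, abs_of_pos hα]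
    exact mul_le_of_le_one_right hα.le (hu _)
  have hQ := hcl α hα (fun i => y (i + 1)) (fun i => y' (i + 1)) (hstart u y (hu 0) hy hy0)
    (hstart u' y' (hu' 0) hy' hy0') (hstep u y hu hy) (hstep u' y' hu' hy')
  have hle : ∀ k ≤ n, lam ^ k * (5 * α) ≤ δ₁ := fun k hk => by
    have : lam ^ k ≤ lam ^ (n + 1) := pow_le_pow_right₀ hl.le (by omega)
    exact (mul_le_mul_of_nonneg_right this (by positivity)).trans (hN1.trans hδδ)
  set m : ℕ → ℝ := fun i => -(y (i + 1) + y' (i + 1)) with hm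
  set Q : ℕ → ℝ := fun k => ∏ i ∈ Finset.range k, m i with hQdef
  have hQn := (hQ n (hle n le_rfl)).2
  have hQn0 : 0 < |Q n| := lt_of_lt_of_le (by positivity) hQn
  have hm0 : ∀ i < n, m i ≠ 0 := fun i hi =>
    Finset.prod_ne_zero_iff.1 (abs_pos.1 hQn0) i (Finset.mem_range.2 hi)
  set v : ℕ → ℝ := fun i => y (i + 1) - y' (i + 1) with hv
  set Δ : ℕ → ℝ := fun i => u i - u' i with hΔ
  have hΔ2 : ∀ i, |Δ i| ≤ 2 := fun i => (abs_sub _ _).trans (by linarith [hu i, hu' i])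
  have hrec := div_prod_recursion (m := m) (b := fun i => α * Δ (i + 1)) (v := v)
    (fun k => by simp only [hv, hm, hΔ]; rw [hy (k + 1), hy' (k + 1), qm, qm]; ring) n hm0
  set w := critWeight a
  have hws := summable_critWeight hg
  have hsum : ∀ u : ℕ → ℝ, (∀ i, |u i| ≤ 1) → Summable fun k => w k * u k := fun u hu =>
    Summable.of_norm_bounded hws fun k => by
      rw [norm_mul]
      exact mul_le_of_le_one_right (norm_nonneg _) (hu _)
  have hT : ∑' k, w k * u k - ∑' k, w k * u' k = ∑' k, w k * Δ k := by
    rw [← (hsum u hu).tsum_sub (hsum u' hu')]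
    exact tsum_congr fun k => by simp only [hΔ]; ring
  have hsΔ : Summable fun k => w k * Δ k := by
    refine ((hsum u hu).sub (hsum u' hu')).congr fun k => ?_
    simp only [hΔ]; ring
  rw [hT]
  set T := ∑' k, w k * Δ k
  have htail : |∑' k, w (k + (n + 1)) * Δ (k + (n + 1))| ≤
      2 / (c * (lam - 1)) * (5 * lam ^ 2 / δ₀) * √δ₀ * √α := by
    have hgs : HasSum (fun k => 2 / (c * lam ^ (n + 1)) * (1 / lam) ^ k)
        (2 / (c * lam ^ (n + 1)) * (1 - 1 / lam)⁻¹) :=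
      (hasSum_geometric_of_lt_one (by positivity) (by rw [div_lt_one hl0]; exact hl)).mul_left _
    have h1 : |∑' k, w (k + (n + 1)) * Δ (k + (n + 1))| ≤ 2 / (c * lam ^ (n + 1)) * (1 - 1 / lam)⁻¹ := by
      refine tsum_of_norm_bounded (f := fun k => w (k + (n + 1)) * Δ (k + (n + 1))) hgs fun k => ?_
      rw [norm_mul]
      calc _ ≤ (1 / c * (1 / lam) ^ (k + (n + 1))) * 2 :=
            mul_le_mul (abs_critWeight_le hg _) (hΔ2 _) (abs_nonneg _) (by positivity)
        _ = _ := by rw [pow_add, one_div_pow lam (n + 1)]; field_simp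
    have h2 : (1 - 1 / lam)⁻¹ = lam / (lam - 1) := by field_simp
    have h3 : 1 / lam ^ (n + 1) ≤ lam * (5 * α) / δ₀ := by
      rw [div_le_div_iff₀ (by positivity) hδ₀]
      have : lam ^ (n + 1 + 1) * (5 * α) = lam * (5 * α) * lam ^ (n + 1) := by ring
      linarith
    have h4 : √α ≤ √δ₀ := Real.sqrt_le_sqrt (by
      have : 1 ≤ lam ^ (n + 1) := one_le_pow₀ hl.le
      nlinarith)
    calc _ ≤ _ := h1
      _ = 2 * lam / (c * (lam - 1)) * (1 / lam ^ (n + 1)) := by rw [h2]; field_simp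
      _ ≤ 2 * lam / (c * (lam - 1)) * (lam * (5 * α) / δ₀) := by gcongr
      _ = 2 / (c * (lam - 1)) * (5 * lam ^ 2 / δ₀) * (√α * √α) := by
          rw [← sq, hsq]; field_simp
      _ ≤ 2 / (c * (lam - 1)) * (5 * lam ^ 2 / δ₀) * (√δ₀ * √α) := by gcongr
      _ = _ := by ring
  have hNα : ((n + 1 : ℕ) : ℝ) * α ≤ √δ₀ / (√5 * (√lam - 1)) * √α := by
    have h1 : ((n + 1 : ℕ) : ℝ) * (√lam - 1) ≤ √lam ^ (n + 1) := by
      have := one_add_mul_le_pow (a := √lam - 1) (by linarith) (n + 1)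
      rw [add_sub_cancel] at this
      linarith
    have h2 : √lam ^ (n + 1) * (√5 * √α) ≤ √δ₀ := by
      refine Real.le_sqrt_of_sq_le ?_
      rw [mul_pow, mul_pow, ← pow_mul, mul_comm (n + 1) 2, pow_mul, Real.sq_sqrt hl0.le,
        Real.sq_sqrt (by norm_num), hsq]
      exact hN1
    have h3 : ((n + 1 : ℕ) : ℝ) * (√lam - 1) * (√5 * √α) ≤ √δ₀ :=
      (mul_le_mul_of_nonneg_right h1 (by positivity)).trans h2
    have h4 : ((n + 1 : ℕ) : ℝ) * √α ≤ √δ₀ / (√5 * (√lam - 1)) := by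
      rw [le_div_iff₀ (by positivity)]
      linarith
    calc _ = ((n + 1 : ℕ) : ℝ) * √α * √α := by rw [mul_assoc, ← sq, hsq]
      _ ≤ _ := by gcongr
  have hmain : |v n / Q n - α * T| ≤ α * ((4 * A + 2 * L₁ * (√δ₀ / (√5 * (√lam - 1))) +
      2 / (c * (lam - 1)) * (5 * lam ^ 2 / δ₀) * √δ₀) * √α) := by
    have e1 : v n / Q n = -(y 0 ^ 2 - y' 0 ^ 2) +
        α * ∑ j ∈ Finset.range (n + 1), Δ j * (1 / Q j) := by
      rw [hrec, Finset.sum_range_succ', mul_add, Finset.mul_sum]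
      have e2 : v 0 = -(y 0 ^ 2 - y' 0 ^ 2) + α * Δ 0 := by
        simp only [hv, hΔ]; rw [hy, hy', qm, qm]; ring
      rw [e2]
      have e3 : Q 0 = 1 := by simp [hQdef]
      have e4 : ∑ j ∈ Finset.range n, α * Δ (j + 1) / ∏ i ∈ Finset.range (j + 1), m i =
          ∑ j ∈ Finset.range n, α * (Δ (j + 1) * (1 / Q (j + 1))) :=
        Finset.sum_congr rfl fun j _ => by rw [hQdef]; ring
      rw [e3, e4]
      ring
    have e5 : T = ∑ j ∈ Finset.range (n + 1), w j * Δ j +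
        ∑' k, w (k + (n + 1)) * Δ (k + (n + 1)) := (hsΔ.sum_add_tsum_nat_add (n + 1)).symm
    have e6 : v n / Q n - α * T = -(y 0 ^ 2 - y' 0 ^ 2) +
        α * ∑ j ∈ Finset.range (n + 1), Δ j * (1 / Q j - w j) -
        α * ∑' k, w (k + (n + 1)) * Δ (k + (n + 1)) := by
      rw [e1, e5]
      simp only [mul_sub, Finset.sum_sub_distrib]
      have : ∑ j ∈ Finset.range (n + 1), w j * Δ j = ∑ j ∈ Finset.range (n + 1), Δ j * w j :=
        Finset.sum_congr rfl fun j _ => mul_comm _ _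
      rw [this]
      ring
    have b1 : |-(y 0 ^ 2 - y' 0 ^ 2)| ≤ α * (4 * A * √α) := by
      rw [abs_neg, sq_sub_sq, abs_mul]
      calc _ ≤ (4 * √α) * (A * α) :=
            mul_le_mul ((abs_add_le _ _).trans (by linarith)) hyy (abs_nonneg _) (by positivity)
        _ = _ := by ring
    have b2 : |∑ j ∈ Finset.range (n + 1), Δ j * (1 / Q j - w j)| ≤
        2 * L₁ * (√δ₀ / (√5 * (√lam - 1)) * √α) := by
      calc _ ≤ ∑ j ∈ Finset.range (n + 1), 2 * (L₁ * α) := by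
            refine (Finset.abs_sum_le_sum_abs _ _).trans (Finset.sum_le_sum fun j hj => ?_)
            rw [abs_mul]
            have hj' := Finset.mem_range.1 hj
            exact mul_le_mul (hΔ2 j) (hQ j (hle j (by omega))).1 (abs_nonneg _) (by norm_num)
        _ = 2 * L₁ * (((n + 1 : ℕ) : ℝ) * α) := by
            rw [Finset.sum_const, Finset.card_range, nsmul_eq_mul]; ring
        _ ≤ _ := by gcongr
    rw [e6]
    refine (abs_sub _ _).trans ((add_le_add (abs_add_le _ _) le_rfl).trans ?_)
    rw [abs_mul, abs_mul, abs_of_pos hα]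
    have b3 := mul_le_mul_of_nonneg_left b2 hα.le
    have b4 := mul_le_mul_of_nonneg_left htail hα.le
    linarith
  set L := 4 * A + 2 * L₁ * (√δ₀ / (√5 * (√lam - 1))) +
      2 / (c * (lam - 1)) * (5 * lam ^ 2 / δ₀) * √δ₀
  change c * δ₀ / (10 * lam ^ 2) * (|T| - L * √α) ≤ |v n|
  rcases le_total (|T| - L * √α) 0 with hneg | hpos
  · exact (mul_nonpos_of_nonneg_of_nonpos (by positivity) hneg).trans (abs_nonneg _)
  · have c1 : α * (|T| - L * √α) ≤ |v n / Q n| := by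
      have := abs_sub_abs_le_abs_sub (α * T) (v n / Q n)
      rw [abs_sub_comm, abs_mul α, abs_of_pos hα] at this
      linarith
    rw [abs_div, le_div_iff₀ hQn0] at c1
    refine le_trans ?_ c1
    have c2 : δ₀ / (5 * lam ^ 2) ≤ α * lam ^ n := by
      rw [div_le_iff₀ (by positivity)]
      have : lam ^ (n + 1 + 1) * (5 * α) = α * lam ^ n * (5 * lam ^ 2) := by ring
      linarith
    calc _ = (δ₀ / (5 * lam ^ 2)) * (c / 2) * (|T| - L * √α) := by field_simp; ring
      _ ≤ α * lam ^ n * (c / 2) * (|T| - L * √α) := by gcongr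
      _ = α * (|T| - L * √α) * (c * lam ^ n / 2) := by ring
      _ ≤ _ := by gcongr

end Misiurewicz

/-- The points that fall near `0` in bounded time are close to a finite set. -/
lemma exists_finset_near_preimages_zero (a : ℝ) (m₀ : ℕ) : ∃ Z : Finset ℝ, ∀ r > 0, ∃ η > 0,
    ∀ y, ∀ j < m₀, |orb a y j| ≤ η → ∃ z ∈ Z, |y - z| ≤ r := by
  classical
  induction m₀ with
  | zero => exact ⟨∅, fun r _ => ⟨1, one_pos, fun y j hj => by omega⟩⟩
  | succ m₀ ih =>
    obtain ⟨Z, hZ⟩ := ih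
    refine ⟨insert 0 (Z.image (fun z => √(a - z)) ∪ Z.image fun z => -√(a - z)), fun r hr => ?_⟩
    obtain ⟨η, hη, hηZ⟩ := hZ (r ^ 2) (by positivity)
    refine ⟨min η r, by positivity, fun y j hj hy => ?_⟩
    rcases j with _ | j
    · exact ⟨0, Finset.mem_insert_self _ _, by
        rw [orb_zero] at hy; simpa using hy.trans (min_le_right _ _)⟩
    · rw [add_comm, orb_add, show orb a y 1 = qm a y from rfl] at hy
      obtain ⟨z, hz, hyz⟩ := hηZ (qm a y) j (by omega) (hy.trans (min_le_left _ _))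
      have hs : |(|y|) - √(a - z)| ≤ r := by
        set s := √(a - z) with hs
        have hs0 : 0 ≤ s := Real.sqrt_nonneg _
        have hy0 := abs_nonneg y
        have hyy : |y| ^ 2 = y ^ 2 := sq_abs y
        rw [qm] at hyz
        have hyz' := abs_le.1 hyz
        rw [abs_le]
        rcases le_total 0 (a - z) with h0 | h0
        · have hss : s ^ 2 = a - z := Real.sq_sqrt h0
          constructor
          · by_contra hcon
            nlinarith
          · by_contra hcon
            nlinarith
        · have hss : s = 0 := Real.sqrt_eq_zero_of_nonpos h0
          rw [hss]
          constructor
          · linarith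
          · by_contra hcon
            nlinarith
      rcases abs_choice y with hc | hc
      · exact ⟨√(a - z), Finset.mem_insert_of_mem (Finset.mem_union_left _
          (Finset.mem_image_of_mem _ hz)), by rwa [hc] at hs⟩
      · refine ⟨-√(a - z), Finset.mem_insert_of_mem (Finset.mem_union_right _
          (Finset.mem_image_of_mem _ hz)), ?_⟩
        rw [hc] at hs
        rwa [sub_neg_eq_add, ← abs_neg, neg_add']

namespace Misiurewicz

variable {a P : ℝ} (h : Misiurewicz a P) {lam c C : ℝ}

include h in
lemma abs_fn_sub_orb_le {d : ℕ} {φ : ℝ → ℝ} {β C' R α : ℝ} (hβ : β < P)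
    (hD : Dominated a d φ β C' R α) (hφb : ∀ θ, |φ θ| ≤ 1) {y : ℝ} (hy : y ∈ Icc (-β) β) (θ : ℝ)
    (j : ℕ) : |fn a d φ α j θ y - orb a y j| ≤ α * 5 ^ j := by
  have hα := hD.pos
  induction j with
  | zero => simp only [fn_zero, orb_zero, sub_self, abs_zero]; positivity
  | succ j ih =>
    rw [fn_succ, orb_succ, qm, qm]
    have h1 : |fn a d φ α j θ y| ≤ 2 := by
      have := abs_le.2 (hD.mem j θ y hy)
      linarith [h.P_lt_two]
    have h2 : |orb a y j| ≤ 2 := h.abs_orb_le ⟨by linarith [hy.1], by linarith [hy.2]⟩ j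
    have e : a - fn a d φ α j θ y ^ 2 + α * φ ((d : ℝ) ^ j * θ) - (a - orb a y j ^ 2) =
        -((fn a d φ α j θ y + orb a y j) * (fn a d φ α j θ y - orb a y j)) +
          α * φ ((d : ℝ) ^ j * θ) := by ring
    rw [e]
    refine (abs_add_le _ _).trans ?_
    rw [abs_neg, abs_mul, abs_mul, abs_of_pos hα]
    have a1 := (abs_add_le (fn a d φ α j θ y) (orb a y j)).trans (add_le_add h1 h2)
    have a2 := mul_le_mul a1 ih (abs_nonneg _) (by norm_num)
    have a3 : α * |φ ((d : ℝ) ^ j * θ)| ≤ α := mul_le_of_le_one_right hα.le (hφb _)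
    have a4 : α ≤ α * 5 ^ j := le_mul_of_one_le_right hα.le (one_le_pow₀ (by norm_num))
    rw [pow_succ]
    linarith

include h in
/-- After a visit near the critical point and its bound period, an immediate new visit is
unlikely. -/
lemma exists_close_return_bound (hg : Growth a lam c C) {d : ℕ} {φ : ℝ → ℝ} (hd : 2 ≤ d)
    (hφa : ∀ x, AnalyticAt ℝ φ x) (hφp : Function.Periodic φ 1) (hφnc : ∃ s t, φ s ≠ φ t)
    (hφb : ∀ θ, |φ θ| ≤ 1) {β : ℝ} (hβ : β < P) : ∃ δ₁ > 0, ∀ δ₀ > 0, δ₀ ≤ δ₁ → ∀ A ≥ 0,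
    ∀ (m₀ : ℕ) (ε : ℝ), 0 < ε → ∃ α₁ > 0, ∀ C' R α, Dominated a d φ β C' R α → α ≤ α₁ → ∀ N,
      lam ^ N * (5 * α) ≤ δ₀ → δ₀ < lam ^ (N + 1) * (5 * α) → ∀ Y : ℝ → ℝ,
        (∀ t, Y t ∈ Icc (-β) β) → (∀ t ∈ Ico (0 : ℝ) 1, |Y t| ≤ 2 * √α) →
        (∀ t t', |Y t - Y t'| ≤ A * α * |t - t'|) →
        volume {θ ∈ Ico (0 : ℝ) 1 | ∃ m < m₀, |fn a d φ α (N + m) θ (Y θ)| < 2 * √α} ≤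
          ENNReal.ofReal ε := by
  obtain ⟨δ₁, hδ₁, hdiff⟩ := h.difference_bound hg
  refine ⟨δ₁, hδ₁, fun δ₀ hδ₀ hδδ A hA m₀ ε hε => ?_⟩
  obtain ⟨κ, hκ, L, hL, hκL⟩ := hdiff δ₀ hδ₀ hδδ A hA
  obtain ⟨Z, hZ⟩ := exists_finset_near_preimages_zero a m₀
  have hl := hg.one_lt
  have hl0 : 0 < lam := by linarith
  have hw := summable_critWeight hg
  obtain ⟨ρ, hρ, hρG⟩ := exists_volume_lacunary_near_le hd hφa hφp hφnc hφb hw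
    (by simp [critWeight]) (ε := ENNReal.ofReal (ε / (Z.card + 1))) (by
      rw [ENNReal.ofReal_pos]; positivity)
  obtain ⟨η, hη, hηZ⟩ := hZ (κ * ρ / 8) (by positivity)
  refine ⟨min (min ((η / 4) ^ 2) (η / (2 * 5 ^ m₀))) (min ((ρ / (2 * L)) ^ 2) (δ₀ / (5 * lam))),
    by positivity, ?_⟩
  intro C' R α hD hα N hN1 hN2 Y hYβ hY0 hYL
  have hα0 := hD.pos
  have hα1 := hα.trans ((min_le_left _ _).trans (min_le_left _ _))
  have hα2 := hα.trans ((min_le_left _ _).trans (min_le_right _ _))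
  have hα3 := hα.trans ((min_le_right _ _).trans (min_le_left _ _))
  have hα4 := hα.trans ((min_le_right _ _).trans (min_le_right _ _))
  have hs1 : √α ≤ η / 4 := Real.sqrt_le_iff.2 ⟨by positivity, hα1⟩
  have hs3 : √α ≤ ρ / (2 * L) := Real.sqrt_le_iff.2 ⟨by positivity, hα3⟩
  have hN : 1 ≤ N := by
    rcases Nat.eq_zero_or_pos N with rfl | hN
    · rw [le_div_iff₀ (by positivity)] at hα4
      rw [zero_add, pow_one] at hN2
      linarith
    · exact hN
  set S : ℝ → Set ℝ := fun z => {θ ∈ Ico (0 : ℝ) 1 | |fn a d φ α N θ (Y θ) - z| ≤ κ * ρ / 8}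
  have hsub : {θ ∈ Ico (0 : ℝ) 1 | ∃ m < m₀, |fn a d φ α (N + m) θ (Y θ)| < 2 * √α} ⊆
      ⋃ z ∈ Z, S z := by
    rintro θ ⟨hθ, m, hm, hlt⟩
    rw [fn_add] at hlt
    have a1 := h.abs_fn_sub_orb_le hβ hD hφb (hD.mem N θ _ (hYβ θ)) ((d : ℝ) ^ N * θ) m
    have a2 : α * 5 ^ m ≤ η / 2 := by
      rw [le_div_iff₀ (by positivity)] at hα2
      have : (5 : ℝ) ^ m ≤ 5 ^ m₀ := pow_le_pow_right₀ (by norm_num) hm.le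
      nlinarith
    have a3 : |orb a (fn a d φ α N θ (Y θ)) m| ≤ η := by
      have := abs_sub_abs_le_abs_sub (orb a (fn a d φ α N θ (Y θ)) m)
        (fn a d φ α m ((d : ℝ) ^ N * θ) (fn a d φ α N θ (Y θ)))
      rw [abs_sub_comm] at this
      linarith
    obtain ⟨z, hz, hyz⟩ := hηZ _ m hm a3
    exact mem_iUnion₂.2 ⟨z, hz, hθ, hyz⟩
  have hS : ∀ z, volume (S z) ≤ ENNReal.ofReal (ε / (Z.card + 1)) := by
    intro z
    rcases (S z).eq_empty_or_nonempty with he | ⟨θ₀, hθ₀⟩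
    · rw [he, measure_empty]; exact bot_le
    · refine le_trans (measure_mono fun θ hθ => And.intro (Ico_subset_Icc_self hθ.1) ?_)
        (hρG (lacunary d φ (critWeight a) θ₀))
      have b1 := hκL α hα0 N hN hN1 hN2 (fun i => φ ((d : ℝ) ^ i * θ)) (fun i => φ ((d : ℝ) ^ i * θ₀))
        (fun i => fn a d φ α i θ (Y θ)) (fun i => fn a d φ α i θ₀ (Y θ₀)) (fun i => hφb _)
        (fun i => hφb _) (fun i => fn_succ a d φ α i θ (Y θ)) (fun i => fn_succ a d φ α i θ₀ (Y θ₀))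
        (by simpa only [fn_zero] using hY0 θ hθ.1) (by simpa only [fn_zero] using hY0 θ₀ hθ₀.1) (by
          simp only [fn_zero]
          refine (hYL θ θ₀).trans (mul_le_of_le_one_right (by positivity) ?_)
          rw [abs_le]
          constructor <;> linarith [hθ.1.1, hθ.1.2, hθ₀.1.1, hθ₀.1.2])
      have b2 : |fn a d φ α N θ (Y θ) - fn a d φ α N θ₀ (Y θ₀)| ≤ κ * ρ / 4 := by
        have c1 := abs_le.1 hθ.2
        have c2 := abs_le.1 hθ₀.2
        rw [abs_le]
        constructor <;> linarith
      have b3 : |lacunary d φ (critWeight a) θ - lacunary d φ (critWeight a) θ₀| - L * √α ≤ ρ / 4 := by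
        have := b1.trans b2
        rw [show κ * ρ / 4 = κ * (ρ / 4) by ring] at this
        exact le_of_mul_le_mul_left this hκ
      have b4 : L * √α ≤ ρ / 2 := by
        rw [le_div_iff₀ (by positivity)] at hs3
        linarith
      show |lacunary d φ (critWeight a) θ - lacunary d φ (critWeight a) θ₀| < ρ
      linarith
  calc _ ≤ volume (⋃ z ∈ Z, S z) := measure_mono hsub
    _ ≤ ∑ z ∈ Z, volume (S z) := measure_biUnion_finset_le _ _
    _ ≤ ∑ z ∈ Z, ENNReal.ofReal (ε / (Z.card + 1)) := Finset.sum_le_sum fun z _ => hS z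
    _ = ENNReal.ofReal (Z.card * (ε / (Z.card + 1))) := by
        rw [Finset.sum_const, nsmul_eq_mul, ENNReal.ofReal_mul (by positivity), ENNReal.ofReal_natCast]
    _ ≤ ENNReal.ofReal ε := by
        refine ENNReal.ofReal_le_ofReal ?_
        rw [mul_div_assoc', div_le_iff₀ (by positivity)]
        nlinarith

end Misiurewicz

/-- `F` only depends on the `d`-adic interval of level `i`. -/
def LevelConst {γ : Type*} (d i : ℕ) (F : ℝ → γ) : Prop :=
  ∀ θ θ' : ℝ, ⌊(d : ℝ) ^ i * θ⌋ = ⌊(d : ℝ) ^ i * θ'⌋ → F θ = F θ'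

section LevelConst

variable {γ : Type*} {d i : ℕ}

lemma floor_level_eq_of_le (hd : 0 < d) {i j : ℕ} (hij : i ≤ j) {θ θ' : ℝ}
    (h : ⌊(d : ℝ) ^ j * θ⌋ = ⌊(d : ℝ) ^ j * θ'⌋) : ⌊(d : ℝ) ^ i * θ⌋ = ⌊(d : ℝ) ^ i * θ'⌋ := by
  have hd' : (d : ℝ) ≠ 0 := by positivity
  have e : ∀ t : ℝ, (d : ℝ) ^ i * t = (d : ℝ) ^ j * t / ((d ^ (j - i) : ℕ) : ℝ) := fun t => by
    push_cast
    rw [eq_div_iff (by positivity), ← Nat.sub_add_cancel hij, pow_add]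
    simp only [Nat.add_sub_cancel]
    ring
  rw [e, e, Int.floor_div_natCast, Int.floor_div_natCast, h]

lemma LevelConst.mono (hd : 0 < d) {j : ℕ} (hij : i ≤ j) {F : ℝ → γ} (h : LevelConst d i F) :
    LevelConst d j F := fun _ _ he => h _ _ (floor_level_eq_of_le hd hij he)

lemma LevelConst.eq_comp (hd : 0 < d) {F : ℝ → γ} (h : LevelConst d i F) :
    F = (fun k : ℤ => F (k / (d : ℝ) ^ i)) ∘ fun θ => ⌊(d : ℝ) ^ i * θ⌋ := by
  funext θ
  have hd' : (d : ℝ) ^ i ≠ 0 := by positivity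
  refine h _ _ ?_
  rw [mul_div_cancel₀ _ hd', Int.floor_intCast]

lemma measurable_floor_level (d i : ℕ) : Measurable fun θ : ℝ => ⌊(d : ℝ) ^ i * θ⌋ :=
  Int.measurable_floor.comp (measurable_const.mul measurable_id)

lemma LevelConst.measurable [MeasurableSpace γ] (hd : 0 < d) {F : ℝ → γ} (h : LevelConst d i F) :
    Measurable F := by
  rw [h.eq_comp hd]
  exact measurable_from_top.comp (measurable_floor_level d i)

lemma LevelConst.measurableSet (hd : 0 < d) {A : Set ℝ} (h : LevelConst d i (· ∈ A)) :
    MeasurableSet A := by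
  have := h.measurable hd
  exact measurableSet_setOfPred.2 this

lemma LevelConst.indicator {M : Type*} [Zero M] {A : Set ℝ} (h : LevelConst d i (· ∈ A)) (c : M) :
    LevelConst d i (A.indicator fun _ => c) := fun θ θ' he => by
  have := h θ θ' he
  simp only [eq_iff_iff] at this
  by_cases hA : θ ∈ A
  · rw [indicator_of_mem hA, indicator_of_mem (this.1 hA)]
  · rw [indicator_of_notMem hA, indicator_of_notMem (fun hn => hA (this.2 hn))]

lemma setLIntegral_le_of_level (hd : 0 < d) {μ : Measure ℝ} {A V : Set ℝ} (hA : MeasurableSet A)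
    (hV : MeasurableSet V) {p : ℝ≥0∞}
    (h : ∀ k : ℤ, μ (A ∩ {θ | ⌊(d : ℝ) ^ i * θ⌋ = k}) ≤ p * μ (V ∩ {θ | ⌊(d : ℝ) ^ i * θ⌋ = k}))
    {F : ℝ → ℝ≥0∞} (hF : LevelConst d i F) : ∫⁻ θ in A, F θ ∂μ ≤ p * ∫⁻ θ in V, F θ ∂μ := by
  have key : ∀ B, MeasurableSet B → ∫⁻ θ in B, F θ ∂μ =
      ∑' k : ℤ, F (k / (d : ℝ) ^ i) * μ (B ∩ {θ | ⌊(d : ℝ) ^ i * θ⌋ = k}) := by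
    intro B hB
    conv_lhs => rw [hF.eq_comp hd]
    simp only [Function.comp_def]
    rw [← lintegral_map (f := fun k : ℤ => F (k / (d : ℝ) ^ i)) measurable_from_top
      (measurable_floor_level d i), lintegral_countable']
    refine tsum_congr fun k => ?_
    rw [Measure.map_apply (measurable_floor_level d i) (measurableSet_singleton k),
      Measure.restrict_apply (measurable_floor_level d i (measurableSet_singleton k)), inter_comm]
    rfl
  rw [key A hA, key V hV, ← ENNReal.tsum_mul_left]
  refine ENNReal.tsum_le_tsum fun k => ?_
  calc _ ≤ F (k / (d : ℝ) ^ i) * (p * μ (V ∩ {θ | ⌊(d : ℝ) ^ i * θ⌋ = k})) := by gcongr; exact h k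
    _ = _ := by ring

end LevelConst

lemma posPart_sq_step {s p a v : ℝ} (hp : 0 ≤ p) (ha : a = 0 ∨ a = 1) (hv : v = 0 ∨ v = 1) :
    max (s + (a - p * v)) 0 ^ 2 + 2 * p * (max s 0 * v) ≤
      max s 0 ^ 2 + 2 * (max s 0 * a) + a + p ^ 2 * v := by
  have h1 : max (s + (a - p * v)) 0 ^ 2 ≤ (max s 0 + (a - p * v)) ^ 2 := by
    rcases le_total 0 s with hs | hs
    · rw [max_eq_left hs]
      rcases le_total 0 (s + (a - p * v)) with h | h
      · rw [max_eq_left h]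
      · rw [max_eq_right h, zero_pow two_ne_zero]; positivity
    · rw [max_eq_right hs, zero_add]
      rcases le_total 0 (s + (a - p * v)) with h | h
      · rw [max_eq_left h]; exact pow_le_pow_left₀ h (by linarith) 2
      · rw [max_eq_right h, zero_pow two_ne_zero]; positivity
  rcases ha with rfl | rfl <;> rcases hv with rfl | rfl <;> nlinarith

lemma lintegral_posPart_sq_le {d : ℕ} (hd : 0 < d) {μ : Measure ℝ} (hμ : μ univ ≤ 1) {ℓ : ℕ → ℕ}
    (hℓ : Monotone ℓ) {A V : ℕ → Set ℝ} (hV : ∀ j, LevelConst d (ℓ j) (· ∈ V j))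
    (hA : ∀ j, LevelConst d (ℓ (j + 1)) (· ∈ A j)) {p : ℝ} (hp : 0 ≤ p)
    (h : ∀ j, ∀ k : ℤ, μ (A j ∩ {θ | ⌊(d : ℝ) ^ ℓ j * θ⌋ = k}) ≤
      ENNReal.ofReal p * μ (V j ∩ {θ | ⌊(d : ℝ) ^ ℓ j * θ⌋ = k})) (n : ℕ) :
    ∫⁻ θ, ENNReal.ofReal (max (∑ j ∈ Finset.range n, ((A j).indicator (fun _ => (1 : ℝ)) θ -
      p * (V j).indicator (fun _ => 1) θ)) 0 ^ 2) ∂μ ≤ n * ENNReal.ofReal (p + p ^ 2) := by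
  set S : ℕ → ℝ → ℝ := fun n θ => ∑ j ∈ Finset.range n, ((A j).indicator (fun _ => (1 : ℝ)) θ -
      p * (V j).indicator (fun _ => 1) θ) with hS
  have hSlev : ∀ n, LevelConst d (ℓ n) (S n) := fun n θ θ' he => by
    refine Finset.sum_congr rfl fun j hj => ?_
    have hj := Finset.mem_range.1 hj
    rw [((hV j).mono hd (hℓ hj.le)).indicator (1 : ℝ) θ θ' he,
      ((hA j).mono hd (hℓ (Nat.succ_le_of_lt hj))).indicator (1 : ℝ) θ θ' he]
  have hind : ∀ (B : Set ℝ) θ, B.indicator (fun _ => (1 : ℝ)) θ = 0 ∨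
      B.indicator (fun _ => (1 : ℝ)) θ = 1 := fun B θ => by
    by_cases hB : θ ∈ B
    · exact Or.inr (indicator_of_mem hB _)
    · exact Or.inl (indicator_of_notMem hB _)
  have hofReal : ∀ (B : Set ℝ) (g : ℝ → ℝ) θ, B.indicator (fun θ => ENNReal.ofReal (g θ)) θ =
      ENNReal.ofReal (g θ * B.indicator (fun _ => (1 : ℝ)) θ) := fun B g θ => by
    by_cases hB : θ ∈ B
    · rw [indicator_of_mem hB, indicator_of_mem hB, mul_one]
    · rw [indicator_of_notMem hB, indicator_of_notMem hB, mul_zero, ENNReal.ofReal_zero]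
  have hSn : ∀ n θ, S n θ ≤ n := fun n θ => by
    calc S n θ ≤ ∑ j ∈ Finset.range n, (1 : ℝ) := Finset.sum_le_sum fun j _ => by
          have h1 := hind (A j) θ
          have h2 := hind (V j) θ
          rcases h1 with h1 | h1 <;> rcases h2 with h2 | h2 <;> rw [h1, h2] <;> linarith
      _ = n := by simp
  have hAm := fun j => (hA j).measurableSet hd
  have hVm := fun j => (hV j).measurableSet hd
  induction n with
  | zero => simp
  | succ n ih =>
    have hμA : μ (A n) ≤ ENNReal.ofReal p := by
      have := setLIntegral_le_of_level hd (hAm n) (hVm n) (h n) (F := fun _ => 1)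
        (fun _ _ _ => rfl)
      simp only [lintegral_const, Measure.restrict_apply_univ, one_mul] at this
      exact this.trans (mul_le_of_le_one_right bot_le ((measure_mono (subset_univ _)).trans hμ))
    have hμV : μ (V n) ≤ 1 := (measure_mono (subset_univ _)).trans hμ
    have hstep := setLIntegral_le_of_level hd (hAm n) (hVm n) (h n)
      (F := fun θ => ENNReal.ofReal (2 * max (S n θ) 0))
      (fun θ θ' he => by simp only [hSlev n θ θ' he])
    have hSm : Measurable (S n) := (hSlev n).measurable hd
    have hSm' : Measurable (S (n + 1)) := (hSlev (n + 1)).measurable hd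
    have hfin : ∫⁻ θ in V n, ENNReal.ofReal (2 * max (S n θ) 0) ∂μ ≠ ⊤ := by
      refine ne_top_of_le_ne_top (b := ENNReal.ofReal (2 * n)) ENNReal.ofReal_ne_top ?_
      calc _ ≤ ∫⁻ θ in V n, ENNReal.ofReal (2 * n) ∂μ := lintegral_mono fun θ =>
            ENNReal.ofReal_le_ofReal (by
              have := max_le (hSn n θ) (Nat.cast_nonneg n)
              linarith)
        _ ≤ _ := by
          rw [lintegral_const, Measure.restrict_apply_univ]
          exact mul_le_of_le_one_right bot_le hμV
    have hpt : ∫⁻ θ, (ENNReal.ofReal (max (S (n + 1) θ) 0 ^ 2) + ENNReal.ofReal p *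
          (V n).indicator (fun θ => ENNReal.ofReal (2 * max (S n θ) 0)) θ) ∂μ ≤
        ∫⁻ θ, (ENNReal.ofReal (max (S n θ) 0 ^ 2) +
          (A n).indicator (fun θ => ENNReal.ofReal (2 * max (S n θ) 0)) θ +
          (A n).indicator (fun _ => ENNReal.ofReal 1) θ +
          (V n).indicator (fun _ => ENNReal.ofReal (p ^ 2)) θ)
          ∂μ := by
      refine lintegral_mono fun θ => ?_
      have hb := posPart_sq_step (s := S n θ) hp (hind (A n) θ) (hind (V n) θ)
      have h0 : 0 ≤ max (S n θ) 0 := le_max_right _ _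
      have hA0 : 0 ≤ (A n).indicator (fun _ => (1 : ℝ)) θ := indicator_nonneg (by simp) _
      have hV0 : 0 ≤ (V n).indicator (fun _ => (1 : ℝ)) θ := indicator_nonneg (by simp) _
      have hSs : S (n + 1) θ = S n θ + ((A n).indicator (fun _ => (1 : ℝ)) θ -
        p * (V n).indicator (fun _ => 1) θ) := Finset.sum_range_succ _ _
      rw [← hSs] at hb
      beta_reduce
      simp only [hofReal (V n) (fun θ => 2 * max (S n θ) 0),
        hofReal (A n) (fun θ => 2 * max (S n θ) 0), hofReal (A n) (fun _ => 1),
        hofReal (V n) (fun _ => p ^ 2)]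
      rw [← ENNReal.ofReal_mul hp, ← ENNReal.ofReal_add (by positivity) (by positivity),
        ← ENNReal.ofReal_add (by positivity) (by positivity),
        ← ENNReal.ofReal_add (by positivity) (by positivity),
        ← ENNReal.ofReal_add (by positivity) (by positivity)]
      refine ENNReal.ofReal_le_ofReal ?_
      linarith
    have hmS : Measurable fun θ => ENNReal.ofReal (2 * max (S n θ) 0) := by fun_prop
    rw [lintegral_add_left (by fun_prop), lintegral_add_right _ (measurable_const.indicator (hVm n)),
      lintegral_add_right _ (measurable_const.indicator (hAm n)),
      lintegral_add_right _ (hmS.indicator (hAm n)),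
      lintegral_const_mul _ (hmS.indicator (hVm n)), lintegral_indicator (hVm n),
      lintegral_indicator (hAm n), lintegral_indicator (hAm n), lintegral_indicator (hVm n),
      lintegral_const, lintegral_const, Measure.restrict_apply_univ,
      Measure.restrict_apply_univ, ENNReal.ofReal_one, one_mul] at hpt
    have hfin' : ENNReal.ofReal p * ∫⁻ θ in V n, ENNReal.ofReal (2 * max (S n θ) 0) ∂μ ≠ ⊤ :=
      ENNReal.mul_ne_top ENNReal.ofReal_ne_top hfin
    refine (ENNReal.add_le_add_iff_right hfin').1 (hpt.trans ?_)
    rw [ENNReal.ofReal_add hp (by positivity)]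
    calc _ ≤ n * (ENNReal.ofReal p + ENNReal.ofReal (p ^ 2)) +
          ENNReal.ofReal p * ∫⁻ θ in V n, ENNReal.ofReal (2 * max (S n θ) 0) ∂μ +
          ENNReal.ofReal p + ENNReal.ofReal (p ^ 2) := by
          rw [← ENNReal.ofReal_add hp (by positivity)]
          gcongr
          exact mul_le_of_le_one_right bot_le hμV
      _ = _ := by push_cast; ring

lemma sum_range_residues {M : Type*} [AddCommMonoid M] (f : ℕ → M) (m n : ℕ) :
    ∑ r ∈ Finset.range m, ∑ j ∈ Finset.range n, f (r + m * j) =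
      ∑ i ∈ Finset.range (m * n), f i := by
  induction n with
  | zero => simp
  | succ n ih =>
    simp only [Finset.sum_range_succ, Finset.sum_add_distrib, ih]
    rw [Nat.mul_succ, Finset.sum_range_add]
    simp only [add_comm]

lemma measure_count_ge_le {d : ℕ} (hd : 0 < d) {μ : Measure ℝ} (hμ : μ univ ≤ 1) {m : ℕ}
    (hm : 0 < m) {A V : ℕ → Set ℝ} (hV : ∀ i, LevelConst d i (· ∈ V i))
    (hA : ∀ i, LevelConst d (i + m) (· ∈ A i)) {p w : ℝ} (hp : 0 ≤ p) (hw : 0 < w)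
    (h : ∀ i, ∀ k : ℤ, μ (A i ∩ {θ | ⌊(d : ℝ) ^ i * θ⌋ = k}) ≤
      ENNReal.ofReal p * μ (V i ∩ {θ | ⌊(d : ℝ) ^ i * θ⌋ = k})) {n : ℕ} (hn : 0 < n) :
    μ {θ | p * ∑ i ∈ Finset.range n, (V i).indicator (fun _ => (1 : ℝ)) θ + n * w ≤
      ∑ i ∈ Finset.range n, (A i).indicator (fun _ => (1 : ℝ)) θ} ≤
      ENNReal.ofReal ((p + p ^ 2) * m ^ 3 / w ^ 2 * (1 / n)) := by
  let A' : ℕ → Set ℝ := fun i => if i < n then A i else ∅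
  let V' : ℕ → Set ℝ := fun i => if i < n then V i else ∅
  have hA' : ∀ i, LevelConst d (i + m) (· ∈ A' i) := fun i => by
    by_cases hi : i < n
    · simpa only [A', if_pos hi] using hA i
    · simp only [A', if_neg hi]; exact fun _ _ _ => rfl
  have hV' : ∀ i, LevelConst d i (· ∈ V' i) := fun i => by
    by_cases hi : i < n
    · simpa only [V', if_pos hi] using hV i
    · simp only [V', if_neg hi]; exact fun _ _ _ => rfl
  have h' : ∀ i, ∀ k : ℤ, μ (A' i ∩ {θ | ⌊(d : ℝ) ^ i * θ⌋ = k}) ≤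
      ENNReal.ofReal p * μ (V' i ∩ {θ | ⌊(d : ℝ) ^ i * θ⌋ = k}) := fun i k => by
    by_cases hi : i < n
    · simpa only [A', V', if_pos hi] using h i k
    · simp [A', V', if_neg hi]
  set S : ℕ → ℝ → ℝ := fun r θ => ∑ j ∈ Finset.range n,
    ((A' (r + m * j)).indicator (fun _ => (1 : ℝ)) θ -
      p * (V' (r + m * j)).indicator (fun _ => 1) θ) with hS
  have hSint : ∀ r, ∫⁻ θ, ENNReal.ofReal (max (S r θ) 0 ^ 2) ∂μ ≤
      n * ENNReal.ofReal (p + p ^ 2) := fun r =>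
    lintegral_posPart_sq_le hd hμ (ℓ := fun j => r + m * j)
      (fun i j hij => by dsimp only; gcongr) (fun j => hV' _)
      (fun j => by
        have := hA' (r + m * j)
        rwa [add_assoc, ← Nat.mul_succ] at this) hp (fun j k => h' _ k) n
  have hm0 : (0 : ℝ) < m := by exact_mod_cast hm
  have hn0 : (0 : ℝ) < n := by exact_mod_cast hn
  have hmeas : ∀ r, Measurable fun θ => ENNReal.ofReal (max (S r θ) 0 ^ 2) := fun r => by
    have : Measurable (S r) := Finset.measurable_fun_sum _ fun j _ =>
      (measurable_const.indicator ((hA' _).measurableSet hd)).sub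
        (measurable_const.mul (measurable_const.indicator ((hV' _).measurableSet hd)))
    fun_prop
  have hr : ∀ r, μ {θ | ENNReal.ofReal ((n * w / m) ^ 2) ≤ ENNReal.ofReal (max (S r θ) 0 ^ 2)} ≤
      ENNReal.ofReal ((p + p ^ 2) * m ^ 2 / w ^ 2 * (1 / n)) := fun r => by
    refine (meas_ge_le_lintegral_div (hmeas r).aemeasurable
      (by positivity) ENNReal.ofReal_ne_top).trans ?_
    calc _ ≤ n * ENNReal.ofReal (p + p ^ 2) / ENNReal.ofReal ((n * w / m) ^ 2) := by
          gcongr; exact hSint r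
      _ = _ := by
        rw [← ENNReal.ofReal_natCast, ← ENNReal.ofReal_mul (by positivity),
          ← ENNReal.ofReal_div_of_pos (by positivity)]
        congr 1
        field_simp
  calc _ ≤ μ (⋃ r ∈ Finset.range m,
        {θ | ENNReal.ofReal ((n * w / m) ^ 2) ≤ ENNReal.ofReal (max (S r θ) 0 ^ 2)}) := by
        refine measure_mono fun θ hθ => ?_
        rw [Set.mem_ofPred_eq] at hθ
        have hsum : ∀ (B : ℕ → Set ℝ), ∑ i ∈ Finset.range n, (B i).indicator (fun _ => (1 : ℝ)) θ =
            ∑ i ∈ Finset.range (m * n),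
              (if i < n then B i else ∅).indicator (fun _ => (1 : ℝ)) θ := fun B => by
          rw [← Finset.sum_subset (Finset.range_subset_range.2 (Nat.le_mul_of_pos_left n hm))]
          · exact Finset.sum_congr rfl fun i hi => by rw [if_pos (Finset.mem_range.1 hi)]
          · intro i _ hi
            rw [if_neg (by simpa using hi), indicator_empty]
        have htot : n * w ≤ ∑ r ∈ Finset.range m, S r θ := by
          simp only [hS, Finset.sum_sub_distrib, ← Finset.mul_sum]
          rw [sum_range_residues (fun i => (A' i).indicator (fun _ => (1 : ℝ)) θ),
            sum_range_residues (fun i => (V' i).indicator (fun _ => (1 : ℝ)) θ), ← hsum, ← hsum]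
          linarith
        by_contra hcon
        simp only [mem_iUnion, not_exists, Set.mem_ofPred_eq, not_le] at hcon
        have : ∑ r ∈ Finset.range m, S r θ < ∑ r ∈ Finset.range m, n * w / m := by
          refine Finset.sum_lt_sum_of_nonempty ⟨0, Finset.mem_range.2 hm⟩ fun r hr => ?_
          have h1 := (ENNReal.ofReal_lt_ofReal_iff (by positivity)).1 (hcon r hr)
          exact (le_max_left _ _).trans_lt (lt_of_pow_lt_pow_left₀ 2 (by positivity) h1)
        rw [Finset.sum_const, Finset.card_range, nsmul_eq_mul, mul_div_cancel₀ _ hm0.ne'] at this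
        linarith
    _ ≤ ∑ r ∈ Finset.range m, ENNReal.ofReal ((p + p ^ 2) * m ^ 2 / w ^ 2 * (1 / n)) :=
        (measure_biUnion_finset_le _ _).trans (Finset.sum_le_sum fun r _ => hr r)
    _ = _ := by
        rw [Finset.sum_const, Finset.card_range, nsmul_eq_mul, ← ENNReal.ofReal_natCast,
          ← ENNReal.ofReal_mul hm0.le]
        congr 1
        ring

/-- Simultaneous upper bounds for visit counts to countably many families of rare events. -/
lemma ae_eventually_count_le {ι : Type*} [Countable ι] {d : ℕ} (hd : 0 < d) {μ : Measure ℝ}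
    (hμ : μ univ ≤ 1) {m : ι → ℕ} (hm : ∀ k, 0 < m k) {A : ι → ℕ → Set ℝ} {V : ℕ → Set ℝ}
    (hV : ∀ i, LevelConst d i (· ∈ V i)) (hA : ∀ k i, LevelConst d (i + m k) (· ∈ A k i))
    {p w : ι → ℝ} (hp : ∀ k, 0 ≤ p k) (hw : ∀ k, 0 < w k)
    (h : ∀ k i, ∀ l : ℤ, μ (A k i ∩ {θ | ⌊(d : ℝ) ^ i * θ⌋ = l}) ≤
      ENNReal.ofReal (p k) * μ (V i ∩ {θ | ⌊(d : ℝ) ^ i * θ⌋ = l}))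
    (hs : Summable fun k => (p k + p k ^ 2) * m k ^ 3 / w k ^ 2) :
    ∀ᵐ θ ∂μ, ∀ᶠ n : ℕ in atTop, ∀ k,
      ∑ i ∈ Finset.range n, (A k i).indicator (fun _ => (1 : ℝ)) θ ≤
        p k * ∑ i ∈ Finset.range (4 * n), (V i).indicator (fun _ => (1 : ℝ)) θ + 4 * n * w k := by
  set B : ℕ → Set ℝ := fun j => ⋃ k, {θ |
    p k * ∑ i ∈ Finset.range ((j + 1) ^ 2), (V i).indicator (fun _ => (1 : ℝ)) θ +
      ((j + 1) ^ 2 : ℕ) * w k ≤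
      ∑ i ∈ Finset.range ((j + 1) ^ 2), (A k i).indicator (fun _ => (1 : ℝ)) θ} with hB
  have hBμ : ∀ j, μ (B j) ≤ (∑' k, ENNReal.ofReal ((p k + p k ^ 2) * m k ^ 3 / w k ^ 2)) *
      ENNReal.ofReal (1 / ((j + 1 : ℕ) : ℝ) ^ 2) := fun j => by
    rw [← ENNReal.tsum_mul_right]
    refine (measure_iUnion_le _).trans (ENNReal.tsum_le_tsum fun k => ?_)
    have hpk := hp k
    have hwk := hw k
    rw [← ENNReal.ofReal_mul (by positivity)]
    refine (measure_count_ge_le hd hμ (hm k) hV (hA k) (hp k) (hw k) (h k)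
      (n := (j + 1) ^ 2) (by positivity)).trans (le_of_eq ?_)
    push_cast
    rfl
  have hBs : ∑' j, μ (B j) ≠ ⊤ := by
    refine ne_top_of_le_ne_top ?_ (ENNReal.tsum_le_tsum hBμ)
    rw [ENNReal.tsum_mul_left]
    refine ENNReal.mul_ne_top hs.tsum_ofReal_ne_top ?_
    exact Summable.tsum_ofReal_ne_top
      ((summable_nat_add_iff 1).2 (Real.summable_one_div_nat_pow.2 one_lt_two))
  filter_upwards [ae_eventually_notMem hBs] with θ hθ
  obtain ⟨J, hJ⟩ := eventually_atTop.1 hθ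
  refine eventually_atTop.2 ⟨(J + 1) ^ 2, fun n hn k => ?_⟩
  have hJn : J + 1 ≤ Nat.sqrt n := Nat.le_sqrt'.2 hn
  have h1 := hJ (Nat.sqrt n) (by omega)
  simp only [hB, mem_iUnion, not_exists, Set.mem_ofPred_eq, not_le] at h1
  have h1 := h1 k
  have hle : n ≤ (Nat.sqrt n + 1) ^ 2 := (Nat.lt_succ_sqrt' n).le
  have hle' : (Nat.sqrt n + 1) ^ 2 ≤ 4 * n := by
    have := Nat.sqrt_le' n
    nlinarith
  have hmono : ∀ (C : ℕ → Set ℝ) {a b : ℕ}, a ≤ b →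
      ∑ i ∈ Finset.range a, (C i).indicator (fun _ => (1 : ℝ)) θ ≤
      ∑ i ∈ Finset.range b, (C i).indicator (fun _ => (1 : ℝ)) θ := fun C a b hab =>
    Finset.sum_le_sum_of_subset_of_nonneg (Finset.range_subset_range.2 hab)
      fun i _ _ => indicator_nonneg (by simp) _
  have hle'' : (((Nat.sqrt n + 1) ^ 2 : ℕ) : ℝ) ≤ 4 * n := by exact_mod_cast hle'
  calc _ ≤ _ := hmono (A k) hle
    _ ≤ _ := h1.le
    _ ≤ _ := add_le_add (mul_le_mul_of_nonneg_left (hmono V hle') (hp k))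
      (mul_le_mul_of_nonneg_right hle'' (hw k).le)

/-- The union of the `d`-adic intervals of level `l` that meet `S`. -/
def sat (d l : ℕ) (S : Set ℝ) : Set ℝ := {θ | ∃ θ' ∈ S, ⌊(d : ℝ) ^ l * θ⌋ = ⌊(d : ℝ) ^ l * θ'⌋}

lemma subset_sat (d l : ℕ) (S : Set ℝ) : S ⊆ sat d l S := fun θ hθ => ⟨θ, hθ, rfl⟩

lemma levelConst_sat (d l : ℕ) (S : Set ℝ) : LevelConst d l (· ∈ sat d l S) := fun θ θ' h => by
  refine propext ⟨?_, ?_⟩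
  · rintro ⟨t, ht, he⟩; exact ⟨t, ht, h.symm.trans he⟩
  · rintro ⟨t, ht, he⟩; exact ⟨t, ht, h.trans he⟩

lemma sat_subset_sat {d : ℕ} (hd : 0 < d) {i l : ℕ} (hil : i ≤ l) {S T : Set ℝ}
    (h : S ⊆ sat d i T) : sat d l S ⊆ sat d i T := by
  rintro θ ⟨θ', hθ', he⟩
  obtain ⟨t, ht, he'⟩ := h hθ'
  exact ⟨t, ht, (floor_level_eq_of_le hd hil he).trans he'⟩

lemma volume_preimage_mul_sub {b : ℝ} (hb : b ≠ 0) (k : ℝ) (E : Set ℝ) :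
    volume ((fun θ => b * θ - k) ⁻¹' E) = ENNReal.ofReal |b⁻¹| * volume E := by
  have : (fun θ => b * θ - k) ⁻¹' E = (fun θ => b * θ) ⁻¹' ((fun θ => θ + -k) ⁻¹' E) := by
    ext θ; simp [sub_eq_add_neg]
  rw [this, Real.volume_preimage_mul_left hb, measure_preimage_add_right]

/-- A bound on a rescaled `d`-adic interval is a bound on conditional probabilities. -/
lemma measure_level_le {d : ℕ} (hd : 0 < d) {i : ℕ} {A V : Set ℝ}
    (hV : LevelConst d i (· ∈ V)) (hAV : A ⊆ V) {p : ℝ}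
    (h : ∀ k : ℤ, (∀ t ∈ Ico (0 : ℝ) 1, (t + k) / (d : ℝ) ^ i ∈ V) →
      volume {t ∈ Ico (0 : ℝ) 1 | (t + k) / (d : ℝ) ^ i ∈ A} ≤ ENNReal.ofReal p) (k : ℤ) :
    volume.restrict (Ico (0 : ℝ) 1) (A ∩ {θ | ⌊(d : ℝ) ^ i * θ⌋ = k}) ≤
      ENNReal.ofReal p *
        volume.restrict (Ico (0 : ℝ) 1) (V ∩ {θ | ⌊(d : ℝ) ^ i * θ⌋ = k}) := by
  have hdi : (0 : ℝ) < (d : ℝ) ^ i := by positivity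
  have hpm : MeasurableSet {θ : ℝ | ⌊(d : ℝ) ^ i * θ⌋ = k} :=
    measurable_floor_level d i (measurableSet_singleton k)
  rcases (A ∩ {θ | ⌊(d : ℝ) ^ i * θ⌋ = k}).eq_empty_or_nonempty with he | ⟨θ₀, hθ₀, hk₀⟩
  · rw [he, measure_empty]; exact bot_le
  have hpV : {θ | ⌊(d : ℝ) ^ i * θ⌋ = k} ⊆ V := fun θ hθ =>
    (hV θ θ₀ (Eq.trans hθ (Eq.symm hk₀))).mpr (hAV hθ₀)
  rw [inter_eq_right.2 hpV]
  by_cases hk : 0 ≤ k ∧ k + 1 ≤ (d ^ i : ℕ)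
  · have hk0 : (0 : ℝ) ≤ k := by exact_mod_cast hk.1
    have hk1 : (k : ℝ) + 1 ≤ (d : ℝ) ^ i := by exact_mod_cast hk.2
    have hsub : {θ : ℝ | ⌊(d : ℝ) ^ i * θ⌋ = k} ⊆ Ico 0 1 := fun θ hθ => by
      obtain ⟨h1, h2⟩ := Int.floor_eq_iff.1 (Set.mem_ofPred_eq ▸ hθ)
      constructor
      · by_contra hc
        have := mul_neg_of_pos_of_neg hdi (not_le.1 hc)
        linarith
      · by_contra hc
        have := mul_le_mul_of_nonneg_left (not_lt.1 hc) hdi.le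
        linarith
    rw [Measure.restrict_apply hpm, inter_eq_left.2 hsub]
    refine (Measure.restrict_apply_le _ _).trans ?_
    have e1 : {θ : ℝ | ⌊(d : ℝ) ^ i * θ⌋ = k} =
        (fun θ => (d : ℝ) ^ i * θ - k) ⁻¹' (Ico 0 1) := by
      ext θ
      simp only [Set.mem_ofPred_eq, Int.floor_eq_iff, mem_preimage, mem_Ico]
      constructor <;> rintro ⟨h1, h2⟩ <;> constructor <;> linarith
    have e2 : A ∩ {θ : ℝ | ⌊(d : ℝ) ^ i * θ⌋ = k} ⊆ (fun θ => (d : ℝ) ^ i * θ - k) ⁻¹'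
        {t ∈ Ico (0 : ℝ) 1 | (t + k) / (d : ℝ) ^ i ∈ A} := by
      rintro θ ⟨hA, hθ⟩
      rw [e1] at hθ
      refine ⟨hθ, ?_⟩
      rwa [sub_add_cancel, mul_div_cancel_left₀ _ hdi.ne']
    refine (measure_mono e2).trans ?_
    rw [e1, volume_preimage_mul_sub hdi.ne', volume_preimage_mul_sub hdi.ne', Real.volume_Ico,
      sub_zero, ENNReal.ofReal_one, mul_one, mul_comm]
    gcongr
    refine h k fun t ht => hpV ?_
    rw [Set.mem_ofPred_eq, mul_div_cancel₀ _ hdi.ne', Int.floor_eq_iff]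
    constructor <;> linarith [ht.1, ht.2]
  · refine le_trans (le_of_eq ?_) (bot_le : (0 : ℝ≥0∞) ≤ _)
    refine measure_mono_null inter_subset_right ?_
    rw [Measure.restrict_apply hpm]
    convert measure_empty (μ := volume)
    refine eq_empty_of_forall_notMem fun θ hθ => hk ?_
    obtain ⟨hθ, h0, h1⟩ := hθ
    rw [Set.mem_ofPred_eq] at hθ
    subst hθ
    refine ⟨Int.floor_nonneg.2 (by positivity), Int.add_one_le_iff.2 (Int.floor_lt.2 ?_)⟩
    push_cast
    exact mul_lt_of_lt_one_right hdi h1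

/-- Images of horizontal segments over `d`-adic intervals. -/
def IsIntCurve (a : ℝ) (d : ℕ) (φ : ℝ → ℝ) (α β : ℝ) (X : ℝ → ℝ) : Prop :=
  ∃ n : ℕ, 1 ≤ n ∧ ∃ c : ℤ, ∃ x₀ ∈ Icc (-β) β, ∀ t, X t = fn a d φ α n ((t + c) / (d : ℝ) ^ n) x₀

section Curves

variable {a : ℝ} {d : ℕ} {φ : ℝ → ℝ} {α β : ℝ} {X : ℝ → ℝ}

/-- Over a `d`-adic interval of level `i`, the `i`-th image of a curve is again a curve. -/
lemma IsIntCurve.restart (hX : IsIntCurve a d φ α β X) (hd : 0 < d)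
    (hφp : Function.Periodic φ 1) (hmem : ∀ n θ x, x ∈ Icc (-β) β → fn a d φ α n θ x ∈ Icc (-β) β)
    (i : ℕ) (j : ℤ) : ∃ Y, IsCurve a d φ α β Y ∧ (∀ t, Y t ∈ Icc (-β) β) ∧
      ∀ t l, fn a d φ α (i + l) ((t + j) / (d : ℝ) ^ i) (X ((t + j) / (d : ℝ) ^ i)) =
        fn a d φ α l t (Y t) := by
  obtain ⟨n, hn, c, x₀, hx₀, h⟩ := hX
  have hd' : (d : ℝ) ≠ 0 := by positivity
  refine ⟨fun t => fn a d φ α (n + i) ((t + (j + c * d ^ i : ℝ)) / (d : ℝ) ^ (n + i)) x₀,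
    ⟨n + i, by omega, _, x₀, hx₀, fun t => rfl⟩, fun t => hmem _ _ _ hx₀, fun t l => ?_⟩
  have e : (t + (j + c * d ^ i : ℝ)) / (d : ℝ) ^ (n + i) =
      ((t + j) / (d : ℝ) ^ i + c) / (d : ℝ) ^ n := by
    rw [pow_add]; field_simp; ring
  rw [fn_add, mul_div_cancel₀ _ (by positivity), fn_add_int _ _ _ hφp]
  congr 1
  beta_reduce
  rw [h, e, fn_add a d φ α n i, mul_div_cancel₀ _ (by positivity), fn_add_int _ _ _ hφp]

lemma IsIntCurve.abs_sub_le (hX : IsIntCurve a d φ α β X) (hd : 0 < d)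
    (hφp : Function.Periodic φ 1) (hmem : ∀ n θ x, x ∈ Icc (-β) β → fn a d φ α n θ x ∈ Icc (-β) β)
    {A : ℝ} (hA : 0 ≤ A) (hα : 0 ≤ α)
    (hL : ∀ Y, IsCurve a d φ α β Y → ∀ t t', |Y t - Y t'| ≤ A * α * |t - t'|) {i l : ℕ}
    {θ θ' : ℝ} (h : ⌊(d : ℝ) ^ (i + l) * θ⌋ = ⌊(d : ℝ) ^ (i + l) * θ'⌋) :
    |fn a d φ α i θ (X θ) - fn a d φ α i θ' (X θ')| ≤ A * α / (d : ℝ) ^ l := by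
  obtain ⟨Y, hY, -, hYX⟩ := hX.restart hd hφp hmem i 0
  have hd' : (d : ℝ) ≠ 0 := by positivity
  have e : ∀ θ, fn a d φ α i θ (X θ) = Y ((d : ℝ) ^ i * θ) := fun θ => by
    have := hYX ((d : ℝ) ^ i * θ) 0
    simp only [Int.cast_zero, add_zero, mul_div_cancel_left₀ _ (pow_ne_zero i hd')] at this
    rw [this]; rfl
  rw [e, e]
  refine (hL Y hY _ _).trans ?_
  have h1 := Int.abs_sub_lt_one_of_floor_eq_floor h
  have h2 : |(d : ℝ) ^ i * θ - (d : ℝ) ^ i * θ'| ≤ 1 / (d : ℝ) ^ l := by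
    have hl : (0 : ℝ) ≤ (d : ℝ) ^ l := by positivity
    rw [le_div_iff₀ (by positivity)]
    refine le_trans (le_of_eq ?_) h1.le
    nth_rw 1 [← abs_of_nonneg hl]
    rw [← abs_mul, pow_add]
    congr 1
    ring
  calc _ = A * α * |(d : ℝ) ^ i * θ - (d : ℝ) ^ i * θ'| := by ring
    _ ≤ A * α * (1 / (d : ℝ) ^ l) := by gcongr
    _ = _ := by ring

/-- The number of times in `S` before `n`. -/
def visits (S : Set ℕ) (n : ℕ) : ℝ := ∑ i ∈ Finset.range n, S.indicator (fun _ => (1 : ℝ)) i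

lemma summable_depth_weights (K : ℝ) {τ : ℝ} (hτ : 0 < τ) (hτ1 : τ < 1) (hK : 0 ≤ K) (m : ℕ)
    (w : ℝ) : Summable fun k : ℕ => (K * τ ^ k + (K * τ ^ k) ^ 2) * ((k + m : ℕ) : ℝ) ^ 3 /
      (w / ((k + 1) * (k + 2))) ^ 2 := by
  have h1 : Summable fun k : ℕ => ((k + 1 : ℕ) : ℝ) ^ 7 * τ ^ (k + 1) :=
    (summable_nat_add_iff (f := fun k : ℕ => (k : ℝ) ^ 7 * τ ^ k) 1).2
      (summable_pow_mul_geometric_of_norm_lt_one 7 (by rwa [Real.norm_of_nonneg hτ.le]))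
  refine Summable.of_nonneg_of_le (fun k => by positivity) (fun k => ?_)
    (h1.mul_left ((K + K ^ 2) * (m + 1) ^ 3 * 4 / w ^ 2 / τ))
  have hτk : τ ^ k ≤ 1 := pow_le_one₀ hτ.le hτ1.le
  have hτk0 : 0 ≤ τ ^ k := by positivity
  have e1 : K * τ ^ k + (K * τ ^ k) ^ 2 ≤ (K + K ^ 2) * τ ^ k := by
    have : K ^ 2 * (τ ^ k * τ ^ k) ≤ K ^ 2 * (τ ^ k * 1) := by gcongr
    nlinarith
  have hk : (0 : ℝ) ≤ k := k.cast_nonneg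
  have hm : (0 : ℝ) ≤ m := m.cast_nonneg
  have e2 : ((k + m : ℕ) : ℝ) ≤ (m + 1) * (k + 1) := by push_cast; nlinarith
  have e3 : ((k : ℝ) + 1) * (k + 2) ≤ 2 * (k + 1) ^ 2 := by nlinarith
  rw [div_pow, div_div_eq_mul_div]
  calc _ ≤ ((K + K ^ 2) * τ ^ k) * ((m + 1) * (k + 1)) ^ 3 * (2 * ((k : ℝ) + 1) ^ 2) ^ 2 / w ^ 2 := by
        gcongr
    _ = _ := by
      push_cast
      rw [pow_succ τ k]
      field_simp
      ring

lemma IsIntCurve.ae_eventually_visits_le (hX : IsIntCurve a d φ α β X) (hd : 2 ≤ d)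
    (hφp : Function.Periodic φ 1) (hmem : ∀ n θ x, x ∈ Icc (-β) β → fn a d φ α n θ x ∈ Icc (-β) β)
    {A K τ ε w : ℝ} (hA : 0 ≤ A) (hα : 0 < α) (hα1 : α < 1) (hαA : A * √α ≤ 1) (hK : 0 ≤ K)
    (hτ : 0 < τ) (hτ1 : τ < 1) (hε : 0 ≤ ε) (hw : 0 < w)
    (hL : ∀ Y, IsCurve a d φ α β Y → ∀ t t', |Y t - Y t'| ≤ A * α * |t - t'|)
    (hpow : ∀ Y, IsCurve a d φ α β Y → ∀ k : ℕ,
      volume {t ∈ Ico (0 : ℝ) 1 | |Y t| ≤ 2 * α / (d : ℝ) ^ k} ≤ ENNReal.ofReal (K * τ ^ k))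
    {N m₀ : ℕ} (hret : ∀ Y, IsCurve a d φ α β Y → (∀ t, Y t ∈ Icc (-β) β) →
      (∀ t ∈ Ico (0 : ℝ) 1, |Y t| ≤ 2 * √α) →
      volume {t ∈ Ico (0 : ℝ) 1 | ∃ m < m₀, |fn a d φ α (N + m) t (Y t)| < 2 * √α} ≤
        ENNReal.ofReal ε) :
    ∀ᵐ θ ∂(volume.restrict (Ico (0 : ℝ) 1)), ∀ᶠ n : ℕ in atTop,
      (∀ k : ℕ, visits {i | |fn a d φ α i θ (X θ)| ≤ α / (d : ℝ) ^ k} n ≤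
        K * τ ^ k * visits {i | |fn a d φ α i θ (X θ)| < 2 * √α} (4 * n) +
          4 * n * (w / ((k + 1) * (k + 2)))) ∧
      visits {i | |fn a d φ α i θ (X θ)| < √α ∧
          ∃ m < m₀, |fn a d φ α (i + (N + m)) θ (X θ)| < √α} n ≤
        ε * visits {i | |fn a d φ α i θ (X θ)| < 2 * √α} (4 * n) + 4 * n * w := by
  have hd0 : 0 < d := by omega
  have hd1 : (1 : ℝ) < d := by exact_mod_cast hd
  have hs : 0 < √α := Real.sqrt_pos.2 hα
  have hAα : A * α ≤ √α := by
    calc A * α = A * √α * √α := by rw [mul_assoc, Real.mul_self_sqrt hα.le]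
      _ ≤ 1 * √α := by gcongr
      _ = _ := one_mul _
  have hαs : α < √α := by
    have : √α < 1 := (Real.sqrt_lt' one_pos).2 (by simpa using hα1)
    nlinarith [Real.mul_self_sqrt hα.le]
  obtain ⟨m₁, hm₁⟩ := pow_unbounded_of_one_lt A hd1
  set x : ℕ → ℝ → ℝ := fun i θ => fn a d φ α i θ (X θ) with hx
  have hosc : ∀ {i l : ℕ} {θ θ' : ℝ}, ⌊(d : ℝ) ^ (i + l) * θ⌋ = ⌊(d : ℝ) ^ (i + l) * θ'⌋ →
      |x i θ - x i θ'| ≤ A * α / (d : ℝ) ^ l := fun h =>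
    hX.abs_sub_le hd0 hφp hmem hA hα.le hL h
  have hosc' : ∀ {i l : ℕ} {θ θ' : ℝ}, i ≤ l → ⌊(d : ℝ) ^ l * θ⌋ = ⌊(d : ℝ) ^ l * θ'⌋ →
      |x i θ'| < √α → |x i θ| < 2 * √α := fun {i l θ θ'} hil he h => by
    have h1 := hosc (l := 0) (floor_level_eq_of_le hd0 hil he)
    rw [pow_zero, div_one] at h1
    have h2 := abs_sub_abs_le_abs_sub (x i θ) (x i θ')
    linarith
  set V : ℕ → Set ℝ := fun i => sat d i {θ | |x i θ| < √α} with hV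
  have hVx : ∀ i θ, θ ∈ V i → |x i θ| < 2 * √α := by
    rintro i θ ⟨θ', hθ', he⟩
    exact hosc' le_rfl he hθ'
  set D : ℕ → ℕ → Set ℝ := fun k i => sat d (i + (k + (m₁ + 1))) {θ | |x i θ| ≤ α / (d : ℝ) ^ k}
    with hD
  have hDV : ∀ k i, D k i ⊆ V i := fun k i => sat_subset_sat hd0 (by omega) (by
    refine subset_trans (fun θ hθ => ?_) (subset_sat _ _ _)
    exact lt_of_le_of_lt (le_trans (Set.mem_ofPred_eq ▸ hθ)
      (div_le_self hα.le (one_le_pow₀ hd1.le))) hαs)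
  have hDx : ∀ k i θ, θ ∈ D k i → |x i θ| ≤ 2 * α / (d : ℝ) ^ k := by
    rintro k i θ ⟨θ', hθ', he⟩
    have h1 := hosc he
    have h2 := abs_sub_abs_le_abs_sub (x i θ) (x i θ')
    have h3 : A * α / (d : ℝ) ^ (k + (m₁ + 1)) ≤ α / (d : ℝ) ^ k := by
      rw [pow_add, mul_comm A, mul_div_mul_comm]
      refine mul_le_of_le_one_right (by positivity) ((div_le_one (by positivity)).2 ?_)
      exact hm₁.le.trans (pow_le_pow_right₀ hd1.le (by omega))
    rw [Set.mem_ofPred_eq] at hθ'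
    rw [mul_div_assoc]
    rw [← mul_div_assoc, two_mul, add_div]
    linarith
  set Q : ℕ → Set ℝ := fun i => sat d (i + (N + m₀ + 1))
    {θ | |x i θ| < √α ∧ ∃ m < m₀, |x (i + (N + m)) θ| < √α} with hQ
  have hQV : ∀ i, Q i ⊆ V i := fun i => sat_subset_sat hd0 (by omega)
    (subset_trans (fun θ hθ => (Set.mem_ofPred_eq ▸ hθ).1) (subset_sat _ _ _))
  have hQx : ∀ i θ, θ ∈ Q i → ∃ m < m₀, |x (i + (N + m)) θ| < 2 * √α := by
    rintro i θ ⟨θ', ⟨-, m, hm, hθ'⟩, he⟩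
    exact ⟨m, hm, hosc' (by omega) he hθ'⟩
  have hVlev : ∀ i, LevelConst d i (· ∈ V i) := fun i => levelConst_sat _ _ _
  have hμ : volume.restrict (Ico (0 : ℝ) 1) univ ≤ 1 := by simp
  have hD' := ae_eventually_count_le hd0 hμ (m := fun k => k + (m₁ + 1)) (fun k => by omega)
    (A := D) hVlev (fun k i => levelConst_sat _ _ _) (p := fun k => K * τ ^ k)
    (w := fun k => w / ((k + 1) * (k + 2))) (fun k => by positivity) (fun k => by positivity)
    (fun k i => measure_level_le hd0 (hVlev i) (hDV k i) fun j _ => by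
      obtain ⟨Y, hY, -, hYX⟩ := hX.restart hd0 hφp hmem i j
      refine le_trans (measure_mono fun t ht => And.intro ht.1 ?_) (hpow Y hY k)
      have h1 := hDx k i _ ht.2
      have h2 := hYX t 0
      simp only [hx] at h1
      rw [add_zero] at h2
      rwa [h2] at h1)
    (summable_depth_weights K hτ hτ1 hK (m₁ + 1) w)
  have hQ' := ae_eventually_count_le hd0 hμ (m := fun _ : Unit => N + m₀ + 1) (fun _ => by omega)
    (A := fun _ => Q) hVlev (fun _ i => levelConst_sat _ _ _) (p := fun _ => ε)
    (w := fun _ => w) (fun _ => hε) (fun _ => hw)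
    (fun _ i => measure_level_le hd0 (hVlev i) (hQV i) fun j hj => by
      obtain ⟨Y, hY, hYm, hYX⟩ := hX.restart hd0 hφp hmem i j
      refine le_trans (measure_mono fun t ht => And.intro ht.1 ?_) (hret Y hY hYm fun t ht => ?_)
      · obtain ⟨m, hm, h1⟩ := hQx i _ ht.2
        refine ⟨m, hm, ?_⟩
        simp only [hx] at h1
        rwa [hYX] at h1
      · have h1 := hVx i _ (hj t ht)
        have h2 := hYX t 0
        simp only [hx] at h1
        rw [add_zero] at h2
        rw [h2] at h1
        exact h1.le)
    (Summable.of_finite)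
  filter_upwards [hD', hQ'] with θ h1 h2
  have hVv : ∀ n, ∑ i ∈ Finset.range n, (V i).indicator (fun _ => (1 : ℝ)) θ ≤
      visits {i | |fn a d φ α i θ (X θ)| < 2 * √α} n := fun n =>
    Finset.sum_le_sum fun i _ => by
      by_cases h : θ ∈ V i
      · rw [indicator_of_mem h, indicator_of_mem (by exact hVx i θ h)]
      · rw [indicator_of_notMem h]; exact indicator_nonneg (by simp) _
  have hle : ∀ (S : Set ℕ) (B : ℕ → Set ℝ) n, (∀ i ∈ S, θ ∈ B i) → visits S n ≤
      ∑ i ∈ Finset.range n, (B i).indicator (fun _ => (1 : ℝ)) θ := fun S B n h =>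
    Finset.sum_le_sum fun i _ => by
      by_cases hi : i ∈ S
      · rw [indicator_of_mem hi, indicator_of_mem (h i hi)]
      · rw [indicator_of_notMem hi]; exact indicator_nonneg (by simp) _
  filter_upwards [h1, h2] with n h1 h2
  refine ⟨fun k => ?_, ?_⟩
  · refine (hle _ (D k) n fun i hi => subset_sat _ _ _ hi).trans ((h1 k).trans ?_)
    gcongr
    exact hVv _
  · refine (hle _ Q n fun i hi => subset_sat _ _ _ hi).trans ((h2 ()).trans ?_)
    gcongr
    exact hVv _

end Curves

lemma visits_nonneg (S : Set ℕ) (n : ℕ) : 0 ≤ visits S n :=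
  Finset.sum_nonneg fun _ _ => indicator_nonneg (fun _ _ => zero_le_one) _

/-- Disjoint intervals of length `len i`, starting at the times in `v`, pack. -/
lemma sum_len_le {v : Set ℕ} {len : ℕ → ℝ} (h : ∀ i ∈ v, ∀ j ∈ v, i < j → i + len i ≤ j) (n : ℕ) :
    ∀ B : ℝ, 0 ≤ B → (∀ i ∈ v, i < n → i + len i ≤ B) →
      ∑ i ∈ Finset.range n, v.indicator len i ≤ B := by
  induction n with
  | zero => intro B hB _; simpa using hB
  | succ n ih =>
    intro B hB hn
    rw [Finset.sum_range_succ]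
    by_cases hv : n ∈ v
    · rw [indicator_of_mem hv]
      have h1 := ih n n.cast_nonneg fun i hi hin => h i hi n hv hin
      have h2 := hn n hv n.lt_succ_self
      linarith
    · rw [indicator_of_notMem hv, add_zero]
      exact ih B hB fun i hi hin => hn i hi (hin.trans n.lt_succ_self)

lemma mul_visits_le {v : Set ℕ} {N : ℕ} (h : ∀ i ∈ v, ∀ j ∈ v, i < j → i + N ≤ j) (n : ℕ) :
    N * visits v n ≤ n + N := by
  have := sum_len_le (v := v) (len := fun _ => (N : ℝ))
    (fun i hi j hj hij => by exact_mod_cast h i hi j hj hij) n (n + N) (by positivity)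
    (fun i _ hi => by have : (i : ℝ) ≤ n := by exact_mod_cast hi.le
                      linarith)
  refine le_trans (le_of_eq ?_) this
  rw [visits, Finset.mul_sum]
  refine Finset.sum_congr rfl fun i _ => ?_
  by_cases hi : i ∈ v
  · simp [indicator_of_mem hi]
  · simp [indicator_of_notMem hi]

lemma mul_visits_add_le {v R : Set ℕ} (hR : R ⊆ v) {N m₀ : ℕ}
    (h : ∀ i ∈ v, ∀ j ∈ v, i < j → i + N ≤ j)
    (h' : ∀ i ∈ v, i ∉ R → ∀ j ∈ v, i < j → i + (N + m₀) ≤ j) (n : ℕ) :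
    N * visits v n + m₀ * (visits v n - visits R n) ≤ n + (N + m₀) := by
  have := sum_len_le (v := v) (len := fun i => N + m₀ * (1 - R.indicator (fun _ => (1 : ℝ)) i))
    (fun i hi j hj hij => by
      by_cases hiR : i ∈ R
      · have := h i hi j hj hij
        rw [indicator_of_mem hiR, sub_self, mul_zero, add_zero]
        exact_mod_cast this
      · have := h' i hi hiR j hj hij
        rw [indicator_of_notMem hiR, sub_zero, mul_one]
        exact_mod_cast this) n (n + (N + m₀)) (by positivity)
    (fun i _ hi => by
      have h1 : (i : ℝ) ≤ n := by exact_mod_cast hi.le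
      have h2 : (m₀ : ℝ) * (1 - R.indicator (fun _ => (1 : ℝ)) i) ≤ m₀ :=
        mul_le_of_le_one_right m₀.cast_nonneg
          (sub_le_self _ (indicator_nonneg (fun _ _ => zero_le_one) _))
      linarith)
  refine le_trans (le_of_eq ?_) this
  rw [visits, visits, ← Finset.sum_sub_distrib, Finset.mul_sum, Finset.mul_sum,
    ← Finset.sum_add_distrib]
  refine Finset.sum_congr rfl fun i _ => ?_
  by_cases hi : i ∈ v
  · simp [indicator_of_mem hi]
  · simp [indicator_of_notMem hi, indicator_of_notMem (fun hn => hi (hR hn))]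

/-- The logarithmic depth of a point is controlled by counting the dyadic scales below it. -/
lemma log_min_ge {D α y : ℝ} (hD : 1 < D) (hα : 0 < α) (T : ℕ) (hT : α / D ^ T < |y|) :
    -(Real.log D * ∑ k ∈ Finset.range T, {t : ℝ | |t| ≤ α / D ^ k}.indicator (fun _ => (1 : ℝ)) y) ≤
      Real.log (min 1 (|y| / α)) := by
  have hlD : 0 < Real.log D := Real.log_pos hD
  induction T with
  | zero =>
    have : 1 ≤ |y| / α := by rw [le_div_iff₀ hα]; simpa using hT.le
    simp [min_eq_left this]
  | succ T ih =>
    by_cases hy : α / D ^ T < |y|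
    · refine le_trans (neg_le_neg (mul_le_mul_of_nonneg_left ?_ hlD.le)) (ih hy)
      rw [Finset.sum_range_succ]
      exact le_add_of_nonneg_right (indicator_nonneg (fun _ _ => zero_le_one) _)
    · have hall : ∑ k ∈ Finset.range (T + 1),
          {t : ℝ | |t| ≤ α / D ^ k}.indicator (fun _ => (1 : ℝ)) y = (T + 1 : ℕ) := by
        have hmem : ∀ k ∈ Finset.range (T + 1), y ∈ {t : ℝ | |t| ≤ α / D ^ k} := fun k hk => by
          refine (not_lt.1 hy).trans ?_
          have := pow_le_pow_right₀ hD.le (Nat.lt_succ_iff.1 (Finset.mem_range.1 hk))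
          gcongr
        rw [Finset.sum_congr rfl fun k hk => indicator_of_mem (hmem k hk) _]
        simp
      have hD0 : 0 < D := by linarith
      have h1 : (D ^ (T + 1))⁻¹ ≤ min 1 (|y| / α) := by
        refine le_min (inv_le_one_of_one_le₀ (one_le_pow₀ hD.le)) ?_
        rw [le_div_iff₀ hα, inv_mul_eq_div]
        exact hT.le
      have h2 := Real.log_le_log (by positivity) h1
      rw [Real.log_inv, Real.log_pow] at h2
      rw [hall]
      linarith

lemma log_dprod_ge {D α c₁ σ Cα : ℝ} {N n T : ℕ} {x : ℕ → ℝ} (hD : 1 < D) (hα : 0 < α)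
    (hc₁ : 0 < c₁) (hσ : 1 < σ) (hCα : 0 < Cα) (hT : ∀ i < n, α / D ^ T < |x i|)
    (h : Cα * σ ^ n * ∏ i ∈ Finset.range n, visitWeight α (c₁ / σ ^ N) (x i) ≤ dprod x n) :
    Real.log Cα + n * Real.log σ - (N * Real.log σ + |Real.log c₁|) * visits {i | |x i| < √α} n -
      Real.log D * ∑ k ∈ Finset.range T, visits {i | |x i| ≤ α / D ^ k} n ≤
        Real.log (dprod x n) := by
  have hσ0 : 0 < σ := by linarith
  have hD0 : 0 < D := by linarith
  have hlD : 0 < Real.log D := Real.log_pos hD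
  have hx : ∀ i < n, 0 < |x i| := fun i hi => lt_trans (by positivity) (hT i hi)
  have hW : ∀ i < n, 0 < visitWeight α (c₁ / σ ^ N) (x i) := fun i hi => by
    have := hx i hi
    unfold visitWeight
    split_ifs
    · exact one_pos
    · have : 0 < min 1 (|x i| / α) := by positivity
      positivity
  have hlog := Real.log_le_log (mul_pos (by positivity)
    (Finset.prod_pos fun i hi => hW i (Finset.mem_range.1 hi))) h
  rw [Real.log_mul (by positivity)
    (Finset.prod_pos fun i hi => hW i (Finset.mem_range.1 hi)).ne', Real.log_mul (by positivity)
    (by positivity), Real.log_pow, Real.log_prod fun i hi => (hW i (Finset.mem_range.1 hi)).ne']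
    at hlog
  refine le_trans ?_ hlog
  have key : ∑ i ∈ Finset.range n, (-((N * Real.log σ + |Real.log c₁|) *
      {i | |x i| < √α}.indicator (fun _ => (1 : ℝ)) i) - Real.log D * ∑ k ∈ Finset.range T,
        {i | |x i| ≤ α / D ^ k}.indicator (fun _ => (1 : ℝ)) i) ≤
      ∑ i ∈ Finset.range n, Real.log (visitWeight α (c₁ / σ ^ N) (x i)) := by
    refine Finset.sum_le_sum fun i hi => ?_
    have hi' := Finset.mem_range.1 hi
    by_cases hv : |x i| < √α
    · rw [indicator_of_mem (show i ∈ {i | |x i| < √α} from hv), mul_one, visitWeight,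
        if_neg (not_le.2 hv)]
      have hm : 0 < min 1 (|x i| / α) := by have := hx i hi'; positivity
      rw [Real.log_mul (by positivity) hm.ne', Real.log_div hc₁.ne' (by positivity), Real.log_pow]
      have h1 := log_min_ge hD hα T (hT i hi')
      have h2 := neg_abs_le (Real.log c₁)
      have e : ∀ k, {i | |x i| ≤ α / D ^ k}.indicator (fun _ => (1 : ℝ)) i =
        {t : ℝ | |t| ≤ α / D ^ k}.indicator (fun _ => (1 : ℝ)) (x i) := fun k => rfl
      simp only [e]
      linarith
    · rw [indicator_of_notMem (show i ∉ {i | |x i| < √α} from hv), visitWeight,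
        if_pos (not_lt.1 hv), Real.log_one, mul_zero, neg_zero, zero_sub, neg_nonpos]
      exact mul_nonneg hlD.le (Finset.sum_nonneg fun _ _ =>
        indicator_nonneg (fun _ _ => zero_le_one) _)
  rw [Finset.sum_sub_distrib, Finset.sum_neg_distrib, ← Finset.mul_sum, ← Finset.mul_sum,
    Finset.sum_comm] at key
  simp only [visits]
  linarith

lemma growth_of_visit_bounds {L lc s C₃ K ω ε w nv nR N m₀ n : ℝ} (hs : 0 < s) (hC₃ : 0 ≤ C₃)
    (hK : 0 ≤ K) (hn : 0 ≤ n) (hN : 1 ≤ N) (hm₀ : 0 ≤ m₀) (hnv : 0 ≤ nv)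
    (hL : lc + n * s - (N * s + C₃) * nv - (K * (4 * n / N + 1) + 4 * n * ω) ≤ L)
    (hpack : N * nv + m₀ * (nv - nR) ≤ n + (N + m₀)) (hR : nR ≤ ε * (4 * n / N + 1) + 4 * n * w)
    (hNs : C₃ / 2 + 4 * K + 2 ≤ N * s / 2) (hm : C₃ + 2 * (4 * K + 3) ≤ s * m₀)
    (hε : 4 * s * m₀ * ε ≤ 1) (hω : 4 * N * ω ≤ 1 / 2) (hw : 4 * s * m₀ * w * N ≤ 1 / 2) :
    n / N - (|lc| + K + 1 + s * (N + m₀)) ≤ L := by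
  have hN0 : 0 < N := by linarith
  obtain ⟨q, rfl⟩ : ∃ q, n = N * q := ⟨n / N, by field_simp⟩
  have hq : 0 ≤ q := by
    by_contra hc
    nlinarith [mul_neg_of_pos_of_neg hN0 (not_le.1 hc)]
  have e1 : N * q / N = q := by field_simp
  have e2 : 4 * (N * q) / N = 4 * q := by field_simp
  rw [e2] at hL hR
  rw [e1]
  have hlc := neg_abs_le lc
  have hωq : 4 * (N * q) * ω ≤ q / 2 := by nlinarith
  have hsm : 0 ≤ s * (N + m₀) := by positivity
  rcases le_or_gt nv (q / 2) with h | h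
  · have h1 : (N * s + C₃) * nv ≤ (N * s + C₃) * (q / 2) := by gcongr
    nlinarith [mul_le_mul_of_nonneg_right hNs hq]
  · have h2 : s * m₀ * nR ≤ s * m₀ * (ε * (4 * q + 1) + 4 * (N * q) * w) := by gcongr
    have h3 : s * m₀ * (ε * (4 * q + 1) + 4 * (N * q) * w) ≤ (q + 1 / 4) + q / 2 := by
      nlinarith
    have h4 : s * (N * nv + m₀ * (nv - nR)) ≤ s * (N * q + (N + m₀)) := by gcongr
    have h5 : (C₃ + 2 * (4 * K + 3)) * nv ≤ s * m₀ * nv := by gcongr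
    nlinarith


lemma exists_depth_bound {K τ v n w : ℝ} (hτ : 0 < τ) (hτ1 : τ < 1) :
    ∃ T : ℕ, K * τ ^ T * v + 4 * n * (w / ((T + 1) * (T + 2))) < 1 := by
  have h1 : Tendsto (fun T : ℕ => K * τ ^ T * v) atTop (nhds (K * 0 * v)) :=
    ((tendsto_pow_atTop_nhds_zero_of_lt_one hτ.le hτ1).const_mul K).mul_const v
  have h2 : Tendsto (fun T : ℕ => ((T : ℝ) + 1) * (T + 2)) atTop atTop :=
    (tendsto_atTop_add_const_right _ _ tendsto_natCast_atTop_atTop).atTop_mul_atTop₀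
      (tendsto_atTop_add_const_right _ _ tendsto_natCast_atTop_atTop)
  have h3 := h1.add ((h2.const_div_atTop w).const_mul (4 * n))
  rw [mul_zero, mul_zero, zero_mul, add_zero] at h3
  exact (h3.eventually (gt_mem_nhds one_pos)).exists

lemma sum_inv_mul_succ_le (w : ℝ) (hw : 0 ≤ w) (T : ℕ) :
    ∑ k ∈ Finset.range T, w / (((k : ℝ) + 1) * (k + 2)) ≤ w := by
  have : ∑ k ∈ Finset.range T, w / (((k : ℝ) + 1) * (k + 2)) = w - w / (T + 1) := by
    induction T with
    | zero => simp
    | succ T ih =>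
      rw [Finset.sum_range_succ, ih]
      push_cast
      have h1 : (T : ℝ) + 1 ≠ 0 := by positivity
      have h2 : (T : ℝ) + 2 ≠ 0 := by positivity
      have h3 : (T : ℝ) + 1 + 1 ≠ 0 := by positivity
      field_simp
      ring
  rw [this]
  exact sub_le_self _ (by positivity)

/-- Recurrence estimates along a typical orbit give exponential growth of the derivative. -/
lemma log_dprod_ge_of_visits {D α c₁ σ Cα K τ ε w : ℝ} {N m₀ n : ℕ} {x : ℕ → ℝ} (hD : 1 < D)
    (hα : 0 < α) (hc₁ : 0 < c₁) (hσ : 1 < σ) (hCα : 0 < Cα) (hK : 0 ≤ K) (hτ : 0 < τ)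
    (hτ1 : τ < 1) (hε : 0 ≤ ε) (hw : 0 ≤ w) (hN : 1 ≤ N)
    (hdet : ∀ n, Cα * σ ^ n * ∏ i ∈ Finset.range n, visitWeight α (c₁ / σ ^ N) (x i) ≤ dprod x n)
    (hsep : ∀ i, |x i| < 2 * √α → ∀ l, 1 ≤ l → l ≤ N → 2 * √α ≤ |x (i + l)|)
    (hdepth : ∀ k : ℕ, visits {i | |x i| ≤ α / D ^ k} n ≤
      K * τ ^ k * visits {i | |x i| < 2 * √α} (4 * n) + 4 * n * (w / ((k + 1) * (k + 2))))
    (hret : visits {i | |x i| < √α ∧ ∃ m < m₀, |x (i + (N + m))| < √α} n ≤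
        ε * visits {i | |x i| < 2 * √α} (4 * n) + 4 * n * w)
    (hNs : |Real.log c₁| / 2 + 4 * (Real.log D * (K / (1 - τ))) + 2 ≤ N * Real.log σ / 2)
    (hm : |Real.log c₁| + 2 * (4 * (Real.log D * (K / (1 - τ))) + 3) ≤ Real.log σ * m₀)
    (hsε : 4 * Real.log σ * m₀ * ε ≤ 1) (hω : 4 * N * (Real.log D * w) ≤ 1 / 2)
    (hwN : 4 * Real.log σ * m₀ * w * N ≤ 1 / 2) :
    n / N - (|Real.log Cα| + Real.log D * (K / (1 - τ)) + 1 + Real.log σ * (N + m₀)) ≤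
      Real.log (dprod x n) := by
  have hlD : 0 < Real.log D := Real.log_pos hD
  have hs : 0 < √α := Real.sqrt_pos.2 hα
  have hN0 : (0 : ℝ) < N := by exact_mod_cast hN
  have h1τ : 0 < 1 - τ := by linarith
  have hVsep : ∀ i ∈ {i | |x i| < 2 * √α}, ∀ j ∈ {i | |x i| < 2 * √α}, i < j → i + N + 1 ≤ j :=
    fun i hi j hj hij => by
      by_contra hc
      have := hsep i hi (j - i) (by omega) (by omega)
      rw [Nat.add_sub_cancel' hij.le] at this
      exact absurd hj (not_lt.2 this)
  have hV4 : visits {i | |x i| < 2 * √α} (4 * n) ≤ 4 * n / N + 1 := by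
    have := mul_visits_le (N := N) (fun i hi j hj hij => by
      have := hVsep i hi j hj hij; omega) (4 * n)
    push_cast at this
    rw [div_add_one hN0.ne', le_div_iff₀ hN0]
    linarith
  have hsub : ∀ i, |x i| < √α → |x i| < 2 * √α := fun i hi => by linarith
  set q := 4 * (n : ℝ) / N + 1 with hq
  have hq0 : 0 ≤ q := by positivity
  obtain ⟨T, hT⟩ := exists_depth_bound (K := K) (v := visits {i | |x i| < 2 * √α} (4 * n))
    (n := n) (w := w) hτ hτ1
  have hTx : ∀ i < n, α / D ^ T < |x i| := fun i hi => by
    by_contra hc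
    have h1 := (hdepth T).trans_lt hT
    have h2 : (1 : ℝ) ≤ visits {i | |x i| ≤ α / D ^ T} n := by
      refine le_trans ?_ (Finset.single_le_sum (f := fun i =>
        {i | |x i| ≤ α / D ^ T}.indicator (fun _ => (1 : ℝ)) i)
        (fun _ _ => indicator_nonneg (fun _ _ => zero_le_one) _) (Finset.mem_range.2 hi))
      rw [indicator_of_mem (show i ∈ {i | |x i| ≤ α / D ^ T} from not_lt.1 hc)]
    linarith
  have hL := log_dprod_ge hD hα hc₁ hσ hCα hTx (hdet n)
  have hsum : ∑ k ∈ Finset.range T, visits {i | |x i| ≤ α / D ^ k} n ≤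
      K / (1 - τ) * q + 4 * n * w := by
    calc _ ≤ ∑ k ∈ Finset.range T, (K * τ ^ k * q + 4 * n * (w / ((k + 1) * (k + 2)))) :=
          Finset.sum_le_sum fun k _ => (hdepth k).trans (by gcongr)
      _ = K * (∑ k ∈ Finset.range T, τ ^ k) * q +
          4 * n * ∑ k ∈ Finset.range T, w / (((k : ℝ) + 1) * (k + 2)) := by
          rw [Finset.sum_add_distrib, ← Finset.sum_mul, ← Finset.mul_sum, ← Finset.mul_sum]
      _ ≤ K * (1 / (1 - τ)) * q + 4 * n * w := by
          have h1 : ∑ k ∈ Finset.range T, τ ^ k ≤ 1 / (1 - τ) := by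
            rw [le_div_iff₀ h1τ, geom_sum_mul_neg]
            exact sub_le_self _ (by positivity)
          have h2 := sum_inv_mul_succ_le w hw T
          gcongr
      _ = _ := by ring
  refine growth_of_visit_bounds (lc := Real.log Cα) (C₃ := |Real.log c₁|)
    (ω := Real.log D * w) (ε := ε) (w := w) (nv := visits {i | |x i| < √α} n)
    (nR := visits {i | |x i| < √α ∧ ∃ m < m₀, |x (i + (N + m))| < √α} n)
    (Real.log_pos hσ) (abs_nonneg _) (by positivity) n.cast_nonneg (by exact_mod_cast hN)
    m₀.cast_nonneg (visits_nonneg _ _) ?_ ?_ (hret.trans (by gcongr)) hNs hm hsε hω hwN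
  · refine le_trans ?_ hL
    have := mul_le_mul_of_nonneg_left hsum hlD.le
    linarith
  · refine mul_visits_add_le (fun i hi => hi.1)
      (fun i hi j hj hij => by
        have := hVsep i (hsub i hi) j (hsub j hj) hij; omega)
      (fun i hi hiR j hj hij => ?_) n
    have h1 := hVsep i (hsub i hi) j (hsub j hj) hij
    by_contra hc
    refine hiR ⟨hi, j - (i + N), by omega, ?_⟩
    rw [show i + (N + (j - (i + N))) = j by omega]
    exact hj

lemma liminf_pos_of_linear_growth {y : ℕ → ℝ} {κ B M : ℝ} (hκ : 0 < κ) (hM : 0 ≤ M)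
    (hlow : ∀ᶠ n : ℕ in atTop, κ * n - B ≤ y n) (hup : ∀ n : ℕ, y n ≤ M * n) :
    0 < liminf (fun n : ℕ => y n / n) atTop := by
  have hbdd : IsBoundedUnder (· ≤ ·) atTop fun n : ℕ => y n / n :=
    isBoundedUnder_of ⟨M, fun n => div_le_of_le_mul₀ n.cast_nonneg hM (hup n)⟩
  have hev : ∀ᶠ n : ℕ in atTop, κ / 2 ≤ y n / n := by
    filter_upwards [hlow, tendsto_natCast_atTop_atTop.eventually_ge_atTop (2 * B / κ),
      eventually_gt_atTop 0] with n h1 h2 h3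
    have hn : (0 : ℝ) < n := by exact_mod_cast h3
    rw [le_div_iff₀ hn]
    rw [div_le_iff₀ hκ] at h2
    linarith
  exact lt_of_lt_of_le (half_pos hκ) (le_liminf_of_le hbdd.isCoboundedUnder_ge hev)

lemma misiurewicz_of_strictlyPreperiodic {a : ℝ} (ha : a ∈ Ioo (1 : ℝ) 2)
    (hpre : StrictlyPreperiodic a) :
    Misiurewicz a |(-1 - √(1 + 4 * a)) / 2| := by
  have h1 := ha.1
  have hs := Real.sq_sqrt (show 0 ≤ 1 + 4 * a by linarith)
  have hs0 : 1 < √(1 + 4 * a) := by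
    rw [Real.lt_sqrt (by norm_num)]
    linarith
  have e : |(-1 - √(1 + 4 * a)) / 2| = (1 + √(1 + 4 * a)) / 2 := by
    rw [abs_of_nonpos (by linarith)]
    ring
  rw [e]
  exact ⟨h1, ha.2, by nlinarith, by linarith, hpre⟩

lemma pseudoOrbit_fn {a : ℝ} {d : ℕ} {φ : ℝ → ℝ} {α β θ x : ℝ} (hα : 0 ≤ α)
    (hφb : ∀ θ, |φ θ| ≤ 1) (hmem : ∀ n, fn a d φ α n θ x ∈ Icc (-β) β) :
    PseudoOrbit a α β fun i => fn a d φ α i θ x := by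
  refine ⟨fun i => ?_, fun i => abs_le.2 (hmem i)⟩
  rw [fn_succ, add_sub_cancel_left, abs_mul, abs_of_nonneg hα]
  exact mul_le_of_le_one_right hα (hφb _)

lemma log_dprod_le {x : ℕ → ℝ} {β : ℝ} (hβ : β ≤ 2) (hx : ∀ i, |x i| ≤ β) (n : ℕ) :
    Real.log (dprod x n) ≤ Real.log 4 * n := by
  have h0 : 0 ≤ dprod x n := Finset.prod_nonneg fun _ _ => abs_nonneg _
  have h4 : 0 ≤ Real.log 4 := Real.log_nonneg (by norm_num)
  rcases h0.eq_or_lt with h | h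
  · rw [← h, Real.log_zero]
    positivity
  · have h1 : dprod x n ≤ 4 ^ n := dprod_le_pow fun i _ => by
      rw [abs_mul, abs_two]
      linarith [hx i]
    have h2 := Real.log_le_log h h1
    rwa [Real.log_pow, mul_comm] at h2

/-- For `α > 0` small enough: for every admissible curve `X : [0,1) → B` and
Lebesgue-a.e. `θ ∈ [0,1)`,
`χ₋(θ, X(θ)) = liminf_{n→∞} (1/n) log |∂f_n(θ, X(θ))/∂x| > 0`. -/
theorem admissible_positive_exponent
    (a : ℝ) (ha : a ∈ Set.Ioo (1 : ℝ) 2) (hpre : StrictlyPreperiodic a)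
    (d : ℕ) (hd : 2 ≤ d)
    (φ : ℝ → ℝ) (hφa : ∀ x : ℝ, AnalyticAt ℝ φ x) (hφp : Function.Periodic φ 1)
    (hφnc : ∃ s t : ℝ, φ s ≠ φ t) (hφb : ∀ θ : ℝ, |φ θ| ≤ 1)
    (β : ℝ) (hβ1 : 1 < β) (hβ2 : β < |(-1 - Real.sqrt (1 + 4 * a)) / 2|)
    (hβmap : ∀ x ∈ Set.Icc (-β) β, qm a x ∈ Set.Ioo (-β) β)
    (hβder : ∀ x : ℝ, β ≤ |x| → 2 * β ≤ |deriv (qm a) x|)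
    (n₀ : ℕ)
    (hdom : ∃ C₁ R₁ : ℝ, 0 < C₁ ∧ R₁ ∈ Set.Ioo (0 : ℝ) 2 ∧ ∃ α₁ > 0, ∀ α : ℝ, 0 < α → α < α₁ →
      ∀ θ x : ℝ, x ∈ Set.Icc (-β) β → ∀ k : ℕ,
        |deriv (fun y => fn a d φ α k θ y) x| ≤ C₁ * R₁ ^ k ∧
        (n₀ ≤ k → |deriv (fun y => fn a d φ α k θ y) x| ≤ R₁ ^ k ∧ R₁ ^ k ≤ (d : ℝ) ^ k / 6))
    :
    ∃ α₀ > 0, ∀ α : ℝ, 0 < α → α < α₀ →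
      ∀ X : ℝ → ℝ, Admissible a d φ α β n₀ X →
        ∀ᵐ θ ∂(volume.restrict (Set.Ico (0 : ℝ) 1)),
          0 < Filter.liminf
            (fun n : ℕ => Real.log |deriv (fun y => fn a d φ α n θ y) (X θ)| / n)
            Filter.atTop := by
  have h := misiurewicz_of_strictlyPreperiodic ha hpre
  have hβ' : β ≤ 2 := (hβ2.trans h.P_lt_two).le
  have hd2 : (2 : ℝ) ≤ d := by exact_mod_cast hd
  have hlogd : 0 < Real.log d := Real.log_pos (by linarith)
  obtain ⟨lam, c, C, hg⟩ := h.exists_growth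
  have hl := hg.one_lt
  obtain ⟨C₁, R₁, hC₁, hR₁, α₁, hα₁, hdom⟩ := hdom
  obtain ⟨A, hA, K, hK, τ, hτ, hτ1, αp, hαp, hpow⟩ := exists_power_law hφa hφp hφnc hd hC₁
    hR₁.1.le (hR₁.2.trans_le hd2)
  obtain ⟨δ₀', hδ₀', hdet⟩ := h.deterministic_bound hβ2 hg
  obtain ⟨δ₁, hδ₁, hret⟩ := h.exists_close_return_bound hg hd hφa hφp hφnc hφb hβ2
  set δ₀ := min δ₀' δ₁ with hδdef
  have hδ₀ : 0 < δ₀ := lt_min hδ₀' hδ₁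
  obtain ⟨σ, c₁, αd, hσ, hc₁, hαd, hdet⟩ := hdet δ₀ hδ₀ (min_le_left _ _)
  have hs : 0 < Real.log σ := Real.log_pos hσ
  obtain ⟨m₀, hm₀⟩ := exists_nat_ge
    ((|Real.log c₁| + 2 * (4 * (Real.log d * (K / (1 - τ))) + 3)) / Real.log σ)
  rw [div_le_iff₀' hs] at hm₀
  set ε := 1 / (4 * Real.log σ * m₀ + 1) with hεdef
  have hε : 0 < ε := by positivity
  obtain ⟨αr, hαr, hret⟩ := hret δ₀ hδ₀ (min_le_right _ _) A hA.le m₀ ε hε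
  obtain ⟨N₀, hN₀⟩ := exists_nat_ge
    ((|Real.log c₁| / 2 + 4 * (Real.log d * (K / (1 - τ))) + 2) / (Real.log σ / 2))
  rw [div_le_iff₀' (half_pos hs)] at hN₀
  obtain ⟨αm, hαm, hmem⟩ := exists_fn_mem (by linarith) hβmap
  have hl0 : 0 < lam := by linarith
  refine ⟨min (min (min α₁ αp) (min αd αr)) (min (min αm (1 / (A + 1) ^ 2))
    (δ₀ / (5 * lam ^ (N₀ + 1)))), by positivity, ?_⟩
  rintro α hα hαlt X ⟨n, hn, j, -, x₀, hx₀, hX⟩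
  simp only [lt_min_iff] at hαlt
  obtain ⟨⟨⟨hα1, hα2⟩, hα3, hα4⟩, ⟨hα5, hα6⟩, hα7⟩ := hαlt
  specialize hmem α hα.le hα5.le d φ hφb
  have hD : Dominated a d φ β C₁ R₁ α := ⟨hα, hmem, fun n θ x hx => by
    rw [← abs_deriv_fn]
    exact (hdom α hα hα1 θ x hx n).1⟩
  have hαA : A * √α ≤ 1 ∧ α < 1 := by
    have h1 : √α ≤ 1 / (A + 1) := by
      rw [Real.sqrt_le_left (by positivity), div_pow, one_pow]
      exact hα6.le
    have h2 : A * (1 / (A + 1)) ≤ 1 := by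
      rw [mul_one_div, div_le_one (by positivity)]
      linarith
    refine ⟨(mul_le_mul_of_nonneg_left h1 hA.le).trans h2, hα6.trans_le ?_⟩
    rw [div_le_one (by positivity)]
    exact one_le_pow₀ (by linarith)
  have h5α : (0 : ℝ) < 5 * α := by positivity
  have hlow : lam ^ (N₀ + 1) ≤ δ₀ / (5 * α) := by
    rw [lt_div_iff₀ (by positivity)] at hα7
    rw [le_div_iff₀ h5α]
    linarith only [hα7]
  obtain ⟨N, hN1, hN2⟩ := exists_nat_pow_near ((one_le_pow₀ hl.le).trans hlow) hl
  have hNN : N₀ + 1 ≤ N :=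
    Nat.lt_succ_iff.1 ((pow_lt_pow_iff_right₀ hl).1 (hlow.trans_lt hN2))
  rw [le_div_iff₀ h5α] at hN1
  rw [div_lt_iff₀ h5α] at hN2
  obtain ⟨hsep, Cα, hCα, hdet⟩ := hdet α hα hα3.le N hN1 hN2
  have hN : (1 : ℝ) ≤ N := by exact_mod_cast (Nat.le_add_left 1 N₀).trans hNN
  set w := 1 / (8 * N * (Real.log d + Real.log σ * m₀)) with hwdef
  have hw : 0 < w := by positivity
  have hw1 : 8 * N * (Real.log d + Real.log σ * m₀) * w = 1 := by
    rw [hwdef, mul_one_div, div_self (by positivity)]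
  have hX' : IsIntCurve a d φ α β fun t => fn a d φ α n ((t + (j : ℤ)) / (d : ℝ) ^ n) x₀ :=
    ⟨n, by omega, j, x₀, hx₀, fun _ => rfl⟩
  have hae := hX'.ae_eventually_visits_le hd hφp hmem hA.le hα hαA.2 hαA.1 hK.le hτ hτ1 hε.le hw
    (fun Y hY => (hpow a β α hD hα2.le Y hY).1) (fun Y hY => (hpow a β α hD hα2.le Y hY).2)
    (fun Y hY hYm hY0 => hret C₁ R₁ α hD hα4.le N hN1 hN2 Y hYm hY0 (hpow a β α hD hα2.le Y hY).1)
  filter_upwards [hae, ae_restrict_mem measurableSet_Ico] with θ hθ hθI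
  have hXθ : fn a d φ α n ((θ + (j : ℤ)) / (d : ℝ) ^ n) x₀ = X θ := by
    rw [hX θ hθI, Int.cast_natCast]
  simp only [hXθ] at hθ
  have hXmem : X θ ∈ Icc (-β) β := hXθ ▸ hmem _ _ _ hx₀
  have hpo := pseudoOrbit_fn (θ := θ) (d := d) hα.le hφb fun i => hmem i θ _ hXmem
  simp only [abs_deriv_fn]
  refine liminf_pos_of_linear_growth (κ := 1 / N) (M := Real.log 4)
    (B := |Real.log Cα| + Real.log d * (K / (1 - τ)) + 1 + Real.log σ * (N + m₀)) (by positivity)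
    (Real.log_nonneg (by norm_num)) (hθ.mono fun k hk => ?_) (log_dprod_le hβ' hpo.mem)
  have := log_dprod_ge_of_visits (D := d) (by linarith) hα hc₁ hσ hCα hK.le hτ hτ1 hε.le hw.le
    (by exact_mod_cast hN) (hdet _ hpo)
    (fun i hi l hl1 hl2 => hsep _ (hpo.shift i) hi l hl1 hl2) hk.1 hk.2 ?_ hm₀ ?_ ?_ ?_
  · rwa [one_div_mul_eq_div]
  · have : (N₀ : ℝ) ≤ N := by exact_mod_cast (Nat.le_succ N₀).trans hNN
    have := mul_le_mul_of_nonneg_left this (half_pos hs).le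
    linarith only [this, hN₀]
  · rw [hεdef, mul_one_div, div_le_one (by positivity)]
    linarith
  · have : 0 ≤ (N : ℝ) * (Real.log σ * m₀) * w := by positivity
    linarith only [this, hw1]
  · have : 0 ≤ (N : ℝ) * Real.log d * w := by positivity
    linarith only [this, hw1]
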